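/- Let K be a field and α, β, γ ∈ K with β ≠ 0, and suppose the polynomial X² − αX − β has roots r, s ∈ K. Assume that if α + β = 1 and γ ≠ 0, then β is a root of unity. Then every finitely generated monolithic module over the down-up algebra A(α, β, γ) is Artinian if and only if r and s are both roots of unity. -/

import Mathlib

noncomputable section

open FreeAlgebra

/-- Defining relations of the down-up algebra `A(α, β, γ)`: the generator `ι K 0`
plays the role of `d` and `ι K 1` plays the role of `u`. -/
inductive DownUpRel (K : Type) [Field K] (α β γ : K) :
    FreeAlgebra K (Fin 2) → FreeAlgebra K (Fin 2) → Prop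
  | rel1 : DownUpRel K α β γ
      (ι K (0 : Fin 2) * ι K (0 : Fin 2) * ι K (1 : Fin 2))
      (α • (ι K (0 : Fin 2) * ι K (1 : Fin 2) * ι K (0 : Fin 2)) +
        β • (ι K (1 : Fin 2) * ι K (0 : Fin 2) * ι K (0 : Fin 2)) +
        γ • ι K (0 : Fin 2))
  | rel2 : DownUpRel K α β γ
      (ι K (0 : Fin 2) * ι K (1 : Fin 2) * ι K (1 : Fin 2))
      (α • (ι K (1 : Fin 2) * ι K (0 : Fin 2) * ι K (1 : Fin 2)) +
        β • (ι K (1 : Fin 2) * ι K (1 : Fin 2) * ι K (0 : Fin 2)) +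
        γ • ι K (1 : Fin 2))

/-- The down-up algebra `A(α, β, γ)`. -/
abbrev DownUpAlgebra (K : Type) [Field K] (α β γ : K) : Type :=
  RingQuot (DownUpRel K α β γ)

/-- The generator `d` of the down-up algebra. -/
def DownUpAlgebra.d (K : Type) [Field K] (α β γ : K) : DownUpAlgebra K α β γ :=
  RingQuot.mkAlgHom K (DownUpRel K α β γ) (ι K (0 : Fin 2))

/-- The generator `u` of the down-up algebra. -/
def DownUpAlgebra.u (K : Type) [Field K] (α β γ : K) : DownUpAlgebra K α β γ :=
  RingQuot.mkAlgHom K (DownUpRel K α β γ) (ι K (1 : Fin 2))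

section

open Polynomial

/-- A generalized Weyl algebra datum over `K[z][x]` inside a `K`-algebra `D`: a copy of the
polynomial ring acting through `ev`, with `z` central, and two elements `U`, `V` shifting `x` by
`±c(z)` whose two products are polynomials in `z` and `x`. -/
structure GenWeylDatum (K D : Type) [Field K] [Ring D] [Algebra K D] where
  /-- evaluation of polynomials in `z` (inner variable) and `x` (outer variable) -/
  ev : K[X][X] →ₐ[K] D
  /-- the raising element -/
  U : D
  /-- the lowering element -/
  V : D
  /-- the shift -/
  c : K[X]
  /-- the polynomial giving `V * U` -/
  a : K[X][X]
  /-- the polynomial giving `U * V` -/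
  b : K[X][X]
  central : ∀ (f : K[X]) (w : D), ev (C f) * w = w * ev (C f)
  X_mul_U : ev X * U = U * ev (X + C c)
  V_mul_X : V * ev X = ev (X + C c) * V
  V_mul_U : V * U = ev a
  U_mul_V : U * V = ev b
  taylor_b : taylor c b = a
  adjoin_eq_top : Algebra.adjoin K (Set.range ev ∪ {U, V}) = ⊤

namespace GenWeylDatum

variable {K D : Type} [Field K] [Ring D] [Algebra K D] (G : GenWeylDatum K D)

lemma ev_mul_U (f : K[X][X]) : G.ev f * G.U = G.U * G.ev (taylor G.c f) := by
  induction f using Polynomial.induction_on' with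
  | add p q hp hq => simp only [map_add, add_mul, mul_add, hp, hq]
  | monomial n g =>
    have key : ∀ k : ℕ, G.ev X ^ k * G.U = G.U * G.ev (X + C G.c) ^ k := by
      intro k
      induction k with
      | zero => simp
      | succ k ih => rw [pow_succ, mul_assoc, G.X_mul_U, ← mul_assoc, ih, mul_assoc, ← pow_succ]
    rw [← C_mul_X_pow_eq_monomial, map_mul, map_pow, mul_assoc, key, ← mul_assoc, G.central,
      taylor_mul, taylor_C, map_mul, taylor_X_pow, map_pow, mul_assoc]

lemma V_mul_ev (f : K[X][X]) : G.V * G.ev f = G.ev (taylor G.c f) * G.V := by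
  induction f using Polynomial.induction_on' with
  | add p q hp hq => simp only [map_add, add_mul, mul_add, hp, hq]
  | monomial n g =>
    have key : ∀ k : ℕ, G.V * G.ev X ^ k = G.ev (X + C G.c) ^ k * G.V := by
      intro k
      induction k with
      | zero => simp
      | succ k ih =>
        rw [pow_succ, ← mul_assoc, ih, mul_assoc, G.V_mul_X, ← mul_assoc, ← pow_succ]
    rw [← C_mul_X_pow_eq_monomial, map_mul, map_pow, ← mul_assoc, ← G.central, mul_assoc, key,
      taylor_mul, taylor_C, map_mul, taylor_X_pow, map_pow, mul_assoc]

lemma U_mul_ev (f : K[X][X]) : G.U * G.ev f = G.ev (taylor (-G.c) f) * G.U := by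
  rw [ev_mul_U, taylor_taylor, add_neg_cancel, taylor_zero]

lemma ev_mul_V (f : K[X][X]) : G.ev f * G.V = G.V * G.ev (taylor (-G.c) f) := by
  rw [V_mul_ev, taylor_taylor, add_neg_cancel, taylor_zero]

lemma U_pow_mul_ev (k : ℕ) (f : K[X][X]) :
    G.U ^ k * G.ev f = G.ev (taylor (-(k * G.c)) f) * G.U ^ k := by
  induction k with
  | zero => simp
  | succ k ih =>
    rw [pow_succ', mul_assoc, ih, ← mul_assoc, U_mul_ev, taylor_taylor, mul_assoc, ← pow_succ']
    push_cast
    ring_nf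

/-- The datum with the roles of `U` and `V` exchanged. -/
def swap : GenWeylDatum K D where
  ev := G.ev
  U := G.V
  V := G.U
  c := -G.c
  a := G.b
  b := G.a
  central := G.central
  X_mul_U := by rw [ev_mul_V, taylor_X]
  V_mul_X := by rw [U_mul_ev, taylor_X]
  V_mul_U := G.U_mul_V
  U_mul_V := G.V_mul_U
  taylor_b := by rw [← G.taylor_b, taylor_taylor, neg_add_cancel, taylor_zero]
  adjoin_eq_top := by rw [Set.pair_comm]; exact G.adjoin_eq_top

lemma ev_mul_U_pow (k : ℕ) (f : K[X][X]) :
    G.ev f * G.U ^ k = G.U ^ k * G.ev (taylor (k * G.c) f) := by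
  rw [U_pow_mul_ev, taylor_taylor, neg_add_cancel, taylor_zero]

lemma V_pow_mul_ev (k : ℕ) (f : K[X][X]) :
    G.V ^ k * G.ev f = G.ev (taylor (k * G.c) f) * G.V ^ k := by
  have := G.swap.U_pow_mul_ev k f
  simpa [swap] using this

lemma ev_mul_V_pow (k : ℕ) (f : K[X][X]) :
    G.ev f * G.V ^ k = G.V ^ k * G.ev (taylor (-(k * G.c)) f) := by
  have := G.swap.ev_mul_U_pow k f
  simpa [swap] using this

/-- The sequence `1, V, U, V², U², …`. -/
def word (j : ℕ) : D := if Even j then G.U ^ (j / 2) else G.V ^ ((j + 1) / 2)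

lemma word_two_mul (l : ℕ) : G.word (2 * l) = G.U ^ l := by simp [word]

lemma word_two_mul_add_one (l : ℕ) : G.word (2 * l + 1) = G.V ^ (l + 1) := by
  have : ¬ Even (2 * l + 1) := by simp
  rw [word, if_neg this]
  congr 1
  omega

lemma ev_mul_word (j : ℕ) (f : K[X][X]) : ∃ g, G.ev f * G.word j = G.word j * G.ev g := by
  rcases Nat.even_or_odd' j with ⟨l, rfl | rfl⟩
  · exact ⟨_, by rw [word_two_mul, ev_mul_U_pow]⟩
  · exact ⟨_, by rw [word_two_mul_add_one, ev_mul_V_pow]⟩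

lemma word_mul_ev (j : ℕ) (f : K[X][X]) : ∃ g, G.word j * G.ev f = G.ev g * G.word j := by
  rcases Nat.even_or_odd' j with ⟨l, rfl | rfl⟩
  · exact ⟨_, by rw [word_two_mul, U_pow_mul_ev]⟩
  · exact ⟨_, by rw [word_two_mul_add_one, V_pow_mul_ev]⟩

/-- The span of the first `j` words with polynomial coefficients. -/
def fil (j : ℕ) : Submodule K D :=
  Submodule.span K {w | ∃ i < j, ∃ f, w = G.word i * G.ev f}

lemma word_mul_ev_mem_fil {i j : ℕ} (h : i < j) (f : K[X][X]) :
    G.word i * G.ev f ∈ G.fil j :=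
  Submodule.subset_span ⟨i, h, f, rfl⟩

lemma fil_zero : G.fil 0 = ⊥ := by simp [fil]

lemma fil_mono {i j : ℕ} (h : i ≤ j) : G.fil i ≤ G.fil j :=
  Submodule.span_mono fun _ ⟨k, hk, f, hf⟩ => ⟨k, hk.trans_le h, f, hf⟩

lemma exists_of_mem_fil_succ {j : ℕ} {w : D} (hw : w ∈ G.fil (j + 1)) :
    ∃ v ∈ G.fil j, ∃ f, w = v + G.word j * G.ev f := by
  induction hw using Submodule.span_induction with
  | mem w hw =>
    obtain ⟨i, hi, f, rfl⟩ := hw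
    rcases Nat.lt_succ_iff_lt_or_eq.1 hi with h | rfl
    · exact ⟨_, G.word_mul_ev_mem_fil h f, 0, by simp⟩
    · exact ⟨0, zero_mem _, f, by simp⟩
  | zero => exact ⟨0, zero_mem _, 0, by simp⟩
  | add w₁ w₂ _ _ h₁ h₂ =>
    obtain ⟨v₁, hv₁, f₁, rfl⟩ := h₁
    obtain ⟨v₂, hv₂, f₂, rfl⟩ := h₂
    exact ⟨_, add_mem hv₁ hv₂, f₁ + f₂, by rw [map_add, mul_add]; abel⟩
  | smul k w _ h =>
    obtain ⟨v, hv, f, rfl⟩ := h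
    exact ⟨_, Submodule.smul_mem _ k hv, k • f, by rw [map_smul, mul_smul_comm, smul_add]⟩

lemma ev_mul_mem_fil (f : K[X][X]) {j : ℕ} {w : D} (hw : w ∈ G.fil j) :
    G.ev f * w ∈ G.fil j := by
  induction hw using Submodule.span_induction with
  | mem w hw =>
    obtain ⟨i, hi, g, rfl⟩ := hw
    obtain ⟨f', hf⟩ := G.ev_mul_word i f
    rw [← mul_assoc, hf, mul_assoc, ← map_mul]
    exact G.word_mul_ev_mem_fil hi _
  | zero => simp
  | add w₁ w₂ _ _ h₁ h₂ => rw [mul_add]; exact add_mem h₁ h₂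
  | smul k w _ h => rw [mul_smul_comm]; exact Submodule.smul_mem _ k h

lemma U_mul_mem_fil {j : ℕ} {w : D} (hw : w ∈ G.fil j) : G.U * w ∈ G.fil (j + 2) := by
  induction hw using Submodule.span_induction with
  | mem w hw =>
    obtain ⟨i, hi, g, rfl⟩ := hw
    rcases Nat.even_or_odd' i with ⟨l, rfl | rfl⟩
    · rw [word_two_mul, ← mul_assoc, ← pow_succ', ← word_two_mul]
      exact G.word_mul_ev_mem_fil (by omega) _
    · rw [word_two_mul_add_one, ← mul_assoc, pow_succ', ← mul_assoc, U_mul_V, ev_mul_V_pow,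
        mul_assoc, ← map_mul]
      rcases l with _ | l
      · rw [pow_zero, ← pow_zero G.U, ← word_two_mul]
        exact G.word_mul_ev_mem_fil (by omega) _
      · rw [← word_two_mul_add_one]
        exact G.word_mul_ev_mem_fil (by omega) _
  | zero => simp
  | add w₁ w₂ _ _ h₁ h₂ => rw [mul_add]; exact add_mem h₁ h₂
  | smul k w _ h => rw [mul_smul_comm]; exact Submodule.smul_mem _ k h

lemma V_mul_mem_fil {j : ℕ} {w : D} (hw : w ∈ G.fil j) : G.V * w ∈ G.fil (j + 2) := by
  induction hw using Submodule.span_induction with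
  | mem w hw =>
    obtain ⟨i, hi, g, rfl⟩ := hw
    rcases Nat.even_or_odd' i with ⟨l, rfl | rfl⟩
    · rw [word_two_mul]
      rcases l with _ | l
      · have := G.word_mul_ev_mem_fil (i := 2 * 0 + 1) (j := j + 2) (by omega) g
        rw [word_two_mul_add_one] at this
        simpa using this
      · rw [← mul_assoc, pow_succ', ← mul_assoc, V_mul_U, ev_mul_U_pow,
          mul_assoc, ← map_mul, ← word_two_mul]
        exact G.word_mul_ev_mem_fil (by omega) _
    · rw [word_two_mul_add_one, ← mul_assoc, ← pow_succ', ← word_two_mul_add_one]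
      exact G.word_mul_ev_mem_fil (by omega) _
  | zero => simp
  | add w₁ w₂ _ _ h₁ h₂ => rw [mul_add]; exact add_mem h₁ h₂
  | smul k w _ h => rw [mul_smul_comm]; exact Submodule.smul_mem _ k h

/-- Induction along left multiplication by the generators. -/
lemma mul_left_induction {p : D → Prop} (one : p 1)
    (add : ∀ v w, p v → p w → p (v + w)) (ev : ∀ f w, p w → p (G.ev f * w))
    (U : ∀ w, p w → p (G.U * w)) (V : ∀ w, p w → p (G.V * w)) (w : D) : p w := by
  suffices h : ∀ v ∈ Algebra.adjoin K (Set.range G.ev ∪ {G.U, G.V}), ∀ w, p w → p (v * w) by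
    simpa using h w (by rw [G.adjoin_eq_top]; trivial) 1 one
  intro v hv
  induction hv using Algebra.adjoin_induction with
  | mem x hx =>
    rcases hx with ⟨f, rfl⟩ | rfl | rfl
    · exact ev f
    · exact U
    · exact V
  | algebraMap r =>
    intro w hw
    have := ev (algebraMap K _ r) w hw
    rwa [AlgHom.commutes] at this
  | add x y _ _ hx hy => intro w hw; rw [add_mul]; exact add _ _ (hx w hw) (hy w hw)
  | mul x y _ _ hx hy => intro w hw; rw [mul_assoc]; exact hx _ (hy w hw)

lemma exists_mem_fil (w : D) : ∃ j, w ∈ G.fil j := by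
  refine G.mul_left_induction (p := fun w => ∃ j, w ∈ G.fil j) ⟨1, ?_⟩ ?_ ?_ ?_ ?_ w
  · simpa [word] using G.word_mul_ev_mem_fil (i := 0) (j := 1) (by omega) 1
  · rintro v w ⟨i, hi⟩ ⟨j, hj⟩
    exact ⟨max i j, add_mem (G.fil_mono (le_max_left _ _) hi) (G.fil_mono (le_max_right _ _) hj)⟩
  · rintro f w ⟨j, hj⟩
    exact ⟨j, G.ev_mul_mem_fil f hj⟩
  · rintro w ⟨j, hj⟩
    exact ⟨_, G.U_mul_mem_fil hj⟩
  · rintro w ⟨j, hj⟩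
    exact ⟨_, G.V_mul_mem_fil hj⟩

/-- The ideal of leading coefficients at the word `j` of a left ideal. -/
def leadIdeal (I : Submodule D D) (j : ℕ) : Ideal K[X][X] where
  carrier := {f | ∃ v ∈ I, ∃ w ∈ G.fil j, G.word j * G.ev f = v + w}
  zero_mem' := ⟨0, zero_mem _, 0, zero_mem _, by simp⟩
  add_mem' := by
    rintro f g ⟨v, hv, w, hw, h⟩ ⟨v', hv', w', hw', h'⟩
    exact ⟨_, add_mem hv hv', _, add_mem hw hw', by rw [map_add, mul_add, h, h']; abel⟩
  smul_mem' := by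
    rintro g f ⟨v, hv, w, hw, h⟩
    obtain ⟨g', hg⟩ := G.word_mul_ev j g
    refine ⟨G.ev g' * v, I.smul_mem _ hv, G.ev g' * w, G.ev_mul_mem_fil g' hw, ?_⟩
    rw [smul_eq_mul, map_mul, ← mul_assoc, hg, mul_assoc, h, mul_add]

lemma leadIdeal_mono {I I' : Submodule D D} (h : I ≤ I') (j : ℕ) :
    G.leadIdeal I j ≤ G.leadIdeal I' j :=
  fun _ ⟨v, hv, w, hw, e⟩ => ⟨v, h hv, w, hw, e⟩

lemma leadIdeal_le_add_two (I : Submodule D D) (j : ℕ) :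
    G.leadIdeal I j ≤ G.leadIdeal I (j + 2) := by
  rintro f ⟨v, hv, w, hw, h⟩
  rcases Nat.even_or_odd' j with ⟨l, rfl | rfl⟩
  · refine ⟨G.U * v, I.smul_mem _ hv, G.U * w, G.U_mul_mem_fil hw, ?_⟩
    rw [← mul_add, ← h, ← mul_assoc, word_two_mul, ← pow_succ', ← word_two_mul]
    rfl
  · refine ⟨G.V * v, I.smul_mem _ hv, G.V * w, G.V_mul_mem_fil hw, ?_⟩
    rw [← mul_add, ← h, ← mul_assoc, word_two_mul_add_one, ← pow_succ', ← word_two_mul_add_one]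
    rfl

lemma leadIdeal_mono_two_mul (I : Submodule D D) (e : ℕ) :
    Monotone fun l => G.leadIdeal I (2 * l + e) :=
  monotone_nat_of_le_succ fun l => by
    have := G.leadIdeal_le_add_two I (2 * l + e)
    rwa [show 2 * l + e + 2 = 2 * (l + 1) + e by ring] at this

lemma le_of_leadIdeal_le {I I' : Submodule D D} (hI : I ≤ I')
    (h : ∀ j, G.leadIdeal I' j ≤ G.leadIdeal I j) : I' ≤ I := by
  intro w hw
  obtain ⟨j, hj⟩ := G.exists_mem_fil w
  induction j generalizing w with
  | zero => rw [fil_zero, Submodule.mem_bot] at hj; rw [hj]; exact zero_mem _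
  | succ j ih =>
    obtain ⟨v, hv, f, rfl⟩ := G.exists_of_mem_fil_succ hj
    obtain ⟨i, hi, v', hv', e⟩ := h j (show f ∈ G.leadIdeal I' j from
      ⟨_, hw, -v, neg_mem hv, by abel⟩)
    have e' : v + G.word j * G.ev f = (v + v') + i := by rw [e]; abel
    rw [e'] at hw ⊢
    refine add_mem (ih ?_ (add_mem hv hv')) hi
    simpa using sub_mem hw (hI hi)

/-- A generalized Weyl algebra is left Noetherian. -/
lemma isNoetherianRing (G : GenWeylDatum K D) : IsNoetherianRing D := by
  rw [isNoetherianRing_iff, ← monotone_stabilizes_iff_noetherian]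
  intro I
  have diag : ∀ e, ∃ n, ∀ k ≥ n, ∀ l ≥ n,
      G.leadIdeal (I k) (2 * l + e) = G.leadIdeal (I n) (2 * n + e) := by
    intro e
    have mono : ∀ {k l k' l' : ℕ}, k ≤ k' → l ≤ l' →
        G.leadIdeal (I k) (2 * l + e) ≤ G.leadIdeal (I k') (2 * l' + e) := fun hk hl =>
      (G.leadIdeal_mono (I.monotone hk) _).trans (G.leadIdeal_mono_two_mul _ e hl)
    obtain ⟨n, hn⟩ := WellFoundedGT.monotone_chain_condition
      (⟨fun n => G.leadIdeal (I n) (2 * n + e), fun a b h => mono h h⟩ : ℕ →o Ideal K[X][X])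
    refine ⟨n, fun k hk l hl => le_antisymm ?_ (mono hk hl)⟩
    have := hn (max k l) (hk.trans (le_max_left _ _))
    change G.leadIdeal (I n) _ = G.leadIdeal (I (max k l)) _ at this
    rw [this]
    exact mono (le_max_left _ _) (le_max_right _ _)
  have col : ∀ j, ∃ n, ∀ k ≥ n, G.leadIdeal (I k) j = G.leadIdeal (I n) j := by
    intro j
    obtain ⟨n, hn⟩ := WellFoundedGT.monotone_chain_condition
      (⟨fun n => G.leadIdeal (I n) j, fun a b h => G.leadIdeal_mono (I.monotone h) j⟩ :
        ℕ →o Ideal K[X][X])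
    exact ⟨n, fun k hk => (hn k hk).symm⟩
  choose d hd using diag
  choose m hm using col
  let N := max (max (d 0) (d 1)) ((Finset.range (2 * max (d 0) (d 1) + 2)).sup m)
  have main : ∀ k ≥ N, ∀ j, G.leadIdeal (I k) j = G.leadIdeal (I N) j := by
    intro k hk j
    by_cases hj : j < 2 * max (d 0) (d 1) + 2
    · have : m j ≤ N := le_trans (Finset.le_sup (Finset.mem_range.2 hj)) (le_max_right _ _)
      rw [hm j k (this.trans hk), hm j N this]
    · have h0 : d 0 ≤ N := (le_max_left _ _).trans (le_max_left _ _)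
      have h1 : d 1 ≤ N := (le_max_right _ _).trans (le_max_left _ _)
      rcases Nat.even_or_odd' j with ⟨l, rfl | rfl⟩
      · have hl : d 0 ≤ l := by have := le_max_left (d 0) (d 1); omega
        exact (hd 0 k (h0.trans hk) l hl).trans (hd 0 N h0 l hl).symm
      · have hl : d 1 ≤ l := by have := le_max_right (d 0) (d 1); omega
        exact (hd 1 k (h1.trans hk) l hl).trans (hd 1 N h1 l hl).symm
  exact ⟨N, fun k hk => le_antisymm (I.monotone hk)
    (G.le_of_leadIdeal_le (I.monotone hk) fun j => (main k hk j).le)⟩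

end GenWeylDatum

/-- `s` is a nonzero element which lies in every nonzero submodule of `M`. -/
def IsMonolithElement (R : Type*) {M : Type*} [Ring R] [AddCommGroup M] [Module R M] (s : M) :
    Prop :=
  s ≠ 0 ∧ ∀ m : M, m ≠ 0 → ∃ w : R, w • m = s

lemma IsMonolithElement.isNilpotent {R M : Type*} [Ring R] [AddCommGroup M] [Module R M]
    [IsNoetherian R M] {s : M} (hs : IsMonolithElement R s) {f : Module.End R M} (hf : f s = 0) :
    IsNilpotent f := by
  obtain ⟨n, hn⟩ := Filter.eventually_atTop.1 f.eventually_disjoint_ker_pow_range_pow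
  refine ⟨n + 1, LinearMap.ext fun m => ?_⟩
  by_contra hm
  obtain ⟨w, hw⟩ := hs.2 _ hm
  have h := Submodule.disjoint_def.1 (hn (n + 1) (Nat.le_succ n)) s
    (by rw [LinearMap.mem_ker, pow_succ, Module.End.mul_apply, hf, map_zero])
    (by rw [← hw, ← map_smul]; exact LinearMap.mem_range_self _ _)
  exact hs.1 h

/-- A finitely generated monolithic module over a commutative algebra of finite type is finite
dimensional. -/
lemma IsMonolithElement.finite_of_finiteType {K B P : Type*} [Field K] [CommRing B] [Algebra K B]
    [Algebra.FiniteType K B] [AddCommGroup P] [Module B P] [Module K P] [IsScalarTower K B P]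
    [Module.Finite B P] {s : P} (hs : IsMonolithElement B s) : Module.Finite K P := by
  have : IsNoetherianRing B := Algebra.FiniteType.isNoetherianRing K B
  let 𝔪 : Ideal B := LinearMap.ker (LinearMap.toSpanSingleton B P s)
  have mem : ∀ b, b ∈ 𝔪 ↔ b • s = 0 := fun b => Iff.rfl
  have hm : 𝔪.IsMaximal := by
    rw [Ideal.isMaximal_iff]
    refine ⟨by rw [mem, one_smul]; exact hs.1, fun J b hJ hb hbJ => ?_⟩
    obtain ⟨w, hw⟩ := hs.2 _ (mt (mem b).2 hb)
    have : 1 - w * b ∈ J := hJ (by rw [mem, sub_smul, mul_smul, hw, one_smul, sub_self])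
    simpa using add_mem this (J.mul_mem_left w hbJ)
  let Q := B ⧸ Module.annihilator B P
  let _ := Ideal.Quotient.field 𝔪
  have : Module.Finite K (B ⧸ 𝔪) := finite_of_finite_type_of_isJacobsonRing K (B ⧸ 𝔪)
  have hintegral : Algebra.IsIntegral K Q := by
    refine ⟨fun y => ?_⟩
    obtain ⟨b, rfl⟩ := Ideal.Quotient.mk_surjective y
    obtain ⟨q, hq, hq0⟩ := Algebra.IsIntegral.isIntegral (R := K) (Ideal.Quotient.mk 𝔪 b)
    have hqm : aeval b q ∈ 𝔪 := by
      rw [← Ideal.Quotient.eq_zero_iff_mem, ← hq0, ← aeval_def]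
      exact (aeval_algHom_apply (Ideal.Quotient.mkₐ K 𝔪) b q).symm
    obtain ⟨k, hk⟩ := hs.isNilpotent (f := Module.toModuleEnd B P (aeval b q))
      (by simpa using (mem _).1 hqm)
    refine ⟨q ^ k, hq.pow k, ?_⟩
    rw [← aeval_def]
    have : aeval ((Ideal.Quotient.mkₐ K (Module.annihilator B P)) b) (q ^ k) = 0 := by
      rw [aeval_algHom_apply, Ideal.Quotient.mkₐ_eq_mk, Ideal.Quotient.eq_zero_iff_mem,
        Module.mem_annihilator]
      intro m
      rw [map_pow]
      have := LinearMap.congr_fun hk m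
      rw [← map_pow] at this
      simpa using this
    exact this
  have : Module.Finite K Q := Algebra.IsIntegral.finite
  let _ : Module Q P := Module.quotientAnnihilator
  have : IsScalarTower B Q P := ⟨fun b y m => by
    obtain ⟨b', rfl⟩ := Ideal.Quotient.mk_surjective y
    exact smul_assoc b b' m⟩
  have : IsScalarTower K Q P := by
    refine ⟨fun k y m => ?_⟩
    obtain ⟨b, rfl⟩ := Ideal.Quotient.mk_surjective y
    exact smul_assoc k b m
  have : Module.Finite Q P := Module.Finite.of_restrictScalars_finite B Q P
  exact Module.Finite.trans Q P

lemma IsMonolithElement.finite_of_smul_comm {K D P : Type*} [Field K] [Ring D] [Algebra K D]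
    [Algebra.FiniteType K D] [AddCommGroup P] [Module D P] [Module K P] [IsScalarTower K D P]
    [Module.Finite D P] {s : P} (hs : IsMonolithElement D s)
    (hcomm : ∀ (v w : D) (m : P), v • w • m = w • v • m) : Module.Finite K P := by
  let φ : D →ₐ[K] Module.End K P := Algebra.lsmul K K P
  have hφ : ∀ w m, φ w m = w • m := fun _ _ => rfl
  let B := φ.range
  let _ : CommRing B :=
    { (inferInstance : Ring B) with
      mul_comm := by
        rintro ⟨_, v, rfl⟩ ⟨_, w, rfl⟩
        exact Subtype.ext (LinearMap.ext fun m => hcomm v w m) }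
  have : Algebra.FiniteType K B :=
    Algebra.FiniteType.of_surjective φ.rangeRestrict φ.rangeRestrict_surjective
  have : Module.Finite B P := by
    obtain ⟨T, hT⟩ := Module.Finite.fg_top (R := D) (M := P)
    refine ⟨T, eq_top_iff.2 fun m _ => ?_⟩
    have hm : m ∈ Submodule.span D (T : Set P) := hT ▸ trivial
    induction hm using Submodule.span_induction with
    | mem m hm => exact Submodule.subset_span hm
    | zero => exact zero_mem _
    | add m m' _ _ h h' => exact add_mem (h trivial) (h' trivial)
    | smul w m _ h => exact Submodule.smul_mem _ (φ.rangeRestrict w) (h trivial)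
  refine IsMonolithElement.finite_of_finiteType (B := B) (s := s) ⟨hs.1, fun m hm => ?_⟩
  obtain ⟨w, hw⟩ := hs.2 m hm
  exact ⟨φ.rangeRestrict w, hw⟩

/-- A nonzero submodule contains the monolith. -/
lemma IsMonolithElement.exists_of_submodule {R M : Type*} [Ring R] [AddCommGroup M] [Module R M]
    {s : M} (hs : IsMonolithElement R s) {N : Submodule R M} (hN : N ≠ ⊥) :
    ∃ h : s ∈ N, IsMonolithElement R (⟨s, h⟩ : N) := by
  obtain ⟨m, hm, hm0⟩ := N.ne_bot_iff.1 hN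
  obtain ⟨w, hw⟩ := hs.2 m hm0
  refine ⟨hw ▸ N.smul_mem w hm, fun h => hs.1 (congrArg Subtype.val h), fun m hm => ?_⟩
  obtain ⟨w, hw⟩ := hs.2 m fun h => hm (Subtype.ext h)
  exact ⟨w, Subtype.ext hw⟩

lemma Polynomial.C_dvd_taylor_sub {R : Type*} [CommRing R] (c : R) (f : R[X]) :
    C c ∣ taylor c f - f := by
  have := sub_dvd_eval_sub (X + C c) X (f.map C)
  rwa [eval_map, eval_map, ← comp, ← comp, comp_X, add_sub_cancel_left] at this

namespace GenWeylDatum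

variable {K D : Type} [Field K] [Ring D] [Algebra K D] (G : GenWeylDatum K D)
variable {P : Type} [AddCommGroup P] [Module D P]

/-- Multiplication by a polynomial in the central element `z`. -/
def zEnd (P : Type) [AddCommGroup P] [Module D P] : K[X] →+* Module.End D P where
  toFun f :=
    { toFun := fun m => G.ev (C f) • m
      map_add' := smul_add _
      map_smul' := fun w m => by simp only [← mul_smul, G.central, RingHom.id_apply] }
  map_one' := by ext m; simp
  map_mul' f g := by
    ext m
    change G.ev (C (f * g)) • m = G.ev (C f) • G.ev (C g) • m
    rw [C_mul, map_mul, mul_smul]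
  map_zero' := by ext m; simp
  map_add' f g := by ext m; simp [add_smul]

lemma zEnd_apply (f : K[X]) (m : P) : G.zEnd P f m = G.ev (C f) • m := rfl

/-- The torsion of `K[z][x] ⧸ J` over `K[z]` is bounded. -/
lemma exists_bound_torsion (J : Ideal K[X][X]) :
    ∃ h : K[X], h ≠ 0 ∧ ∀ g : K[X], g ≠ 0 → ∀ f, C g * f ∈ J → C h * f ∈ J := by
  let J' : Ideal K[X][X] :=
    { carrier := {f | ∃ g : K[X], g ≠ 0 ∧ C g * f ∈ J}
      zero_mem' := ⟨1, one_ne_zero, by simp⟩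
      add_mem' := by
        rintro f f' ⟨g, hg, h⟩ ⟨g', hg', h'⟩
        refine ⟨g * g', mul_ne_zero hg hg', ?_⟩
        have := add_mem (J.mul_mem_left (C g') h) (J.mul_mem_left (C g) h')
        convert this using 1
        rw [C_mul]; ring
      smul_mem' := by
        rintro r f ⟨g, hg, h⟩
        refine ⟨g, hg, ?_⟩
        rw [smul_eq_mul, mul_left_comm]
        exact J.mul_mem_left r h }
  obtain ⟨T, hT⟩ : J'.FG := IsNoetherian.noetherian J'
  have hmem : ∀ f ∈ T, ∃ g : K[X], g ≠ 0 ∧ C g * f ∈ J := fun f hf =>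
    (hT ▸ Ideal.subset_span hf : f ∈ J')
  choose! g hg hgJ using hmem
  refine ⟨∏ f ∈ T, g f, Finset.prod_ne_zero_iff.2 hg, fun g' hg' f hf => ?_⟩
  classical
  have hfT : f ∈ Ideal.span (T : Set K[X][X]) := hT ▸ (show f ∈ J' from ⟨g', hg', hf⟩)
  clear hf
  induction hfT using Submodule.span_induction with
  | mem f hf =>
    rw [← Finset.mul_prod_erase T g hf, C_mul, mul_right_comm]
    exact J.mul_mem_right _ (hgJ f hf)
  | zero => simp
  | add f₁ f₂ _ _ h₁ h₂ => rw [mul_add]; exact add_mem h₁ h₂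
  | smul r f _ h => rw [smul_eq_mul, mul_left_comm]; exact J.mul_mem_left _ h

lemma exists_bound_torsion_leadIdeal (I : Submodule D D) :
    ∃ h : K[X], h ≠ 0 ∧ ∀ j, ∀ g : K[X], g ≠ 0 → ∀ f, C g * f ∈ G.leadIdeal I j →
      C h * f ∈ G.leadIdeal I j := by
  choose h hh hJ using fun j => exists_bound_torsion (G.leadIdeal I j)
  have stab : ∀ e, ∃ n, ∀ l ≥ n, G.leadIdeal I (2 * l + e) = G.leadIdeal I (2 * n + e) := by
    intro e
    obtain ⟨n, hn⟩ := WellFoundedGT.monotone_chain_condition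
      (⟨_, G.leadIdeal_mono_two_mul I e⟩ : ℕ →o Ideal K[X][X])
    exact ⟨n, fun l hl => (hn l hl).symm⟩
  choose n hn using stab
  have red : ∀ j, ∃ i ∈ Finset.range (2 * n 0 + 2 * n 1 + 2),
      G.leadIdeal I j = G.leadIdeal I i := by
    intro j
    simp only [Finset.mem_range]
    rcases Nat.even_or_odd' j with ⟨l, rfl | rfl⟩
    · by_cases hl : n 0 ≤ l
      · exact ⟨2 * n 0 + 0, by omega, hn 0 l hl⟩
      · exact ⟨2 * l, by omega, rfl⟩
    · by_cases hl : n 1 ≤ l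
      · exact ⟨2 * n 1 + 1, by omega, hn 1 l hl⟩
      · exact ⟨2 * l + 1, by omega, rfl⟩
  refine ⟨∏ i ∈ Finset.range (2 * n 0 + 2 * n 1 + 2), h i,
    Finset.prod_ne_zero_iff.2 fun i _ => hh i, fun j g hg f hf => ?_⟩
  obtain ⟨i, hi, e⟩ := red j
  rw [e] at hf ⊢
  rw [← Finset.mul_prod_erase _ h hi, C_mul, mul_right_comm]
  exact Ideal.mul_mem_right _ _ (hJ i g hg f hf)

lemma exists_pow_smul_eq_ev_smul {s : P} {h : K[X]}
    (hh : ∀ j, ∀ g : K[X], g ≠ 0 → ∀ f,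
      C g * f ∈ G.leadIdeal (LinearMap.ker (LinearMap.toSpanSingleton D P s)) j →
      C h * f ∈ G.leadIdeal (LinearMap.ker (LinearMap.toSpanSingleton D P s)) j)
    {g : K[X]} (hg : g ≠ 0) {j : ℕ} {v : D} (hv : v ∈ G.fil (j + 1)) {f₀ : K[X][X]}
    (hv' : G.ev (C g) • v • s = G.ev f₀ • s) :
    ∃ (e : ℕ) (f : K[X][X]), G.ev (C (h ^ e)) • v • s = G.ev f • s := by
  induction j generalizing v f₀ with
  | zero =>
    obtain ⟨v', hv₀, f, rfl⟩ := G.exists_of_mem_fil_succ hv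
    rw [fil_zero, Submodule.mem_bot] at hv₀
    exact ⟨0, f, by simp [hv₀, word]⟩
  | succ j ih =>
    obtain ⟨v', hvj, f, rfl⟩ := G.exists_of_mem_fil_succ hv
    have hf : C g * f ∈ G.leadIdeal (LinearMap.ker (LinearMap.toSpanSingleton D P s)) (j + 1) := by
      refine ⟨G.ev (C g) * (v' + G.word (j + 1) * G.ev f) - G.ev f₀, ?_,
        G.ev f₀ - G.ev (C g) * v', ?_, ?_⟩
      · simp [sub_smul, mul_smul, hv']
      · refine sub_mem ?_ (G.ev_mul_mem_fil _ hvj)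
        simpa [word] using G.word_mul_ev_mem_fil (i := 0) (Nat.succ_pos j) f₀
      · rw [map_mul, ← mul_assoc, ← G.central]; noncomm_ring
    obtain ⟨i, hi, w, hw, e⟩ := hh _ g hg f hf
    have key : G.ev (C h) * (v' + G.word (j + 1) * G.ev f) = (G.ev (C h) * v' + w) + i := by
      rw [mul_add, ← mul_assoc, G.central h (G.word (j + 1)), mul_assoc, ← map_mul, e]
      abel
    have key' : G.ev (C h) • (v' + G.word (j + 1) * G.ev f) • s
        = (G.ev (C h) * v' + w) • s := by
      have hi' : i • s = 0 := hi
      rw [← mul_smul, key, add_smul, hi', add_zero]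
    obtain ⟨e', f', he⟩ := ih (v := G.ev (C h) * v' + w) (f₀ := C h * f₀)
      (add_mem (G.ev_mul_mem_fil _ hvj) hw) (by
        rw [← key', ← mul_smul, ← map_mul, ← C_mul, mul_comm, C_mul, map_mul, mul_smul, hv',
          map_mul, mul_smul])
    exact ⟨e' + 1, f', by rw [← he, ← key', pow_succ, C_mul, map_mul, mul_smul]⟩

/-- A polynomial in the central variable kills any element generating a simple module. -/
lemma exists_irreducible_smul_eq_zero {s : P} (hs : s ≠ 0)
    (hsimple : ∀ w : D, w • s ≠ 0 → ∃ w' : D, w' • w • s = s) :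
    ∃ p : K[X], Irreducible p ∧ G.ev (C p) • s = 0 := by
  let J : Ideal K[X] := 
    { carrier := {f | G.ev (C f) • s = 0}
      zero_mem' := by simp
      add_mem' := by
        intro f g hf hg
        simp only [Set.mem_ofPred_eq, map_add, add_smul] at *
        rw [hf, hg, add_zero]
      smul_mem' := by
        intro g f hf
        simp only [Set.mem_ofPred_eq, smul_eq_mul, map_mul, mul_smul] at *
        rw [hf, smul_zero] }
  have memJ : ∀ f, f ∈ J ↔ G.ev (C f) • s = 0 := fun f => Iff.rfl
  have hJ : J.IsPrime := by
    refine ⟨fun h => hs ?_, fun {f g} hfg => ?_⟩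
    · have : (1 : K[X]) ∈ J := h ▸ trivial
      simpa [memJ] using this
    · rw [or_iff_not_imp_right]
      intro hg
      obtain ⟨w, hw⟩ := hsimple _ (mt (memJ g).2 hg)
      rw [memJ] at hfg ⊢
      rw [← hw, ← mul_smul, G.central, mul_smul, ← mul_smul (G.ev (C f)), ← map_mul, ← C_mul,
        hfg, smul_zero]
  by_cases hJ0 : J = ⊥
  swap
  · exact ⟨_, (Submodule.IsPrincipal.prime_generator_of_isPrime J hJ0).irreducible,
      (memJ _).1 (Submodule.IsPrincipal.generator_mem J)⟩
  exfalso
  have inj : ∀ f : K[X], f ≠ 0 → G.ev (C f) • s ≠ 0 := fun f hf h => by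
    have : f ∈ J := h
    rw [hJ0] at this
    exact hf this
  obtain ⟨h, hh, hbound⟩ :=
    G.exists_bound_torsion_leadIdeal (LinearMap.ker (LinearMap.toSpanSingleton D P s))
  let I₀ : Ideal K[X][X] := Ideal.comap G.ev (LinearMap.ker (LinearMap.toSpanSingleton D P s))
  have memI₀ : ∀ f, f ∈ I₀ ↔ G.ev f • s = 0 := fun f => Iff.rfl
  have hrad : C h ∉ I₀.radical := by
    rintro ⟨e, he⟩
    rw [← C_pow, memI₀] at he
    exact inj _ (pow_ne_zero e hh) he
  have key : ∀ p : K[X], p ≠ 0 → ∃ (e : ℕ) (f : K[X][X]), C (h ^ e) - C p * f ∈ I₀ := by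
    intro p hp
    obtain ⟨v, hv⟩ := hsimple _ (inj p hp)
    rw [← mul_smul, ← G.central, mul_smul] at hv
    obtain ⟨j, hj⟩ := G.exists_mem_fil v
    obtain ⟨e, f, hf⟩ := G.exists_pow_smul_eq_ev_smul hbound hp (f₀ := 1)
      (G.fil_mono (Nat.le_succ j) hj) (by rw [hv, map_one, one_smul])
    refine ⟨e, f, ?_⟩
    rw [memI₀, map_sub, map_mul, sub_smul, mul_smul, ← hf, ← mul_smul, ← G.central, mul_smul, hv,
      sub_self]
  rw [I₀.radical_eq_jacobson, Ideal.jacobson, Ideal.mem_sInf] at hrad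
  push Not at hrad
  obtain ⟨𝔪, ⟨hI₀, hm⟩, hm'⟩ := hrad
  let _ := Ideal.Quotient.field 𝔪
  have : Algebra.FiniteType K K[X][X] :=
    Algebra.FiniteType.trans (S := K[X]) inferInstance inferInstance
  have : Module.Finite K (K[X][X] ⧸ 𝔪) := finite_of_finite_type_of_isJacobsonRing K _
  let φ : K[X] →ₐ[K] K[X][X] ⧸ 𝔪 := (Ideal.Quotient.mkₐ K 𝔪).comp CAlgHom
  have hφ : ∀ f, φ f = Ideal.Quotient.mk 𝔪 (C f) := fun f => rfl
  obtain ⟨q, hq, hq0⟩ := Algebra.IsIntegral.isIntegral (R := K) (φ X)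
  have hq1 : φ q = 0 := by rw [← hq0, ← aeval_def, aeval_algHom_apply, aeval_X_left_apply]
  obtain ⟨e, f, hf⟩ := key q hq.ne_zero
  have := hI₀ hf
  rw [← Ideal.Quotient.eq_zero_iff_mem, map_sub, map_mul, ← hφ, ← hφ, hq1, zero_mul, sub_zero,
    map_pow] at this
  exact hm' (Ideal.Quotient.eq_zero_iff_mem.1 (eq_zero_of_pow_eq_zero this))

lemma finiteType (G : GenWeylDatum K D) : Algebra.FiniteType K D := by
  have : Algebra.FiniteType K K[X][X] :=
    Algebra.FiniteType.trans (S := K[X]) inferInstance inferInstance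
  obtain ⟨T, hT⟩ := (this.out.map G.ev)
  classical
  refine ⟨⟨T ∪ {G.U, G.V}, ?_⟩⟩
  rw [← G.adjoin_eq_top, Finset.coe_union, Algebra.adjoin_union, Algebra.adjoin_union, hT,
    Algebra.map_top, ← AlgHom.coe_range, Algebra.adjoin_eq]
  simp

lemma ev_smul_eq_zero_of_dvd {f g : K[X][X]} (h : f ∣ g) {m : P} (hm : G.ev f • m = 0) :
    G.ev g • m = 0 := by
  obtain ⟨k, rfl⟩ := h
  rw [mul_comm, map_mul, mul_smul, hm, smul_zero]

lemma finite_of_c_smul_eq_zero [Module K P] [IsScalarTower K D P] [Module.Finite D P] {s : P}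
    (hs : IsMonolithElement D s) (hc : ∀ m : P, G.ev (C G.c) • m = 0) : Module.Finite K P := by
  have := G.finiteType
  have shift : ∀ f (m : P), G.ev (taylor G.c f) • m = G.ev f • m := fun f m => by
    rw [← sub_eq_zero, ← sub_smul, ← map_sub]
    exact G.ev_smul_eq_zero_of_dvd (C_dvd_taylor_sub _ _) (hc m)
  have evU : ∀ f (m : P), G.ev f • G.U • m = G.U • G.ev f • m := fun f m => by
    rw [← mul_smul, ev_mul_U, mul_smul, shift]
  have evV : ∀ f (m : P), G.ev f • G.V • m = G.V • G.ev f • m := fun f m => by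
    rw [← mul_smul G.V, V_mul_ev, mul_smul, shift]
  have UV : ∀ m : P, G.U • G.V • m = G.V • G.U • m := fun m => by
    rw [← mul_smul, ← mul_smul, U_mul_V, V_mul_U, ← G.taylor_b, shift]
  refine hs.finite_of_smul_comm (D := D) fun v w => ?_
  have step : ∀ v : D, (∀ f (m : P), G.ev f • v • m = v • G.ev f • m) →
      (∀ m : P, G.U • v • m = v • G.U • m) → (∀ m : P, G.V • v • m = v • G.V • m) →
      ∀ (w : D) (m : P), w • v • m = v • w • m := by
    intro v h1 h2 h3 w
    refine G.mul_left_induction (p := fun w => ∀ m : P, w • v • m = v • w • m)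
      (by simp) ?_ ?_ ?_ ?_ w
    · intro w w' h h' m
      rw [add_smul, h, h', add_smul, smul_add]
    · intro f w h m
      rw [mul_smul, h, h1, mul_smul]
    · intro w h m
      rw [mul_smul, h, h2, mul_smul]
    · intro w h m
      rw [mul_smul, h, h3, mul_smul]
  refine step w (fun f m => ?_) (fun m => ?_) (fun m => ?_) v
  · refine (step (G.ev f) (fun g m => ?_) (fun m => ?_) (fun m => ?_) w m).symm
    · rw [← mul_smul, ← mul_smul, ← map_mul, ← map_mul, mul_comm]
    · rw [evU]
    · rw [evV]
  · exact (step G.U evU (fun _ => rfl) (fun m => (UV m).symm) w m).symm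
  · exact (step G.V evV UV (fun _ => rfl) w m).symm

/-- A finitely generated monolithic module killed by a power of a divisor of the shift is finite
dimensional. -/
lemma finite_of_dvd_c [Module K P] [IsScalarTower K D P] [Module.Finite D P] {s : P}
    (hs : IsMonolithElement D s) {p : K[X]} (hp : p ∣ G.c) {k : ℕ}
    (hk : ∀ m : P, G.ev (C (p ^ k)) • m = 0) : Module.Finite K P := by
  have := G.isNoetherianRing
  induction k generalizing P with
  | zero => exact absurd (by simpa using hk s) hs.1
  | succ k ih =>
    let f : Module.End D P := G.zEnd P p
    have hf : ∀ m, f m = G.ev (C p) • m := fun m => rfl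
    have hker : Module.Finite K (LinearMap.ker f) := by
      by_cases h0 : LinearMap.ker f = ⊥
      · rw [h0]; infer_instance
      · obtain ⟨h, hs'⟩ := hs.exists_of_submodule h0
        refine G.finite_of_c_smul_eq_zero hs' fun m => Subtype.ext ?_
        exact G.ev_smul_eq_zero_of_dvd (_root_.map_dvd C hp) m.2
    have hrange : Module.Finite K (LinearMap.range f) := by
      by_cases h0 : LinearMap.range f = ⊥
      · rw [h0]; infer_instance
      · obtain ⟨h, hs'⟩ := hs.exists_of_submodule h0
        refine ih hs' ?_
        rintro ⟨_, m, rfl⟩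
        refine Subtype.ext ?_
        change G.ev (C (p ^ k)) • G.ev (C p) • m = 0
        rw [← mul_smul, ← map_mul, ← C_mul, ← pow_succ, hk]
    let e := (f.quotKerEquivRange.restrictScalars K)
    have : Module.Finite K (P ⧸ LinearMap.ker f) := Module.Finite.equiv e.symm
    have : Module.Finite K ((LinearMap.ker f).restrictScalars K) := hker
    have : Module.Finite K (P ⧸ (LinearMap.ker f).restrictScalars K) := ‹_›
    exact Module.Finite.of_submodule_quotient ((LinearMap.ker f).restrictScalars K)

end GenWeylDatum

lemma Polynomial.C_dvd_taylor_iff {R : Type*} [CommRing R] (p c : R) (f : R[X]) :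
    C p ∣ taylor c f ↔ C p ∣ f := by
  have key : ∀ (c : R) (f : R[X]), C p ∣ f → C p ∣ taylor c f := by
    rintro c _ ⟨g, rfl⟩
    rw [taylor_mul, taylor_C]
    exact dvd_mul_right _ _
  refine ⟨fun h => ?_, key c f⟩
  simpa [taylor_taylor] using key (-c) _ h

/-- A polynomial not divisible by the irreducible constant `p` is, up to a constant, congruent to
a monic one modulo `p`. -/
lemma Polynomial.exists_monic_of_not_C_dvd {K : Type*} [Field K] {p : K[X]} (hp : Irreducible p)
    {F : K[X][X]} (hF : ¬ C p ∣ F) :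
    ∃ (g : K[X]) (F' : K[X][X]), F'.Monic ∧ C p ∣ C g * F - F' := by
  have : Fact (Irreducible p) := ⟨hp⟩
  let φ := AdjoinRoot.mk p
  have hφ : ∀ f : K[X][X], f.map φ = 0 ↔ C p ∣ f := by
    intro f
    rw [C_dvd_iff_dvd_coeff, Polynomial.ext_iff]
    simp only [coeff_map, coeff_zero]
    exact forall_congr' fun i => AdjoinRoot.mk_eq_zero
  obtain ⟨g, hg⟩ := AdjoinRoot.mk_surjective (F.map φ).leadingCoeff⁻¹
  have hmonic : ((C g * F).map φ).Monic := by
    rw [Polynomial.map_mul, map_C, hg, mul_comm]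
    exact monic_mul_leadingCoeff_inv (mt (hφ F).1 hF)
  obtain ⟨F', h1, -, h2⟩ := lifts_and_natDegree_eq_and_monic
    ((mem_lifts _).2 ⟨C g * F, rfl⟩) hmonic
  exact ⟨g, F', h2, by rw [← hφ, Polynomial.map_sub, h1, sub_self]⟩

namespace GenWeylDatum

variable {K D : Type} [Field K] [Ring D] [Algebra K D] (G : GenWeylDatum K D)
variable {P : Type} [AddCommGroup P] [Module D P]

/-- Polynomials in `U` of degree less than `q` with coefficients on the left. -/
def lowU (q : ℕ) : Submodule K D :=
  Submodule.span K {w | ∃ j < q, ∃ f, w = G.ev f * G.U ^ j}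

lemma ev_mul_U_pow_mem_lowU {j q : ℕ} (h : j < q) (f : K[X][X]) :
    G.ev f * G.U ^ j ∈ G.lowU q :=
  Submodule.subset_span ⟨j, h, f, rfl⟩

lemma lowU_mono {q r : ℕ} (h : q ≤ r) : G.lowU q ≤ G.lowU r :=
  Submodule.span_mono fun _ ⟨j, hj, f, hf⟩ => ⟨j, hj.trans_le h, f, hf⟩

lemma ev_mul_U_pow_mul_mem_lowU (f : K[X][X]) (i : ℕ) {q : ℕ} {w : D} (hw : w ∈ G.lowU q) :
    G.ev f * G.U ^ i * w ∈ G.lowU (i + q) := by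
  induction hw using Submodule.span_induction with
  | mem w hw =>
    obtain ⟨j, hj, g, rfl⟩ := hw
    have : G.ev f * G.U ^ i * (G.ev g * G.U ^ j) =
        G.ev (f * taylor (-(i * G.c)) g) * G.U ^ (i + j) := by
      rw [mul_assoc, ← mul_assoc _ _ (G.U ^ j), U_pow_mul_ev, mul_assoc, ← pow_add, ← mul_assoc,
        ← map_mul]
    rw [this]
    exact G.ev_mul_U_pow_mem_lowU (by omega) _
  | zero => simp
  | add w w' _ _ h h' => rw [mul_add]; exact add_mem h h'
  | smul k w _ h => rw [mul_smul_comm]; exact Submodule.smul_mem _ _ h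

/-- Polynomials in `U` whose leading coefficient is a monic polynomial in `x`. -/
def IsUMonic (E : D) : Prop :=
  ∃ (q : ℕ) (F : K[X][X]), F.Monic ∧ E - G.ev F * G.U ^ q ∈ G.lowU q

variable {G} in
lemma IsUMonic.mul {E E' : D} (h : G.IsUMonic E) (h' : G.IsUMonic E') : G.IsUMonic (E * E') := by
  obtain ⟨q, F, hF, hE⟩ := h
  obtain ⟨q', F', hF', hE'⟩ := h'
  have top : ∀ i f, G.ev f * G.U ^ i * E' - G.ev (f * taylor (-(i * G.c)) F') * G.U ^ (i + q') ∈
      G.lowU (i + q') := by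
    intro i f
    convert G.ev_mul_U_pow_mul_mem_lowU f i hE' using 1
    rw [mul_sub, mul_assoc _ _ (G.ev F' * G.U ^ q'), ← mul_assoc _ (G.ev F') (G.U ^ q'),
      U_pow_mul_ev, mul_assoc _ _ (G.U ^ q'), ← pow_add, ← mul_assoc _ _ (G.U ^ (i + q')),
      ← map_mul]
  have low : ∀ w ∈ G.lowU q, w * E' ∈ G.lowU (q + q') := by
    intro w hw
    induction hw using Submodule.span_induction with
    | mem w hw =>
      obtain ⟨j, hj, g, rfl⟩ := hw
      rw [← sub_add_cancel (G.ev g * G.U ^ j * E')]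
      exact add_mem (G.lowU_mono (by omega) (top j g))
        (G.ev_mul_U_pow_mem_lowU (by omega) _)
    | zero => simp
    | add w w' _ _ h h' => rw [add_mul]; exact add_mem h h'
    | smul k w _ h => rw [smul_mul_assoc]; exact Submodule.smul_mem _ _ h
  refine ⟨q + q', F * taylor (-(q * G.c)) F', hF.mul ?_, ?_⟩
  · rw [Monic, leadingCoeff_taylor]; exact hF'
  · convert add_mem (top q F) (low _ hE) using 1
    noncomm_ring

/-- Every element is a combination of words with polynomial coefficients on the right. -/
lemma exists_eq_sum_word (w : D) :
    ∃ (n : ℕ) (f : ℕ → K[X][X]), 0 < n ∧ w = ∑ i ∈ Finset.range n, G.word i * G.ev (f i) := by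
  obtain ⟨n, hn⟩ := G.exists_mem_fil w
  suffices ∀ n, ∀ w ∈ G.fil n, ∃ f : ℕ → K[X][X],
      w = ∑ i ∈ Finset.range n, G.word i * G.ev (f i) by
    obtain ⟨f, hf⟩ := this (n + 1) w (G.fil_mono n.le_succ hn)
    exact ⟨n + 1, f, n.succ_pos, hf⟩
  intro n
  induction n with
  | zero => intro w hw; rw [fil_zero, Submodule.mem_bot] at hw; exact ⟨0, by simp [hw]⟩
  | succ n ih =>
    intro w hw
    obtain ⟨v, hv, g, rfl⟩ := G.exists_of_mem_fil_succ hw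
    obtain ⟨f, rfl⟩ := ih v hv
    refine ⟨Function.update f n g, ?_⟩
    rw [Finset.sum_range_succ, Function.update_self]
    congr 1
    refine Finset.sum_congr rfl fun i hi => ?_
    rw [Function.update_of_ne (Finset.mem_range.1 hi).ne]

lemma exists_U_pow_mul_V_pow {p : K[X]} (hp : Irreducible p) (hb : ¬ C p ∣ G.b) (n l : ℕ) :
    ∃ B, ¬ C p ∣ B ∧ G.U ^ (n + l) * G.V ^ l = G.ev B * G.U ^ n := by
  have hprime : Prime (C p) := prime_C_iff.2 hp.prime
  induction l with
  | zero => exact ⟨1, hprime.not_dvd_one, by simp⟩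
  | succ l ih =>
    obtain ⟨B, hB, e⟩ := ih
    refine ⟨taylor (-((n + l : ℕ) * G.c)) G.b * B, fun h => ?_, ?_⟩
    · rcases hprime.dvd_or_dvd h with h | h
      · exact hb ((C_dvd_taylor_iff _ _ _).1 h)
      · exact hB h
    · rw [map_mul, mul_assoc, ← e, ← mul_assoc, ← U_pow_mul_ev, ← U_mul_V, ← add_assoc, pow_succ,
        pow_succ']
      simp only [mul_assoc]

lemma exists_U_pow_mul_word {p : K[X]} (hp : Irreducible p) (hb : ¬ C p ∣ G.b) {n i : ℕ}
    (hi : i < n) : ∃ B, ¬ C p ∣ B ∧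
      G.U ^ n * G.word i = G.ev B * G.U ^ (if Even i then n + i / 2 else n - (i + 1) / 2) := by
  rcases Nat.even_or_odd' i with ⟨l, rfl | rfl⟩
  · rw [word_two_mul, if_pos (even_two_mul l), ← pow_add]
    exact ⟨1, (prime_C_iff.2 hp.prime).not_dvd_one, by simp⟩
  · rw [word_two_mul_add_one, if_neg (by simp)]
    obtain ⟨B, hB, e⟩ := G.exists_U_pow_mul_V_pow hp hb (n - (l + 1)) (l + 1)
    refine ⟨B, hB, ?_⟩
    rw [show n = n - (l + 1) + (l + 1) by omega, e]
    congr 2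
    omega

/-- An element with a coefficient not divisible by `p` acts, up to a left multiple, as a
`U`-monic element on the part killed by `p`. -/
lemma exists_isUMonic_of_not_dvd {p : K[X]} (hp : Irreducible p) (hb : ¬ C p ∣ G.b) {n : ℕ}
    (f : ℕ → K[X][X]) {i₀ : ℕ} (hi₀ : i₀ < n) (hf : ¬ C p ∣ f i₀) :
    ∃ v E : D, G.IsUMonic E ∧ ∀ m : P, G.ev (C p) • m = 0 →
      (v * ∑ i ∈ Finset.range n, G.word i * G.ev (f i)) • m = E • m := by
  classical
  have hprime : Prime (C p) := prime_C_iff.2 hp.prime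
  set e : ℕ → ℕ := fun i => if Even i then n + i / 2 else n - (i + 1) / 2 with he
  have hex : ∀ i, ∃ g : K[X][X], i < n → (C p ∣ g ↔ C p ∣ f i) ∧
      G.U ^ n * (G.word i * G.ev (f i)) = G.ev g * G.U ^ e i := by
    intro i
    by_cases hi : i < n
    · obtain ⟨B, hB, h⟩ := G.exists_U_pow_mul_word hp hb hi
      refine ⟨B * taylor (-(e i * G.c)) (f i), fun _ => ⟨?_, ?_⟩⟩
      · rw [hprime.dvd_mul, C_dvd_taylor_iff]
        tauto
      · rw [← mul_assoc, h, mul_assoc, U_pow_mul_ev, ← mul_assoc, ← map_mul]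
    · exact ⟨0, fun h => absurd h hi⟩
  choose g hg using hex
  have hinj : ∀ i < n, ∀ j < n, e i = e j → i = j := by
    intro i hi j hj hij
    simp only [he] at hij
    rcases Nat.even_or_odd' i with ⟨l, rfl | rfl⟩ <;>
      rcases Nat.even_or_odd' j with ⟨l', rfl | rfl⟩ <;> simp at hij <;> omega
  let s := (Finset.range n).filter fun i => ¬ C p ∣ f i
  obtain ⟨i₁, hi₁, hmax⟩ := s.exists_max_image e ⟨i₀, by simp [s, hi₀, hf]⟩
  have hi₁n : i₁ < n := by simpa using (Finset.mem_filter.1 hi₁).1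
  obtain ⟨k, F, hF, hkF⟩ := exists_monic_of_not_C_dvd hp
    (mt (hg i₁ hi₁n).1.1 (Finset.mem_filter.1 hi₁).2)
  refine ⟨G.ev (C k) * G.U ^ n,
    G.ev F * G.U ^ e i₁ + ∑ i ∈ s.erase i₁, G.ev (C k * g i) * G.U ^ e i,
    ⟨e i₁, F, hF, ?_⟩, fun m hm => ?_⟩
  · rw [add_sub_cancel_left]
    refine sum_mem fun i hi => G.ev_mul_U_pow_mem_lowU ?_ _
    obtain ⟨h1, h2⟩ := Finset.mem_erase.1 hi
    have hin : i < n := by simpa using (Finset.mem_filter.1 h2).1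
    exact lt_of_le_of_ne (hmax i h2) fun h => h1 (hinj i hin i₁ hi₁n h)
  · have hkill : ∀ (F : K[X][X]) (l : ℕ), C p ∣ F → (G.ev F * G.U ^ l) • m = 0 := by
      rintro _ l ⟨F, rfl⟩
      rw [map_mul, mul_assoc, G.central, mul_smul, hm, smul_zero]
    have hsum : ∀ i < n, (G.ev (C k) * G.U ^ n * (G.word i * G.ev (f i))) =
        G.ev (C k * g i) * G.U ^ e i := by
      intro i hi
      rw [mul_assoc, (hg i hi).2, ← mul_assoc, ← map_mul]
    rw [Finset.mul_sum, Finset.sum_smul, add_smul, Finset.sum_smul,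
      ← Finset.sum_subset (Finset.filter_subset (fun i => ¬ C p ∣ f i) (Finset.range n)),
      ← Finset.add_sum_erase _ _ hi₁, hsum i₁ hi₁n]
    · congr 1
      · rw [← sub_eq_zero, ← sub_smul, ← sub_mul, ← map_sub]
        exact hkill _ _ hkF
      · refine Finset.sum_congr rfl fun i hi => ?_
        rw [hsum i (by simpa using (Finset.mem_filter.1 (Finset.mem_of_mem_erase hi)).1)]
    · intro i hi hi'
      rw [hsum i (by simpa using hi)]
      refine hkill _ _ (dvd_mul_of_dvd_right ?_ _)
      rw [(hg i (by simpa using hi)).1]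
      by_contra h
      exact hi' (Finset.mem_filter.2 ⟨hi, h⟩)

/-- Every element of a monolithic module killed by a power of `p` is killed by a `U`-monic
element. -/
lemma exists_isUMonic_smul_eq_zero {p : K[X]} (hp : Irreducible p) (hb : ¬ C p ∣ G.b) {s : P}
    (hs : IsMonolithElement D s) (hps : G.ev (C p) • s = 0) {k : ℕ} {m : P}
    (hm : G.ev (C (p ^ k)) • m = 0) : ∃ E, G.IsUMonic E ∧ E • m = 0 := by
  have isUMonic_ev : ∀ F : K[X][X], F.Monic → G.IsUMonic (G.ev F) := fun F hF =>
    ⟨0, F, hF, by simp⟩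
  have onSocle : ∀ v : D, ∃ E, G.IsUMonic E ∧ E • v • s = 0 := by
    intro v
    by_cases hx : G.ev X • v • s = 0
    · exact ⟨_, isUMonic_ev X monic_X, hx⟩
    · obtain ⟨w, hw⟩ := hs.2 _ hx
      obtain ⟨n, f, hn, hf⟩ := G.exists_eq_sum_word (v * w)
      obtain ⟨v', E, hE, h⟩ := G.exists_isUMonic_of_not_dvd (P := P) hp hb (n := n)
        (fun i => f i * X - if i = 0 then 1 else 0) hn (by
          intro h
          have := C_dvd_iff_dvd_coeff _ _ |>.1 h 0
          simp at this
          exact hp.not_isUnit (isUnit_of_dvd_one this))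
      refine ⟨E, hE, ?_⟩
      rw [← h _ (by rw [← mul_smul, G.central, mul_smul, hps, smul_zero]), mul_smul]
      have e : ∑ i ∈ Finset.range n, G.word i * G.ev (f i * X - if i = 0 then 1 else 0) =
          v * w * G.ev X - 1 := by
        simp only [map_sub, map_mul, mul_sub, Finset.sum_sub_distrib, hf, Finset.sum_mul,
          mul_assoc]
        congr 1
        rw [Finset.sum_eq_single_of_mem 0 (Finset.mem_range.2 hn)
          (fun i _ hi => by simp [hi])]
        simp [word]
      rw [e, sub_smul, mul_smul, mul_smul, hw, one_smul, sub_self, smul_zero]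
  have base : ∀ m : P, G.ev (C p) • m = 0 → ∃ E, G.IsUMonic E ∧ E • m = 0 := by
    intro m hm
    by_cases hm0 : m = 0
    · exact ⟨_, isUMonic_ev 1 monic_one, by simp [hm0]⟩
    obtain ⟨w, hw⟩ := hs.2 m hm0
    obtain ⟨n, f, hn, rfl⟩ := G.exists_eq_sum_word w
    obtain ⟨i₀, hi₀, hf⟩ : ∃ i < n, ¬ C p ∣ f i := by
      by_contra! h
      refine hs.1 ?_
      rw [← hw, Finset.sum_smul]
      refine Finset.sum_eq_zero fun i hi => ?_
      rw [mul_smul, G.ev_smul_eq_zero_of_dvd (h i (by simpa using hi)) hm, smul_zero]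
    obtain ⟨v, E, hE, h⟩ := G.exists_isUMonic_of_not_dvd (P := P) hp hb f hi₀ hf
    obtain ⟨E', hE', h'⟩ := onSocle v
    exact ⟨E' * E, hE'.mul hE, by rw [mul_smul, ← h m hm, mul_smul, hw, h']⟩
  induction k generalizing m with
  | zero => exact ⟨_, isUMonic_ev 1 monic_one, by simpa using hm⟩
  | succ k ih =>
    obtain ⟨E, hE, h⟩ := ih (m := G.ev (C p) • m)
      (by rw [← mul_smul, ← map_mul, ← C_mul, ← pow_succ, hm])
    obtain ⟨E', hE', h'⟩ := base (E • m) (by rw [← mul_smul, G.central, mul_smul, h])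
    exact ⟨E' * E, hE'.mul hE, by rw [mul_smul, h']⟩

end GenWeylDatum

/-- `M` is exhausted by finite dimensional subspaces of linearly bounded dimension on which every
element of `R` has bounded degree. -/
def HasLinearGrowth (K R M : Type*) [Field K] [Ring R] [AddCommGroup M] [Module K M] [Module R M] :
    Prop :=
  ∃ (W : ℕ → Submodule K M) (e : ℕ), Monotone W ∧ (∀ x, ∃ n, x ∈ W n) ∧
    (∀ w : R, ∃ k, ∀ n, ∀ x ∈ W n, w • x ∈ W (n + k)) ∧
    ∀ n, Module.Finite K (W n) ∧ Module.finrank K (W n) ≤ e * (n + 1)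

lemma Submodule.finite_and_finrank_finset_sup_le {K M ι : Type*} [Field K] [AddCommGroup M]
    [Module K M] (T : Finset ι) (W : ι → Submodule K M) (e : ι → ℕ)
    (h : ∀ i ∈ T, Module.Finite K (W i) ∧ Module.finrank K (W i) ≤ e i) :
    Module.Finite K (T.sup W : Submodule K M) ∧
      Module.finrank K (T.sup W : Submodule K M) ≤ ∑ i ∈ T, e i := by
  classical
  induction T using Finset.induction_on with
  | empty => rw [Finset.sup_empty]; exact ⟨inferInstance, by simp⟩
  | insert i T hi ih =>
    obtain ⟨h1, h2⟩ := ih fun j hj => h j (Finset.mem_insert_of_mem hj)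
    obtain ⟨h3, h4⟩ := h i (Finset.mem_insert_self i T)
    rw [Finset.sup_insert, Finset.sum_insert hi]
    exact ⟨Submodule.finite_sup _ _,
      (Submodule.finrank_add_le_finrank_add_finrank _ _).trans (add_le_add h4 h2)⟩

namespace GenWeylDatum

variable {K D : Type} [Field K] [Ring D] [Algebra K D] (G : GenWeylDatum K D)
variable {P : Type} [AddCommGroup P] [Module D P] [Module K P]

/-- The span of the elements `f(z, x) U^l t` of weight less than `n`. -/
def levelU (N : ℕ) (t : P) (n : ℕ) : Submodule K P :=
  Submodule.span K {y | ∃ (f : K[X][X]) (l : ℕ), f.natDegree + N * l < n ∧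
    y = G.ev f • G.U ^ l • t}

variable {G} in
lemma mem_levelU {N : ℕ} {t : P} {n : ℕ} {f : K[X][X]} {l : ℕ} (h : f.natDegree + N * l < n) :
    G.ev f • G.U ^ l • t ∈ G.levelU N t n :=
  Submodule.subset_span ⟨f, l, h, rfl⟩

lemma levelU_mono (N : ℕ) (t : P) : Monotone (G.levelU N t) := fun _ _ h =>
  Submodule.span_mono fun _ ⟨f, l, hl, e⟩ => ⟨f, l, hl.trans_le h, e⟩

variable [IsScalarTower K D P]

lemma exists_lowU_smul_mem_levelU {q : ℕ} {L : D} (hL : L ∈ G.lowU q) (t : P) :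
    ∃ N₀, ∀ N ≥ N₀, ∀ (Q : K[X][X]) (l n : ℕ), Q.natDegree + N * (l + q) ≤ n →
      (G.ev Q * G.U ^ l * L) • t ∈ G.levelU N t n := by
  induction hL using Submodule.span_induction with
  | mem L hL =>
    obtain ⟨j, hj, g, rfl⟩ := hL
    refine ⟨g.natDegree + 1, fun N hN Q l n h => ?_⟩
    have e : (G.ev Q * G.U ^ l * (G.ev g * G.U ^ j)) • t =
        G.ev (Q * taylor (-(l * G.c)) g) • G.U ^ (l + j) • t := by
      rw [mul_assoc, ← mul_assoc _ _ (G.U ^ j), U_pow_mul_ev, mul_assoc, ← pow_add, ← mul_assoc,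
        ← map_mul, mul_smul]
    rw [e]
    refine mem_levelU ?_
    have h1 := natDegree_mul_le (p := Q) (q := taylor (-(l * G.c)) g)
    rw [natDegree_taylor] at h1
    obtain ⟨r, rfl⟩ : ∃ r, q = j + 1 + r := ⟨q - (j + 1), by omega⟩
    nlinarith [Nat.zero_le (N * r)]
  | zero => exact ⟨0, by simp⟩
  | add L L' _ _ h h' =>
    obtain ⟨N₀, h⟩ := h
    obtain ⟨N₀', h'⟩ := h'
    refine ⟨max N₀ N₀', fun N hN Q l n hn => ?_⟩
    rw [mul_add, add_smul]
    exact add_mem (h N ((le_max_left _ _).trans hN) Q l n hn)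
      (h' N ((le_max_right _ _).trans hN) Q l n hn)
  | smul k L _ h =>
    obtain ⟨N₀, h⟩ := h
    refine ⟨N₀, fun N hN Q l n hn => ?_⟩
    rw [mul_smul_comm, smul_assoc]
    exact Submodule.smul_mem _ _ (h N hN Q l n hn)

lemma ev_smul_mem_span {π : K[X]} (hπ : π ≠ 0) {y : P} (hy : G.ev (C π) • y = 0) {d : ℕ}
    {f : K[X][X]} (hf : f.degree < d) {S : Submodule K P}
    (hS : ∀ h < π.natDegree, ∀ i < d, G.ev (C (X ^ h) * X ^ i) • y ∈ S) : G.ev f • y ∈ S := by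
  by_cases hf0 : f = 0
  · simp [hf0]
  rw [as_sum_range_C_mul_X_pow' f ((natDegree_lt_iff_degree_lt hf0).2 hf), map_sum,
    Finset.sum_smul]
  refine sum_mem fun i hi => ?_
  generalize f.coeff i = g
  have e : G.ev (C g * X ^ i) • y = G.ev (C (g % π) * X ^ i) • y := by
    rw [← sub_eq_zero, ← sub_smul, ← map_sub, ← sub_mul, ← C_sub]
    refine G.ev_smul_eq_zero_of_dvd (dvd_mul_of_dvd_left (_root_.map_dvd C ?_) _) hy
    exact ⟨g / π, by rw [sub_eq_iff_eq_add, EuclideanDomain.div_add_mod]⟩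
  rw [e]
  by_cases hg : g % π = 0
  · simp [hg]
  rw [as_sum_range_C_mul_X_pow' (g % π) (natDegree_lt_natDegree hg (EuclideanDomain.mod_lt g hπ)),
    map_sum, Finset.sum_mul, map_sum, Finset.sum_smul]
  refine sum_mem fun h hh => ?_
  have e' : C (C ((g % π).coeff h) * X ^ h) * X ^ i =
      (g % π).coeff h • (C (X ^ h) * X ^ i : K[X][X]) := by
    rw [C_mul' _ (X ^ h), ← smul_C, smul_mul_assoc]
  rw [e', map_smul, smul_assoc]
  exact Submodule.smul_mem _ _ (hS h (Finset.mem_range.1 hh) i (Finset.mem_range.1 hi))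

/-- The levels of an element killed by a `U`-monic element grow linearly. -/
lemma exists_finrank_levelU_le {π : K[X]} (hπ : π ≠ 0) {t : P} (ht : G.ev (C π) • t = 0) {E : D}
    (hE : G.IsUMonic E) (hEt : E • t = 0) :
    ∃ N₀, ∀ N ≥ N₀, ∃ e, ∀ n, Module.Finite K (G.levelU N t n) ∧
      Module.finrank K (G.levelU N t n) ≤ e * (n + 1) := by
  classical
  obtain ⟨q, F, hF, hL⟩ := hE
  obtain ⟨N₀, hN₀⟩ := G.exists_lowU_smul_mem_levelU hL t
  refine ⟨max N₀ 1, fun N hN => ⟨π.natDegree * (q + F.natDegree), fun n => ?_⟩⟩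
  have hN1 : 1 ≤ N := (le_max_right _ _).trans hN
  let idx : ℕ → Finset (ℕ × ℕ × ℕ) := fun n => Finset.range π.natDegree ×ˢ
    ((Finset.range n ×ˢ Finset.range q) ∪ (Finset.range F.natDegree ×ˢ Finset.range n))
  let φ : ℕ × ℕ × ℕ → P := fun j => G.ev (C (X ^ j.1) * X ^ j.2.1) • G.U ^ j.2.2 • t
  let R : ℕ → Submodule K P := fun n => Submodule.span K ((idx n).image φ)
  have hR : ∀ n h i l, h < π.natDegree → (i < n ∧ l < q ∨ i < F.natDegree ∧ l < n) →
      G.ev (C (X ^ h) * X ^ i) • G.U ^ l • t ∈ R n := by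
    intro n h i l hh hil
    refine Submodule.subset_span (Finset.mem_coe.2 (Finset.mem_image.2 ⟨(h, i, l), ?_, rfl⟩))
    simp only [idx, Finset.mem_product, Finset.mem_union, Finset.mem_range]
    exact ⟨hh, hil⟩
  have hRmono : ∀ n, R n ≤ R (n + 1) := by
    intro n
    refine Submodule.span_mono (Finset.coe_subset.2 (Finset.image_subset_image ?_))
    intro j hj
    simp only [idx, Finset.mem_product, Finset.mem_union, Finset.mem_range] at hj ⊢
    omega
  have hkill : ∀ l, G.ev (C π) • G.U ^ l • t = 0 := fun l => by
    rw [← mul_smul, G.central, mul_smul, ht, smul_zero]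
  have hle : ∀ n, G.levelU N t n ≤ R n := by
    intro n
    induction n with
    | zero =>
      refine Submodule.span_le.2 ?_
      rintro _ ⟨f, l, h, rfl⟩
      omega
    | succ n ih =>
      refine Submodule.span_le.2 ?_
      rintro _ ⟨f, l, h, rfl⟩
      have hl : l < n + 1 := by nlinarith
      rw [SetLike.mem_coe]
      by_cases hlq : l < q
      · refine G.ev_smul_mem_span hπ (hkill l) (d := n + 1) ?_ ?_
        · refine degree_le_natDegree.trans_lt ?_
          have : f.natDegree < n + 1 := by omega
          exact_mod_cast this
        · exact fun h hh i hi => hR _ _ _ _ hh (Or.inl ⟨hi, hlq⟩)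
      · obtain ⟨l, rfl⟩ := Nat.exists_eq_add_of_le' (not_lt.1 hlq)
        set F' := taylor (-(l * G.c)) F with hF'
        have hmon : F'.Monic := by rw [Monic, hF', leadingCoeff_taylor]; exact hF
        have hdeg : F'.natDegree = F.natDegree := natDegree_taylor _ _
        have key : G.ev F' • G.U ^ (l + q) • t =
            -((G.U ^ l * (E - G.ev F * G.U ^ q)) • t) := by
          rw [pow_add, mul_smul, ← mul_smul, ← U_pow_mul_ev, mul_smul, mul_smul, sub_smul, hEt,
            zero_sub, smul_neg, neg_neg, mul_smul]
        rw [← modByMonic_add_div f F', map_add, add_smul, mul_comm F', map_mul,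
          mul_smul (G.ev (f /ₘ F')), key]
        refine add_mem ?_ ?_
        · refine G.ev_smul_mem_span hπ (hkill (l + q)) (d := F.natDegree) ?_ ?_
          · rw [← hdeg, ← degree_eq_natDegree hmon.ne_zero]
            exact degree_modByMonic_lt _ hmon
          · exact fun h hh i hi => hR _ _ _ _ hh (Or.inr ⟨hi, hl⟩)
        · refine hRmono n (ih ?_)
          rw [smul_neg, ← mul_smul, ← mul_assoc]
          refine neg_mem (hN₀ N ((le_max_left _ _).trans hN) _ _ _ ?_)
          rw [natDegree_divByMonic _ hmon]
          omega
  have hcard : (idx n).card ≤ π.natDegree * (q + F.natDegree) * (n + 1) := by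
    rw [Finset.card_product, mul_assoc, Finset.card_range]
    refine Nat.mul_le_mul_left _ ((Finset.card_union_le _ _).trans ?_)
    simp only [Finset.card_product, Finset.card_range]
    nlinarith
  have hfin : Module.Finite K (R n) := Module.Finite.span_finset K _
  refine ⟨Submodule.finiteDimensional_of_le (hle n), (Submodule.finrank_mono (hle n)).trans ?_⟩
  exact (finrank_span_finset_le_card _).trans (Finset.card_image_le.trans hcard)

lemma ev_smul_mem_levelU (N : ℕ) (t : P) {n : ℕ} (g : K[X][X]) {y : P}
    (hy : y ∈ G.levelU N t n) : G.ev g • y ∈ G.levelU N t (n + g.natDegree) := by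
  induction hy using Submodule.span_induction with
  | mem y hy =>
    obtain ⟨f, l, h, rfl⟩ := hy
    rw [← mul_smul, ← map_mul]
    refine mem_levelU ?_
    have := natDegree_mul_le (p := g) (q := f)
    omega
  | zero => simp
  | add y y' _ _ h h' => rw [smul_add]; exact add_mem h h'
  | smul k y _ h => rw [smul_comm]; exact Submodule.smul_mem _ _ h

lemma U_smul_mem_levelU (N : ℕ) (t : P) {n : ℕ} {y : P} (hy : y ∈ G.levelU N t n) :
    G.U • y ∈ G.levelU N t (n + N) := by
  induction hy using Submodule.span_induction with
  | mem y hy =>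
    obtain ⟨f, l, h, rfl⟩ := hy
    rw [← mul_smul, U_mul_ev, mul_smul, ← mul_smul G.U, ← pow_succ']
    refine mem_levelU ?_
    rw [natDegree_taylor, mul_add]
    omega
  | zero => simp
  | add y y' _ _ h h' => rw [smul_add]; exact add_mem h h'
  | smul k y _ h => rw [smul_comm]; exact Submodule.smul_mem _ _ h

lemma V_smul_mem_levelU {N : ℕ} (hN : G.a.natDegree ≤ N) (t : P) {n : ℕ} {y : P}
    (hy : y ∈ G.levelU N t n) :
    G.V • y ∈ G.levelU N t (n + N) ⊔ G.swap.levelU N t (n + N) := by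
  induction hy using Submodule.span_induction with
  | mem y hy =>
    obtain ⟨f, l, h, rfl⟩ := hy
    rw [← mul_smul, V_mul_ev, mul_smul]
    rcases l with _ | l
    · refine Submodule.mem_sup_right ?_
      rw [pow_zero, one_smul, ← pow_one G.V]
      refine mem_levelU (G := G.swap) (f := taylor G.c f) ?_
      rw [natDegree_taylor]
      omega
    · refine Submodule.mem_sup_left ?_
      rw [← mul_smul G.V, pow_succ', ← mul_assoc, V_mul_U, mul_smul, ← mul_smul, ← map_mul]
      refine mem_levelU ?_
      have := natDegree_mul_le (p := taylor G.c f) (q := G.a)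
      rw [natDegree_taylor] at this
      rw [mul_add] at h
      omega
  | zero => simp
  | add y y' _ _ h h' => rw [smul_add]; exact add_mem h h'
  | smul k y _ h => rw [smul_comm]; exact Submodule.smul_mem _ _ h

/-- A finitely generated monolithic module killed by a power of `p` has linear growth. -/
lemma hasLinearGrowth [Module.Finite D P] {p : K[X]} (hp : Irreducible p) (ha : ¬ C p ∣ G.a)
    (hb : ¬ C p ∣ G.b) {s : P} (hs : IsMonolithElement D s) (hps : G.ev (C p) • s = 0) {k : ℕ}
    (hk : ∀ m : P, G.ev (C (p ^ k)) • m = 0) : HasLinearGrowth K D P := by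
  obtain ⟨T, hT⟩ := Module.Finite.fg_top (R := D) (M := P)
  have hπ : p ^ k ≠ 0 := pow_ne_zero _ hp.ne_zero
  have bound : ∀ t : P, ∃ N₀, ∀ N ≥ N₀, ∃ e, ∀ n,
      Module.Finite K (G.levelU N t n ⊔ G.swap.levelU N t n : Submodule K P) ∧
      Module.finrank K (G.levelU N t n ⊔ G.swap.levelU N t n : Submodule K P) ≤ e * (n + 1) := by
    intro t
    obtain ⟨E, hE, hEt⟩ := G.exists_isUMonic_smul_eq_zero hp hb hs hps (hk t)
    obtain ⟨E', hE', hEt'⟩ := G.swap.exists_isUMonic_smul_eq_zero hp ha hs hps (hk t)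
    obtain ⟨N₁, h₁⟩ := G.exists_finrank_levelU_le hπ (hk t) hE hEt
    obtain ⟨N₂, h₂⟩ := G.swap.exists_finrank_levelU_le hπ (hk t) hE' hEt'
    refine ⟨max N₁ N₂, fun N hN => ?_⟩
    obtain ⟨e₁, h₁⟩ := h₁ N ((le_max_left _ _).trans hN)
    obtain ⟨e₂, h₂⟩ := h₂ N ((le_max_right _ _).trans hN)
    refine ⟨e₁ + e₂, fun n => ?_⟩
    obtain ⟨f₁, r₁⟩ := h₁ n
    obtain ⟨f₂, r₂⟩ := h₂ n
    refine ⟨Submodule.finite_sup _ _, (Submodule.finrank_add_le_finrank_add_finrank _ _).trans ?_⟩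
    rw [add_mul]
    exact add_le_add r₁ r₂
  choose N₀ hN₀ using bound
  let N := max (T.sup N₀) (max G.a.natDegree G.b.natDegree)
  have hNT : ∀ t ∈ T, N₀ t ≤ N := fun t ht => (Finset.le_sup ht).trans (le_max_left _ _)
  have hNa : G.a.natDegree ≤ N := (le_max_left _ _).trans (le_max_right _ _)
  have hNb : G.b.natDegree ≤ N := (le_max_right _ _).trans (le_max_right _ _)
  have : ∀ t, ∃ e, t ∈ T → ∀ n,
      Module.Finite K (G.levelU N t n ⊔ G.swap.levelU N t n : Submodule K P) ∧
      Module.finrank K (G.levelU N t n ⊔ G.swap.levelU N t n : Submodule K P) ≤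
        e * (n + 1) := by
    intro t
    by_cases ht : t ∈ T
    · obtain ⟨e, he⟩ := hN₀ t N (hNT t ht)
      exact ⟨e, fun _ => he⟩
    · exact ⟨0, fun h => absurd h ht⟩
  choose e he using this
  let Y : P → ℕ → Submodule K P := fun t n => G.levelU N t n ⊔ G.swap.levelU N t n
  let W : ℕ → Submodule K P := fun n => T.sup fun t => Y t n
  have hYW : ∀ t ∈ T, ∀ n, Y t n ≤ W n := fun t ht n =>
    Finset.le_sup (f := fun t => Y t n) ht
  have hYmono : ∀ t, Monotone (Y t) := fun t _ _ h =>
    sup_le_sup (G.levelU_mono N t h) (G.swap.levelU_mono N t h)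
  have hmono : Monotone W := fun i j h => Finset.sup_mono_fun fun t _ => hYmono t h
  have shift : ∀ (w : D) (j : ℕ), (∀ t n, ∀ y ∈ G.levelU N t n, w • y ∈ Y t (n + j)) →
      (∀ t n, ∀ y ∈ G.swap.levelU N t n, w • y ∈ Y t (n + j)) →
      ∀ n, ∀ y ∈ W n, w • y ∈ W (n + j) := by
    intro w j h1 h2 n
    have : W n ≤ (W (n + j)).comap (Algebra.lsmul K K P w) := by
      refine Finset.sup_le fun t ht => sup_le (fun y hy => ?_) fun y hy => ?_
      · exact hYW t ht _ (h1 t n y hy)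
      · exact hYW t ht _ (h2 t n y hy)
    exact this
  have hev : ∀ f, ∀ n, ∀ y ∈ W n, G.ev f • y ∈ W (n + f.natDegree) := fun f =>
    shift _ _ (fun t n y hy => Submodule.mem_sup_left (G.ev_smul_mem_levelU N t f hy))
      (fun t n y hy => Submodule.mem_sup_right (G.swap.ev_smul_mem_levelU N t f hy))
  have hU : ∀ n, ∀ y ∈ W n, G.U • y ∈ W (n + N) :=
    shift _ _ (fun t n y hy => Submodule.mem_sup_left (G.U_smul_mem_levelU N t hy))
      (fun t n y hy => by
        have := G.swap.V_smul_mem_levelU (N := N) hNb t hy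
        rwa [sup_comm] at this)
  have hV : ∀ n, ∀ y ∈ W n, G.V • y ∈ W (n + N) :=
    shift _ _ (fun t n y hy => G.V_smul_mem_levelU hNa t hy)
      (fun t n y hy => Submodule.mem_sup_right (G.swap.U_smul_mem_levelU N t hy))
  have hdeg : ∀ w : D, ∃ j, ∀ n, ∀ y ∈ W n, w • y ∈ W (n + j) := by
    intro w
    refine G.mul_left_induction (p := fun w => ∃ j, ∀ n, ∀ y ∈ W n, w • y ∈ W (n + j))
      ⟨0, fun n y hy => by simpa using hy⟩ ?_ ?_ ?_ ?_ w
    · rintro v w ⟨i, hi⟩ ⟨j, hj⟩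
      refine ⟨i + j, fun n y hy => ?_⟩
      rw [add_smul]
      exact add_mem (hmono (by omega) (hi n y hy)) (hmono (by omega) (hj n y hy))
    · rintro f w ⟨j, hj⟩
      refine ⟨j + f.natDegree, fun n y hy => ?_⟩
      rw [mul_smul, ← add_assoc]
      exact hev f _ _ (hj n y hy)
    · rintro w ⟨j, hj⟩
      refine ⟨j + N, fun n y hy => ?_⟩
      rw [mul_smul, ← add_assoc]
      exact hU _ _ (hj n y hy)
    · rintro w ⟨j, hj⟩
      refine ⟨j + N, fun n y hy => ?_⟩
      rw [mul_smul, ← add_assoc]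
      exact hV _ _ (hj n y hy)
  refine ⟨W, ∑ t ∈ T, e t, hmono, fun y => ?_, hdeg, fun n => ?_⟩
  · have hy : y ∈ Submodule.span D (T : Set P) := hT ▸ trivial
    induction hy using Submodule.span_induction with
    | mem t ht =>
      refine ⟨1, hYW t ht 1 (Submodule.mem_sup_left ?_)⟩
      simpa using mem_levelU (G := G) (N := N) (t := t) (f := 1) (l := 0) (n := 1) (by simp)
    | zero => exact ⟨0, zero_mem _⟩
    | add y y' _ _ h h' =>
      obtain ⟨n, h⟩ := h
      obtain ⟨n', h'⟩ := h'
      exact ⟨n + n', add_mem (hmono (by omega) h) (hmono (by omega) h')⟩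
    | smul w y _ h =>
      obtain ⟨n, h⟩ := h
      obtain ⟨j, hj⟩ := hdeg w
      exact ⟨_, hj n y h⟩
  · rw [Finset.sum_mul]
    exact Submodule.finite_and_finrank_finset_sup_le T (fun t => Y t n) _ fun t ht => he t ht n

end GenWeylDatum

/-- In characteristic zero, a nonzero polynomial over a field is coprime to its large shifts. -/
lemma Polynomial.exists_isCoprime_taylor {L : Type*} [Field L] [CharZero L] {f : L[X]} (hf : f ≠ 0)
    {c : L} (hc : c ≠ 0) : ∃ J : ℕ, ∀ m ≥ J, IsCoprime f (taylor (m * c) f) := by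
  classical
  let Ω := AlgebraicClosure L
  let φ := algebraMap L Ω
  have hφ : Function.Injective φ := φ.injective
  have hg : f.map φ ≠ 0 := (Polynomial.map_ne_zero_iff hφ).2 hf
  let Z : Finset Ω := (f.map φ).roots.toFinset
  have hinj : Function.Injective fun m : ℕ => (m : Ω) * φ c := fun m m' h => by
    have := mul_right_cancel₀ ((_root_.map_ne_zero φ).2 hc) h
    exact_mod_cast this
  let bad : Finset ℕ := ((Z ×ˢ Z).image fun y => y.1 - y.2).preimage _ hinj.injOn
  refine ⟨bad.sup id + 1, fun m hm => ?_⟩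
  rw [← isCoprime_map φ, isCoprime_iff_aeval_ne_zero_of_isAlgClosed Ω Ω]
  intro a
  by_contra! h
  obtain ⟨h1, h2⟩ := h
  rw [coe_aeval_eq_eval] at h1 h2
  rw [taylor_apply, map_comp, Polynomial.map_add, map_X, map_C, eval_comp, eval_add, eval_X,
    eval_C] at h2
  have hmem : m ∈ bad := by
    rw [Finset.mem_preimage, Finset.mem_image]
    refine ⟨(a + φ (m * c), a), Finset.mem_product.2 ⟨?_, ?_⟩, ?_⟩
    · exact Multiset.mem_toFinset.2 ((mem_roots hg).2 h2)
    · exact Multiset.mem_toFinset.2 ((mem_roots hg).2 h1)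
    · simp
  have := Finset.le_sup (f := id) hmem
  simp only [id] at this
  omega

/-- In characteristic zero, a polynomial over `K[z]` is comaximal with its large shifts
modulo any polynomial in `z` sharing no prime factor with the shift and the polynomial. -/
lemma Polynomial.exists_taylor_comaximal {K : Type*} [Field K] [CharZero K] {b : K[X][X]}
    {c π : K[X]} (hπ : π ≠ 0) (h : ∀ p, Prime p → p ∣ π → ¬ p ∣ c ∧ ¬ C p ∣ b) :
    ∃ J : ℕ, ∀ m ≥ J, ∃ u v w : K[X][X], u * b + v * taylor (m * c) b + w * C π = 1 := by
  induction π using UniqueFactorizationMonoid.induction_on_prime with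
  | h₁ => exact absurd rfl hπ
  | h₂ π hu =>
    obtain ⟨π', hπ'⟩ := hu.exists_left_inv
    exact ⟨0, fun m _ => ⟨0, 0, C π', by rw [← C_mul, hπ']; simp⟩⟩
  | h₃ π p hπ0 hp ih =>
    obtain ⟨J, hJ⟩ := ih hπ0 fun q hq hqπ => h q hq (dvd_mul_of_dvd_right hqπ _)
    obtain ⟨hpc, hpb⟩ := h p hp (dvd_mul_right _ _)
    have : Fact (Irreducible p) := ⟨hp.irreducible⟩
    let φ := AdjoinRoot.mk p
    have hφ : Function.Surjective φ := AdjoinRoot.mk_surjective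
    have hker : ∀ f : K[X][X], f.map φ = 0 → C p ∣ f := by
      intro f hf
      rw [C_dvd_iff_dvd_coeff]
      intro i
      rw [← AdjoinRoot.mk_eq_zero, ← coeff_map, hf, coeff_zero]
    have : CharZero (AdjoinRoot p) := charZero_of_injective_algebraMap (algebraMap K _).injective
    obtain ⟨J', hJ'⟩ := exists_isCoprime_taylor (f := b.map φ) (fun h => hpb (hker _ h)) (c := φ c)
      (fun h => hpc (AdjoinRoot.mk_eq_zero.1 h))
    refine ⟨max J J', fun m hm => ?_⟩
    obtain ⟨u, v, w, e⟩ := hJ m ((le_max_left _ _).trans hm)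
    obtain ⟨u', v', e'⟩ := hJ' m ((le_max_right _ _).trans hm)
    obtain ⟨u', rfl⟩ := map_surjective φ hφ u'
    obtain ⟨v', rfl⟩ := map_surjective φ hφ v'
    obtain ⟨w', hw'⟩ := hker (1 - (u' * b + v' * taylor (m * c) b)) (by
      rw [Polynomial.map_sub, Polynomial.map_add, Polynomial.map_mul, Polynomial.map_mul,
        Polynomial.map_one, sub_eq_zero, ← e', taylor_apply, taylor_apply, map_comp]
      simp)
    have e'' : u' * b + v' * taylor (m * c) b + w' * C p = 1 := by
      rw [mul_comm w', ← hw']; ring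
    set t := taylor (m * c) b
    refine ⟨u * (u' * b + v' * t + w' * C p) + w * C π * u',
      v * (u' * b + v' * t + w' * C p) + w * C π * v', w * w', ?_⟩
    rw [C_mul]
    linear_combination e * (u' * b + v' * t + w' * C p) + e''

lemma CommRing.exists_quotient_singleton {R : Type} [CommRing R] (x : R) :
    ∃ (Q : Type) (_ : CommRing Q) (q : R →+* Q),
      Function.Surjective q ∧ ∀ y, q y = 0 ↔ x ∣ y :=
  ⟨R ⧸ Ideal.span {x}, inferInstance, Ideal.Quotient.mk (Ideal.span {x}),
    Ideal.Quotient.mk_surjective, fun y => by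
    rw [Ideal.Quotient.eq_zero_iff_mem, Ideal.mem_span_singleton]⟩

/-- An endomorphism `u` of a finite dimensional space with `[y, u] = u` is nilpotent. -/
lemma LinearMap.isNilpotent_of_mul_eq_mul_add_one {K F : Type*} [Field K] [CharZero K]
    [AddCommGroup F] [Module K F] [Module.Finite K F] {y u : Module.End K F}
    (h : y * u = u * (y + 1)) : IsNilpotent u := by
  by_contra hu
  rw [IsNilpotent] at hu
  push Not at hu
  let ad : Module.End K (Module.End K F) := LinearMap.mulLeft K y - LinearMap.mulRight K y
  have hm : ∀ m : ℕ, y * u ^ m = u ^ m * (y + m) := by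
    intro m
    induction m with
    | zero => simp
    | succ m ih =>
      rw [pow_succ, ← mul_assoc, ih, mul_assoc, mul_assoc, add_mul, h, Nat.cast_comm]
      push_cast
      noncomm_ring
  have hev : ∀ m : ℕ, ad.HasEigenvalue (m : K) := fun m =>
    Module.End.hasEigenvalue_of_hasEigenvector (x := u ^ m) ⟨by
      rw [Module.End.mem_eigenspace_iff]
      simp only [ad, LinearMap.sub_apply, LinearMap.mulLeft_apply, LinearMap.mulRight_apply, hm,
        mul_add, add_sub_cancel_left]
      rw [← Nat.cast_comm, ← nsmul_eq_mul, Nat.cast_smul_eq_nsmul], hu m⟩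
  exact (Set.infinite_range_of_injective (Nat.cast_injective (R := K))).mono
    (Set.range_subset_iff.2 hev) ad.finite_hasEigenvalue

namespace GenWeylDatum

variable {K D : Type} [Field K] [Ring D] [Algebra K D] (G : GenWeylDatum K D)

lemma V_pow_mul_U_pow (N : ℕ) :
    G.V ^ N * G.U ^ N = G.ev (∏ i ∈ Finset.range N, taylor (i * G.c) G.a) := by
  induction N with
  | zero => simp
  | succ N ih =>
    rw [Finset.prod_range_succ, map_mul, ← ih, mul_assoc, ← ev_mul_U_pow, ← V_mul_U, pow_succ,
      pow_succ']
    simp only [mul_assoc]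

lemma U_pow_mul_V_pow (N : ℕ) :
    G.U ^ N * G.V ^ N = G.ev (∏ i ∈ Finset.range N, taylor (-(i * G.c)) G.b) := by
  simpa [swap] using G.swap.V_pow_mul_U_pow N

lemma isNilpotent_lsmul_U [CharZero K] {P : Type} [AddCommGroup P] [Module D P] [Module K P]
    [IsScalarTower K D P] [Module.Finite K P] {π : K[X]} (hcop : IsCoprime G.c π)
    (hk : ∀ m : P, G.ev (C π) • m = 0) : IsNilpotent (Algebra.lsmul K K P G.U) := by
  obtain ⟨g, g', hg⟩ := hcop
  refine LinearMap.isNilpotent_of_mul_eq_mul_add_one (K := K)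
    (y := Algebra.lsmul K K P (G.ev (C g * X))) (LinearMap.ext fun m => ?_)
  simp only [Module.End.mul_apply, LinearMap.add_apply, Module.End.one_apply, Algebra.lsmul_coe]
  have e : G.ev (C g * C G.c) • m = m := by
    have h1 : G.ev (C (g' * π)) • m = 0 :=
      G.ev_smul_eq_zero_of_dvd (_root_.map_dvd C (dvd_mul_left π g')) (hk m)
    rw [← C_mul, eq_sub_of_add_eq hg, C_sub, map_sub, sub_smul, h1, sub_zero, C_1, map_one,
      one_smul]
  rw [smul_add, ← mul_smul, ← mul_smul, ev_mul_U, taylor_mul, taylor_C, taylor_X, mul_add,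
    map_add, mul_add, add_smul, mul_smul G.U (G.ev (C g * C G.c)), e]

lemma exists_comaximal_prods {π : K[X]} {J : ℕ}
    (hJ : ∀ m ≥ J, ∃ u v w : K[X][X], u * G.b + v * taylor (m * G.c) G.b + w * C π = 1) (N : ℕ) :
    ∃ u v, C π ∣ u * (∏ i ∈ Finset.range N, taylor (i * G.c) G.a) +
      v * taylor (-(J * G.c)) (∏ i ∈ Finset.range N, taylor (-(i * G.c)) G.b) - 1 := by
  obtain ⟨Q, _, q, hq, hker⟩ : ∃ (Q : Type) (_ : CommRing Q) (q : K[X][X] →+* Q),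
      Function.Surjective q ∧ ∀ f, q f = 0 ↔ C π ∣ f := CommRing.exists_quotient_singleton _
  have e₂ : taylor (-(J * G.c)) (∏ i ∈ Finset.range N, taylor (-(i * G.c)) G.b) =
      ∏ i ∈ Finset.range N, taylor (-((J + i : ℕ) * G.c)) G.b := by
    rw [← taylorAlgHom_apply, map_prod]
    refine Finset.prod_congr rfl fun i _ => ?_
    rw [taylorAlgHom_apply, taylor_taylor]
    push_cast
    ring_nf
  rw [e₂]
  have hco : IsCoprime (q (∏ i ∈ Finset.range N, taylor (i * G.c) G.a))
      (q (∏ i ∈ Finset.range N, taylor (-((J + i : ℕ) * G.c)) G.b)) := by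
    rw [map_prod, map_prod]
    refine IsCoprime.prod_left fun i _ => IsCoprime.prod_right fun j _ => ?_
    obtain ⟨u, v, w, e⟩ := hJ (J + j + i + 1) (by omega)
    have hs : taylor (-((J + j : ℕ) * G.c)) (taylor ((J + j + i + 1 : ℕ) * G.c) G.b) =
        taylor (i * G.c) G.a := by
      rw [← G.taylor_b, taylor_taylor, taylor_taylor]
      push_cast
      ring_nf
    have e' := congrArg (fun f => q (taylor (-((J + j : ℕ) * G.c)) f)) e
    have hw : q (C π) = 0 := (hker _).2 dvd_rfl
    simp only [map_add, taylor_mul, map_mul, taylor_C, hw, mul_zero, add_zero, hs, taylor_one,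
      map_one] at e'
    exact IsCoprime.symm ⟨_, _, e'⟩
  obtain ⟨u', v', e⟩ := hco
  obtain ⟨u, rfl⟩ := hq u'
  obtain ⟨v, rfl⟩ := hq v'
  refine ⟨u, v, ?_⟩
  rw [← hker, map_sub, map_add, map_mul, map_mul, map_one, e, sub_self]

/-- A uniform power of `U` kills all finite dimensional modules killed by `π(z)`. -/
lemma exists_U_pow_smul_eq_zero [CharZero K] {π : K[X]} (hπ : π ≠ 0)
    (h : ∀ p, Prime p → p ∣ π → ¬ p ∣ G.c ∧ ¬ C p ∣ G.b) :
    ∃ J : ℕ, ∀ (F : Type) [AddCommGroup F] [Module D F] [Module K F] [IsScalarTower K D F]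
      [Module.Finite K F], (∀ m : F, G.ev (C π) • m = 0) → ∀ m : F, G.U ^ J • m = 0 := by
  obtain ⟨J, hJ⟩ := exists_taylor_comaximal hπ h
  have hcop : IsCoprime G.c π :=
    (isCoprime_of_prime_dvd (fun h0 => hπ h0.1) fun p hp hpπ => (h p hp hpπ).1).symm
  refine ⟨J, fun F _ _ _ _ _ hF v => ?_⟩
  obtain ⟨N, hN⟩ := G.isNilpotent_lsmul_U hcop hF
  replace hN : ∀ m : F, G.U ^ N • m = 0 := fun m => by
    rw [← map_pow] at hN
    exact LinearMap.congr_fun hN m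
  obtain ⟨u, w, hd⟩ := G.exists_comaximal_prods hJ N
  have := G.ev_smul_eq_zero_of_dvd hd (hF (G.U ^ J • v))
  rw [map_sub, sub_smul, map_add, add_smul, map_mul, map_mul, mul_smul, mul_smul,
    ← V_pow_mul_U_pow, mul_smul (G.V ^ N), hN, ← mul_smul (G.ev (taylor _ _)), ← U_pow_mul_ev,
    ← U_pow_mul_V_pow, mul_smul, mul_smul, hN, map_one, one_smul] at this
  simpa using this

/-- A finitely generated module killed by `π(z)` and by powers of `U` and `V` is finite
dimensional. -/
lemma finite_of_pow_smul_eq_zero {P : Type} [AddCommGroup P] [Module D P] [Module K P]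
    [IsScalarTower K D P] [Module.Finite D P] (ha : IsUnit G.a.leadingCoeff) {π : K[X]}
    (hπ : π ≠ 0) (hk : ∀ m : P, G.ev (C π) • m = 0) {J : ℕ} (hU : ∀ m : P, G.U ^ J • m = 0)
    (hV : ∀ m : P, G.V ^ J • m = 0) : Module.Finite K P := by
  classical
  set f := ∏ i ∈ Finset.range J, taylor (i * G.c) G.a with hf
  have hlc : IsUnit f.leadingCoeff := by
    rw [hf, leadingCoeff_prod, IsUnit.prod_iff]
    intro i _
    rwa [leadingCoeff_taylor]
  obtain ⟨l, hl⟩ := hlc.exists_left_inv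
  have hmon : (C l * f).Monic := by
    rw [Monic, leadingCoeff_mul, leadingCoeff_C, hl]
  have hkill : ∀ m : P, G.ev (C l * f) • m = 0 := fun m => by
    rw [map_mul, hf, ← V_pow_mul_U_pow, mul_smul, mul_smul, hU, smul_zero, smul_zero]
  obtain ⟨T, hT⟩ := Module.Finite.fg_top (R := D) (M := P)
  let idx := Finset.range (2 * J) ×ˢ Finset.range π.natDegree ×ˢ
    Finset.range (C l * f).natDegree ×ˢ T
  let φ : ℕ × ℕ × ℕ × P → P := fun j => G.word j.1 • G.ev (C (X ^ j.2.1) * X ^ j.2.2.1) • j.2.2.2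
  let S : Submodule K P := Submodule.span K (idx.image φ)
  have hword : ∀ i (m : P), 2 * J ≤ i → G.word i • m = 0 := by
    intro i m hi
    rcases Nat.even_or_odd' i with ⟨k, rfl | rfl⟩
    · rw [word_two_mul, ← Nat.sub_add_cancel (show J ≤ k by omega), pow_add, mul_smul, hU,
        smul_zero]
    · rw [word_two_mul_add_one, ← Nat.sub_add_cancel (show J ≤ k + 1 by omega), pow_add, mul_smul,
        hV, smul_zero]
  have hS : ∀ (w : D), ∀ t ∈ T, w • t ∈ S := by
    intro w t ht
    obtain ⟨n, g, -, rfl⟩ := G.exists_eq_sum_word w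
    rw [Finset.sum_smul]
    refine sum_mem fun i _ => ?_
    rw [mul_smul]
    by_cases hi : 2 * J ≤ i
    · rw [hword i _ hi]; exact zero_mem _
    rw [← modByMonic_add_div (g i) (C l * f), map_add, add_smul, map_mul, mul_smul, hkill,
      add_zero]
    have := G.ev_smul_mem_span hπ (hk t) (f := g i %ₘ (C l * f)) (d := (C l * f).natDegree)
      (S := S.comap (Algebra.lsmul K K P (G.word i))) (by
        rw [← degree_eq_natDegree hmon.ne_zero]
        exact degree_modByMonic_lt _ hmon) (by
        intro h hh k hk
        refine Submodule.subset_span (Finset.mem_coe.2 (Finset.mem_image.2 ⟨(i, h, k, t), ?_, rfl⟩))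
        simp only [idx, Finset.mem_product, Finset.mem_range]
        exact ⟨by omega, hh, hk, ht⟩)
    exact this
  have htop : S = ⊤ := by
    refine Submodule.eq_top_iff'.2 fun y => ?_
    have hy : y ∈ Submodule.span D (T : Set P) := hT ▸ trivial
    rw [Submodule.mem_span_finset] at hy
    obtain ⟨w, -, rfl⟩ := hy
    exact sum_mem fun t ht => hS _ t ht
  exact ⟨⟨_, htop⟩⟩

end GenWeylDatum

section Growth

variable {K A M : Type*} [Field K] [Ring A] [AddCommGroup M] [Module K M] [Module A M]

lemma HasLinearGrowth.of_injective {D P ι : Type*} [Ring D] [AddCommGroup P] [Module K P]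
    [Module D P] [Fintype ι] (h : HasLinearGrowth K D P) {f : M →ₗ[K] ι → P}
    (hf : Function.Injective f)
    (hA : ∀ y : A, ∃ w : ι → ι → D, ∀ m i, f (y • m) i = ∑ j, w i j • f m j) :
    HasLinearGrowth K A M := by
  obtain ⟨W, e, hmono, hex, hdeg, hW⟩ := h
  choose κ hκ using hdeg
  let W' : ℕ → Submodule K M := fun n => (Submodule.pi Set.univ fun _ : ι => W n).comap f
  have hmem : ∀ n m, m ∈ W' n ↔ ∀ i, f m i ∈ W n := fun n m => by
    simp [W', Submodule.mem_pi]
  refine ⟨W', Fintype.card ι * e, fun i j h m hm => ?_, fun m => ?_, fun y => ?_, fun n => ?_⟩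
  · rw [hmem] at hm ⊢
    exact fun l => hmono h (hm l)
  · choose ν hν using hex
    exact ⟨∑ i, ν (f m i), (hmem _ _).2 fun i => hmono
      (Finset.single_le_sum (f := fun i => ν (f m i)) (fun _ _ => Nat.zero_le _)
        (Finset.mem_univ i)) (hν _)⟩
  · obtain ⟨w, hw⟩ := hA y
    refine ⟨∑ i, ∑ j, κ (w i j), fun n m hm => (hmem _ _).2 fun i => ?_⟩
    rw [hw]
    refine sum_mem fun j _ => hmono ?_ (hκ (w i j) n _ ((hmem _ _).1 hm j))
    refine add_le_add_right ?_ n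
    exact (Finset.single_le_sum (f := fun j => κ (w i j)) (fun _ _ => Nat.zero_le _)
      (Finset.mem_univ j)).trans (Finset.single_le_sum (f := fun i => ∑ j, κ (w i j))
        (fun _ _ => Nat.zero_le _) (Finset.mem_univ i))
  · have hfin := (hW n).1
    let g : W' n →ₗ[K] ι → W n := LinearMap.pi fun i =>
      ((LinearMap.proj i ∘ₗ f).restrict fun m hm => (hmem _ _).1 hm i)
    have hg : Function.Injective g := fun m m' h => by
      refine Subtype.ext (hf (funext fun i => ?_))
      exact congrArg Subtype.val (congrFun h i)
    refine ⟨Module.Finite.of_injective g hg, ?_⟩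
    refine (LinearMap.finrank_le_finrank_of_injective hg).trans ?_
    rw [Module.finrank_pi_fintype, Finset.sum_const, Finset.card_univ, smul_eq_mul, mul_assoc]
    exact Nat.mul_le_mul_left _ (hW n).2

variable [Algebra K A] [IsScalarTower K A M]

/-- `N` is contained in `N'` up to a finite dimensional subspace. -/
def FiniteOver (K : Type*) {R M : Type*} [Field K] [Ring R] [Algebra K R] [AddCommGroup M]
    [Module K M] [Module R M] [IsScalarTower K R M] (N N' : Submodule R M) : Prop :=
  ∃ Z : Submodule K M, Module.Finite K Z ∧ N.restrictScalars K ≤ Z ⊔ N'.restrictScalars K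

lemma FiniteOver.refl (N : Submodule A M) : FiniteOver K N N :=
  ⟨⊥, inferInstance, le_sup_right⟩

lemma FiniteOver.trans {N N' N'' : Submodule A M} (h : FiniteOver K N N')
    (h' : FiniteOver K N' N'') : FiniteOver K N N'' := by
  obtain ⟨Z, hZ, h⟩ := h
  obtain ⟨Z', hZ', h'⟩ := h'
  refine ⟨Z ⊔ Z', Submodule.finite_sup _ _, h.trans ?_⟩
  rw [sup_assoc]
  exact sup_le_sup_left h' _

/-- The span of the products of at most `m` elements of `S` applied to elements of `Z`. -/
def Submodule.wordSpan (S : Finset A) (Z : Submodule K M) : ℕ → Submodule K M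
  | 0 => Z
  | m + 1 => wordSpan S Z m ⊔ S.sup fun g => (wordSpan S Z m).map (Algebra.lsmul K K M g)

lemma Submodule.wordSpan_mono (S : Finset A) (Z : Submodule K M) : Monotone (wordSpan S Z) :=
  monotone_nat_of_le_succ fun _ => le_sup_left

lemma Submodule.smul_mem_wordSpan {S : Finset A} {Z : Submodule K M} {g : A} (hg : g ∈ S) {m : ℕ}
    {x : M} (hx : x ∈ wordSpan S Z m) : g • x ∈ wordSpan S Z (m + 1) :=
  mem_sup_right (Finset.le_sup (f := fun g => (wordSpan S Z m).map (Algebra.lsmul K K M g)) hg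
    ⟨x, hx, rfl⟩)

lemma Submodule.wordSpan_le {S : Finset A} {Z : Submodule K M} {W : ℕ → Submodule K M}
    (hZ : Z ≤ W 0) (hmono : Monotone W) (hW : ∀ g ∈ S, ∀ n, ∀ x ∈ W n, g • x ∈ W (n + 1)) (m : ℕ) :
    wordSpan S Z m ≤ W m := by
  induction m with
  | zero => exact hZ
  | succ m ih =>
    refine sup_le (ih.trans (hmono m.le_succ)) (Finset.sup_le fun g hg => ?_)
    rintro _ ⟨x, hx, rfl⟩
    exact hW g hg m x (ih hx)

lemma Submodule.smul_mem_of_adjoin_eq_top {S : Finset A} (hS : Algebra.adjoin K (S : Set A) = ⊤)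
    {Y : Submodule K M} (hY : ∀ g ∈ S, ∀ x ∈ Y, g • x ∈ Y) (a : A) {x : M} (hx : x ∈ Y) :
    a • x ∈ Y := by
  have ha : a ∈ Algebra.adjoin K (S : Set A) := hS ▸ trivial
  induction ha using Algebra.adjoin_induction generalizing x with
  | mem g hg => exact hY g hg x hx
  | algebraMap k => rw [algebraMap_smul]; exact Y.smul_mem k hx
  | add v w _ _ h h' => rw [add_smul]; exact add_mem (h hx) (h' hx)
  | mul v w _ _ h h' => rw [mul_smul]; exact h (h' hx)

/-- An infinite dimensional subquotient contributes linearly to the dimensions of a filtration. -/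
lemma exists_finrank_inf_add_le {W : ℕ → Submodule K M} (hmono : Monotone W)
    (hex : ∀ x, ∃ n, x ∈ W n) {S : Finset A} (hS : Algebra.adjoin K (S : Set A) = ⊤) {k : ℕ}
    (hk : ∀ g ∈ S, ∀ n, ∀ x ∈ W n, g • x ∈ W (n + k)) (hfin : ∀ n, Module.Finite K (W n))
    {N N' : Submodule A M} (hle : N' ≤ N) (hN : N.FG) (hinf : ¬ FiniteOver K N N') :
    ∃ B, ∀ B' ≥ B, ∀ m,
      Module.finrank K (W (B' + k * m) ⊓ N'.restrictScalars K : Submodule K M) + m ≤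
      Module.finrank K (W (B' + k * m) ⊓ N.restrictScalars K : Submodule K M) := by
  obtain ⟨T, hT⟩ := hN
  choose ν hν using hex
  refine ⟨T.sup ν, fun B hB m => ?_⟩
  set N₁ := N.restrictScalars K
  set N₂ := N'.restrictScalars K
  let Z := Submodule.wordSpan S (Submodule.span K (T : Set M))
  have hTB : Submodule.span K (T : Set M) ≤ W B :=
    Submodule.span_le.2 fun t ht => hmono ((Finset.le_sup ht).trans hB) (hν t)
  have hTN : ∀ t ∈ T, t ∈ N := fun t ht => hT ▸ Submodule.subset_span ht
  have hZW : ∀ j, Z j ≤ W (B + k * j) := Submodule.wordSpan_le (W := fun j => W (B + k * j))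
    (by simpa using hTB) (fun i j h => hmono (by gcongr))
    (fun g hg n x hx => by rw [mul_add, mul_one, ← add_assoc]; exact hk g hg _ x hx)
  have hZN : ∀ j, Z j ≤ N₁ := Submodule.wordSpan_le (W := fun _ => N₁)
    (Submodule.span_le.2 hTN) monotone_const (fun g _ _ x hx => N.smul_mem g hx)
  have hZfin : ∀ j, Module.Finite K (Z j) := fun j => by
    have := hfin (B + k * j)
    exact Submodule.finiteDimensional_of_le (hZW j)
  have hstep : ∀ j, ¬ Z (j + 1) ≤ Z j ⊔ N₂ := by
    intro j hj
    refine hinf ⟨Z j, hZfin j, ?_⟩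
    have hstab : ∀ g ∈ S, ∀ x ∈ Z j ⊔ N₂, g • x ∈ Z j ⊔ N₂ := by
      intro g hg x hx
      obtain ⟨y, hy, y', hy', rfl⟩ := Submodule.mem_sup.1 hx
      rw [smul_add]
      exact add_mem (hj (Submodule.smul_mem_wordSpan hg hy))
        (Submodule.mem_sup_right (N'.smul_mem g hy'))
    intro x hx
    have hx' : x ∈ Submodule.span A (T : Set M) := hT ▸ hx
    induction hx' using Submodule.span_induction with
    | mem t ht =>
      exact Submodule.mem_sup_left (Submodule.wordSpan_mono S _ (Nat.zero_le j)
        (Submodule.subset_span ht))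
    | zero => exact zero_mem _
    | add y y' hy hy' h h' =>
      rw [hT] at hy hy'
      exact add_mem (h hy) (h' hy')
    | smul a y hy h =>
      rw [hT] at hy
      exact Submodule.smul_mem_of_adjoin_eq_top hS hstab a (h hy)
  set n := B + k * m with hn
  have hWn := hfin n
  have key : ∀ j ≤ m, Module.finrank K (W n ⊓ N₂ : Submodule K M) + j ≤
      Module.finrank K (W n ⊓ (Z j ⊔ N₂) : Submodule K M) := by
    intro j
    induction j with
    | zero =>
      intro _
      exact Submodule.finrank_mono (inf_le_inf_left _ le_sup_right)
    | succ j ih =>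
      intro hj
      refine Nat.succ_le_of_lt ((ih (by omega)).trans_lt (Submodule.finrank_lt_finrank_of_lt ?_))
      refine lt_of_le_not_ge (inf_le_inf_left _ (sup_le_sup_right
        (Submodule.wordSpan_mono S _ j.le_succ) _)) fun h => hstep j ?_
      exact fun x hx => (h ⟨hmono (by rw [hn]; gcongr) (hZW _ hx), Submodule.mem_sup_left hx⟩).2
  exact (key m le_rfl).trans (Submodule.finrank_mono (inf_le_inf_left _ (sup_le (hZN m) hle)))

/-- In a Noetherian module of linear growth, all but finitely many factors of a descending chain
are finite dimensional. -/
lemma HasLinearGrowth.exists_finiteOver [Algebra.FiniteType K A] [IsNoetherian A M]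
    (h : HasLinearGrowth K A M) {f : ℕ → Submodule A M} (hf : Antitone f) :
    ∃ k₀, ∀ k ≥ k₀, FiniteOver K (f k₀) (f k) := by
  classical
  obtain ⟨W, e, hmono, hex, hdeg, hW⟩ := h
  obtain ⟨S, hS⟩ := Algebra.FiniteType.out (R := K) (A := A)
  choose κ hκ using hdeg
  let k := S.sup κ
  have hk : ∀ g ∈ S, ∀ n, ∀ x ∈ W n, g • x ∈ W (n + k) := fun g hg n x hx =>
    hmono (add_le_add_right (Finset.le_sup hg) n) (hκ g n x hx)
  let bad : Set ℕ := {i | ¬ FiniteOver K (f i) (f (i + 1))}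
  have hB : ∀ i, ∃ B, i ∈ bad → ∀ B' ≥ B, ∀ m,
      Module.finrank K (W (B' + k * m) ⊓ (f (i + 1)).restrictScalars K : Submodule K M) + m ≤
      Module.finrank K (W (B' + k * m) ⊓ (f i).restrictScalars K : Submodule K M) := by
    intro i
    by_cases hi : i ∈ bad
    · obtain ⟨B, hB⟩ := exists_finrank_inf_add_le hmono hex hS hk (fun n => (hW n).1)
        (hf i.le_succ) (IsNoetherian.noetherian _) hi
      exact ⟨B, fun _ => hB⟩
    · exact ⟨0, fun h => absurd h hi⟩
  choose B hB using hB
  have hfinite : bad.Finite := by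
    by_contra hinf
    obtain ⟨T, hT, hcard⟩ := Set.Infinite.exists_subset_card_eq hinf (e * k + 1)
    obtain ⟨L, hL⟩ : ∃ L, ∀ i ∈ T, i < L := ⟨T.sup id + 1, fun i hi =>
      Nat.lt_succ_of_le (Finset.le_sup (f := id) hi)⟩
    let B₀ := T.sup B
    have key : ∀ m j, (T.filter (· < j)).card * m +
        Module.finrank K (W (B₀ + k * m) ⊓ (f j).restrictScalars K : Submodule K M) ≤
        Module.finrank K (W (B₀ + k * m)) := by
      intro m j
      have hfin := (hW (B₀ + k * m)).1
      induction j with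
      | zero => simpa using Submodule.finrank_mono inf_le_left
      | succ j ih =>
        refine le_trans ?_ ih
        by_cases hj : j ∈ T
        · have h1 := hB j (hT hj) B₀ (Finset.le_sup hj) m
          have h2 : (T.filter (· < j + 1)).card = (T.filter (· < j)).card + 1 := by
            rw [← Finset.card_insert_of_notMem (a := j) (by simp)]
            congr 1
            ext i
            simp only [Finset.mem_filter, Finset.mem_insert]
            constructor
            · rintro ⟨h, h'⟩
              rcases Nat.lt_succ_iff_lt_or_eq.1 h' with h' | rfl
              · exact Or.inr ⟨h, h'⟩
              · exact Or.inl rfl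
            · rintro (rfl | ⟨h, h'⟩)
              · exact ⟨hj, by omega⟩
              · exact ⟨h, by omega⟩
          rw [h2, add_mul, one_mul]
          omega
        · have h2 : T.filter (· < j + 1) = T.filter (· < j) := by
            refine Finset.filter_congr fun i hi => ?_
            have : i ≠ j := fun h => hj (h ▸ hi)
            omega
          rw [h2]
          exact add_le_add_right (Submodule.finrank_mono
            (inf_le_inf_left _ (show (f (j + 1)).restrictScalars K ≤ (f j).restrictScalars K from
              hf j.le_succ))) _
    have h1 := key (e * (B₀ + 1) + 1) L
    have h2 := (hW (B₀ + k * (e * (B₀ + 1) + 1))).2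
    rw [Finset.filter_true_of_mem hL, hcard] at h1
    nlinarith
  obtain ⟨k₀, hk₀⟩ := hfinite.bddAbove
  refine ⟨k₀ + 1, fun k hk => ?_⟩
  induction k, hk using Nat.le_induction with
  | base => exact FiniteOver.refl _
  | succ k hk ih =>
    refine ih.trans ?_
    by_contra h
    have := hk₀ (show k ∈ bad from h)
    omega

end Growth

lemma finiteOver_iff_finite_map_mkQ {K R M : Type*} [Field K] [Ring R] [Algebra K R]
    [AddCommGroup M] [Module K M] [Module R M] [IsScalarTower K R M] {N N' : Submodule R M} :
    FiniteOver K N N' ↔ Module.Finite K (N.map N'.mkQ) := by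
  let q : M →ₗ[K] M ⧸ N' := N'.mkQ.restrictScalars K
  have hq : Function.Surjective q := N'.mkQ_surjective
  have hker : LinearMap.ker q = N'.restrictScalars K := by
    ext x
    exact (N'.mkQ.mem_ker).symm.trans (by rw [Submodule.ker_mkQ]; rfl)
  constructor
  · rintro ⟨Z, hZ, h⟩
    have hle : (N.map N'.mkQ).restrictScalars K ≤ Z.map q := by
      rintro _ ⟨x, hx, rfl⟩
      obtain ⟨y, hy, y', hy', rfl⟩ := Submodule.mem_sup.1 (h hx)
      refine ⟨y, hy, ?_⟩
      have : q y' = 0 := by rw [← LinearMap.mem_ker, hker]; exact hy'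
      change q y = q (y + y')
      rw [map_add, this, add_zero]
    exact Submodule.finiteDimensional_of_le hle
  · intro h
    have hfg : ((N.map N'.mkQ).restrictScalars K).FG := (Submodule.fg_top _).1 h.fg_top
    obtain ⟨T, hT⟩ := hfg
    let Z : Submodule K M := Submodule.span K (Function.surjInv hq '' T)
    have hZ : Z.map q = (N.map N'.mkQ).restrictScalars K := by
      rw [← hT, Submodule.map_span, ← Set.image_comp]
      congr 1
      convert Set.image_id _
      ext x
      exact Function.surjInv_eq hq x
    refine ⟨Z, Module.Finite.span_of_finite K (T.finite_toSet.image _), ?_⟩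
    rw [← hker, ← Submodule.comap_map_eq, hZ]
    exact fun x hx => ⟨x, hx, rfl⟩

lemma Submodule.forall_smul_map_mkQ_eq_zero_iff {R M : Type*} [Ring R] [AddCommGroup M]
    [Module R M] {N N' : Submodule R M} {w : R} :
    (∀ y : N.map N'.mkQ, w • y = 0) ↔ ∀ x ∈ N, w • x ∈ N' := by
  have key : ∀ x, w • N'.mkQ x = 0 ↔ w • x ∈ N' := fun x => by
    rw [← map_smul, ← LinearMap.mem_ker, Submodule.ker_mkQ]
  constructor
  · exact fun h x hx => (key x).1 (congrArg Subtype.val (h ⟨N'.mkQ x, x, hx, rfl⟩))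
  · rintro h ⟨_, x, hx, rfl⟩
    exact Subtype.ext ((key x).2 (h x hx))

namespace GenWeylDatum

section

variable {K D : Type} [Field K] [Ring D] [Algebra K D] (G : GenWeylDatum K D)
variable {M : Type} [AddCommGroup M] [Module K M] [Module D M] [IsScalarTower K D M]

lemma not_C_dvd_of_isUnit_leadingCoeff {f : K[X][X]} (hf : IsUnit f.leadingCoeff) {p : K[X]}
    (hp : Prime p) : ¬ C p ∣ f := by
  rintro ⟨g, rfl⟩
  rw [leadingCoeff_mul, leadingCoeff_C] at hf
  exact hp.not_isUnit (isUnit_of_mul_isUnit_left hf)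

lemma isUnit_leadingCoeff_b (ha : IsUnit G.a.leadingCoeff) : IsUnit G.b.leadingCoeff := by
  rw [← leadingCoeff_taylor (r := G.c), G.taylor_b]
  exact ha

lemma exists_U_pow_smul_mem [CharZero K] (M : Type) [AddCommGroup M] [Module K M] [Module D M]
    [IsScalarTower K D M] {π : K[X]} (hπ : π ≠ 0)
    (h : ∀ p, Prime p → p ∣ π → ¬ p ∣ G.c ∧ ¬ C p ∣ G.b) :
    ∃ J : ℕ, ∀ N N' : Submodule D M, (∀ m : M, G.ev (C π) • m = 0) → FiniteOver K N N' →
      ∀ x ∈ N, G.U ^ J • x ∈ N' := by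
  obtain ⟨J, hJ⟩ := G.exists_U_pow_smul_eq_zero hπ h
  refine ⟨J, fun N N' hk hN => ?_⟩
  have := finiteOver_iff_finite_map_mkQ.1 hN
  rw [← Submodule.forall_smul_map_mkQ_eq_zero_iff]
  refine hJ (N.map N'.mkQ) (Submodule.forall_smul_map_mkQ_eq_zero_iff.2 fun x _ => ?_)
  rw [hk]
  exact zero_mem _

lemma finiteOver_of_pow_smul_mem [Module.Finite D M] (ha : IsUnit G.a.leadingCoeff) {π : K[X]}
    (hπ : π ≠ 0) (hk : ∀ m : M, G.ev (C π) • m = 0) {J : ℕ} {N N' : Submodule D M}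
    (hU : ∀ x ∈ N, G.U ^ J • x ∈ N') (hV : ∀ x ∈ N, G.V ^ J • x ∈ N') : FiniteOver K N N' := by
  have := G.isNoetherianRing
  rw [finiteOver_iff_finite_map_mkQ]
  refine G.finite_of_pow_smul_eq_zero ha hπ
    (Submodule.forall_smul_map_mkQ_eq_zero_iff.2 fun x _ => ?_)
    (Submodule.forall_smul_map_mkQ_eq_zero_iff.2 hU)
    (Submodule.forall_smul_map_mkQ_eq_zero_iff.2 hV)
  rw [hk]
  exact zero_mem _

end

variable {K A : Type} [Field K] [Ring A] [Algebra K A] {D : Subalgebra K A}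
  (G : GenWeylDatum K D)
variable {M : Type} [AddCommGroup M] [Module K M] [Module A M] [IsScalarTower K A M]

/-- A module of linear growth killed by a polynomial in `z` coprime to the shift is Artinian. -/
lemma isArtinian_of_hasLinearGrowth [CharZero K] [Algebra.FiniteType K A] [Module.Finite D M]
    (ha : IsUnit G.a.leadingCoeff) {π : K[X]} (hπ : π ≠ 0)
    (hc : ∀ p, Prime p → p ∣ π → ¬ p ∣ G.c) (hk : ∀ m : M, G.ev (C π) • m = 0)
    (hgrowth : HasLinearGrowth K A M) : IsArtinian A M := by
  have := G.isNoetherianRing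
  have : IsNoetherian D M := inferInstance
  have : IsNoetherian A M := isNoetherian_of_tower D this
  have hb := G.isUnit_leadingCoeff_b ha
  obtain ⟨J₁, hJ₁⟩ := G.exists_U_pow_smul_mem M hπ fun p hp hpπ =>
    ⟨hc p hp hpπ, not_C_dvd_of_isUnit_leadingCoeff hb hp⟩
  obtain ⟨J₂, hJ₂⟩ := G.swap.exists_U_pow_smul_mem M hπ fun p hp hpπ =>
    ⟨fun h => hc p hp hpπ ((dvd_neg).1 h), not_C_dvd_of_isUnit_leadingCoeff ha hp⟩
  rw [← monotone_stabilizes_iff_artinian]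
  intro f'
  let f : ℕ → Submodule A M := fun k => OrderDual.ofDual (f' k)
  have hf : Antitone f := fun i j h => f'.monotone h
  obtain ⟨k₀, hk₀⟩ := hgrowth.exists_finiteOver hf
  let N : ℕ → Submodule D M := fun k => (f k).restrictScalars D
  have hUk : ∀ k ≥ k₀, ∀ x ∈ N k₀, G.U ^ J₁ • x ∈ N k ∧ G.V ^ J₂ • x ∈ N k := fun k hkk x hx =>
    ⟨hJ₁ (N k₀) (N k) hk (hk₀ k hkk) x hx, hJ₂ (N k₀) (N k) hk (hk₀ k hkk) x hx⟩
  let I : Submodule D M := ⨅ k, N (k₀ + k)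
  have hI : ∀ k ≥ k₀, I ≤ N k := fun k hkk => by
    obtain ⟨j, rfl⟩ := Nat.exists_eq_add_of_le hkk
    exact iInf_le _ j
  obtain ⟨Z, hZ, hle⟩ : FiniteOver K (N k₀) I := by
    refine G.finiteOver_of_pow_smul_mem ha hπ hk (J := J₁ + J₂) (fun x hx => ?_) fun x hx => ?_
    · rw [add_comm, pow_add, mul_smul]
      exact I.smul_mem _ ((Submodule.mem_iInf _).2 fun j => (hUk _ (by omega) x hx).1)
    · rw [pow_add, mul_smul]
      exact I.smul_mem _ ((Submodule.mem_iInf _).2 fun j => (hUk _ (by omega) x hx).2)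
  let g : ℕ →o (Submodule K Z)ᵒᵈ :=
    ⟨fun k => OrderDual.toDual (((f k).restrictScalars K).comap Z.subtype), fun i j h =>
      Submodule.comap_mono (show (f j).restrictScalars K ≤ (f i).restrictScalars K from hf h)⟩
  obtain ⟨n, hn⟩ := IsArtinian.monotone_stabilizes g
  refine ⟨k₀ + n, fun m hm => le_antisymm (hf hm : f m ≤ f (k₀ + n)) ?_⟩
  intro x hx
  obtain ⟨y, hy, y', hy', rfl⟩ := Submodule.mem_sup.1 (hle (hf (Nat.le_add_right k₀ n) hx))
  have hyn : y ∈ f (k₀ + n) := by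
    have h1 : y' ∈ f (k₀ + n) := hI _ (Nat.le_add_right _ _) hy'
    have h2 := sub_mem (show y + y' ∈ f (k₀ + n) from hx) h1
    rwa [add_sub_cancel_right] at h2
  have h1 : (⟨y, hy⟩ : Z) ∈ OrderDual.ofDual (g (k₀ + n)) := hyn
  rw [← hn _ (Nat.le_add_left n k₀), hn m (by omega)] at h1
  exact add_mem (show y ∈ f m from h1) (hI m (by omega) hy')

/-- Polynomials in `z` pass through an element `y` which commutes with `z` up to a scalar. -/
lemma mul_ev_C {y : A} {θ : K} (hy : y * (G.ev (C X) : A) = θ • ((G.ev (C X) : A) * y)) (f : K[X]) :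
    y * (G.ev (C f) : A) = (G.ev (C (f.comp (C θ * X))) : A) * y := by
  induction f using Polynomial.induction_on' with
  | add p q hp hq => simp only [map_add, add_comp, Subalgebra.coe_add, mul_add, add_mul, hp, hq]
  | monomial n k =>
    have key : y * (G.ev (C X) : A) ^ n = θ ^ n • ((G.ev (C X) : A) ^ n * y) := by
      induction n with
      | zero => simp
      | succ n ih =>
        rw [pow_succ, ← mul_assoc, ih, smul_mul_assoc, mul_assoc, hy, mul_smul_comm, smul_smul,
          ← pow_succ, mul_assoc]
    have h1 : (G.ev (C (monomial n k)) : A) = k • (G.ev (C X) : A) ^ n := by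
      rw [← smul_X_eq_monomial, ← smul_C, map_smul, C_pow, map_pow]
      rfl
    have h2 : (G.ev (C ((monomial n k).comp (C θ * X))) : A) =
        (k * θ ^ n) • (G.ev (C X) : A) ^ n := by
      rw [← smul_X_eq_monomial, smul_comp, X_pow_comp, C_mul', _root_.smul_pow, smul_smul, ← smul_C,
        map_smul, C_pow, map_pow]
      rfl
    rw [h1, h2, mul_smul_comm, key, smul_smul, smul_mul_assoc]

/-- Monolithic modules over a ring which is finite over a generalized Weyl algebra. -/
theorem isArtinian_of_isMonolithElement [Algebra.FiniteType K A] {ι : Type} [Fintype ι] {y : ι → A}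
    (hy : ∀ w : A, ∃ v : ι → D, w = ∑ i, (v i : A) * y i)
    (h : G.c = 0 ∨ CharZero K ∧ IsUnit G.a.leadingCoeff ∧ (∃ κ e, G.c = C κ * X ^ e) ∧
      ∃ θ : ι → K, ∀ i, θ i ≠ 0 ∧ y i * (G.ev (C X) : A) = θ i • ((G.ev (C X) : A) * y i))
    [Module.Finite A M] {s : M} (hs : IsMonolithElement A s) : IsArtinian A M := by
  classical
  have := G.isNoetherianRing
  have hDA : Module.Finite D A := by
    refine ⟨⟨Finset.univ.image y, Submodule.eq_top_iff'.2 fun w => ?_⟩⟩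
    obtain ⟨v, rfl⟩ := hy w
    refine sum_mem fun i _ => Submodule.smul_mem _ (v i) (Submodule.subset_span ?_)
    simp
  have hDM : Module.Finite D M := Module.Finite.trans A M
  have hnoeth : IsNoetherian D M := inferInstance
  obtain ⟨N, hsN, hN⟩ := set_has_maximal_iff_noetherian.2 hnoeth {N | s ∉ N} ⟨⊥, by simpa using hs.1⟩
  let P := M ⧸ N
  let σ : P := N.mkQ s
  have hσ : IsMonolithElement D σ := by
    refine ⟨fun h0 => hsN ((Submodule.Quotient.mk_eq_zero N).1 h0), fun m hm => ?_⟩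
    obtain ⟨m, rfl⟩ := N.mkQ_surjective m
    have hmN : m ∉ N := fun h => hm ((Submodule.Quotient.mk_eq_zero N).2 h)
    have : s ∈ N ⊔ Submodule.span D {m} := by
      by_contra hcon
      refine hN _ hcon (lt_of_le_not_ge le_sup_left fun hle => hmN ?_)
      exact hle (Submodule.mem_sup_right (Submodule.mem_span_singleton_self m))
    obtain ⟨x, hx, x', hx', e⟩ := Submodule.mem_sup.1 this
    obtain ⟨w, rfl⟩ := Submodule.mem_span_singleton.1 hx'
    refine ⟨w, ?_⟩
    rw [← map_smul]
    change _ = N.mkQ s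
    rw [← e, map_add, right_eq_add]
    exact (Submodule.Quotient.mk_eq_zero N).2 hx
  let f : M →ₗ[K] ι → P := LinearMap.pi fun i =>
    (N.mkQ.restrictScalars K) ∘ₗ (Algebra.lsmul K K M (y i))
  have hfapp : ∀ m i, f m i = N.mkQ (y i • m) := fun m i => rfl
  have hfinj : Function.Injective f := by
    rw [← LinearMap.ker_eq_bot, LinearMap.ker_eq_bot']
    intro m hm
    by_contra hm0
    obtain ⟨w, hw⟩ := hs.2 m hm0
    obtain ⟨v, rfl⟩ := hy w
    refine hsN ?_
    rw [← hw, Finset.sum_smul]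
    refine sum_mem fun i _ => ?_
    rw [mul_smul]
    exact N.smul_mem (v i) ((Submodule.Quotient.mk_eq_zero N).1 (congrFun hm i))
  obtain ⟨p, hp, hpσ⟩ := G.exists_irreducible_smul_eq_zero hσ.1 fun w hw => hσ.2 _ hw
  obtain ⟨k, hk⟩ := hσ.isNilpotent (f := G.zEnd P p) hpσ
  replace hk : ∀ m : P, G.ev (C (p ^ k)) • m = 0 := fun m => by
    rw [← zEnd_apply, map_pow, hk, LinearMap.zero_apply]
  by_cases hpc : p ∣ G.c
  · have hfin : Module.Finite K P := G.finite_of_dvd_c hσ hpc hk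
    have : Module.Finite K M := Module.Finite.of_injective f hfinj
    exact isArtinian_of_tower K inferInstance
  obtain hc0 | ⟨hchar, ha, ⟨κ, e, hc⟩, θ, hθ⟩ := h
  · exact absurd (hc0 ▸ dvd_zero p) hpc
  have hgrowth : HasLinearGrowth K A M := by
    refine (G.hasLinearGrowth hp (not_C_dvd_of_isUnit_leadingCoeff ha hp.prime)
      (not_C_dvd_of_isUnit_leadingCoeff (G.isUnit_leadingCoeff_b ha) hp.prime) hσ hpσ
      hk).of_injective hfinj fun w => ?_
    choose v hv using fun i => hy (y i * w)
    refine ⟨v, fun m i => ?_⟩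
    rw [hfapp, ← mul_smul, hv, Finset.sum_smul, map_sum]
    refine Finset.sum_congr rfl fun j _ => ?_
    rw [mul_smul, hfapp, ← map_smul]
    rfl
  have hcomp0 : ∀ i, p.comp (C (θ i)⁻¹ * X) ≠ 0 := fun i h0 => by
    have := congrArg (fun g => g.comp (C (θ i) * X)) h0
    simp only [comp_assoc, mul_comp, C_comp, X_comp, zero_comp] at this
    rw [← mul_assoc, ← C_mul, inv_mul_cancel₀ (hθ i).1, C_1, one_mul, comp_X] at this
    exact hp.ne_zero this
  refine G.isArtinian_of_hasLinearGrowth ha (π := ∏ i, p.comp (C (θ i)⁻¹ * X) ^ k)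
    (Finset.prod_ne_zero_iff.2 fun i _ => pow_ne_zero _ (hcomp0 i)) ?_ ?_ hgrowth
  · intro q hq hqπ hqc
    rw [hq.dvd_finsetProd_iff] at hqπ
    obtain ⟨i, -, hi⟩ := hqπ
    replace hi := hq.dvd_of_dvd_pow hi
    have hκ : κ ≠ 0 := by
      rintro rfl
      exact hpc (by rw [hc]; simp)
    rw [hc] at hqc
    rcases hq.dvd_or_dvd hqc with h1 | h1
    · exact hq.not_isUnit (isUnit_of_dvd_unit h1 (isUnit_C.2 hκ.isUnit))
    have he : e ≠ 0 := by
      rintro rfl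
      exact hq.not_isUnit (isUnit_of_dvd_one (by simpa using h1))
    have hqX : Associated q X := hq.associated_of_dvd prime_X (hq.dvd_of_dvd_pow h1)
    have hX : X ∣ p := by
      have := hqX.symm.dvd.trans hi
      rw [X_dvd_iff, coeff_zero_eq_eval_zero, eval_comp] at this
      rw [X_dvd_iff, coeff_zero_eq_eval_zero]
      simpa using this
    refine hpc ?_
    rw [hc]
    refine dvd_mul_of_dvd_right (dvd_pow ?_ he) _
    exact ((prime_X.irreducible).associated_of_dvd hp hX).symm.dvd
  · intro m
    refine hfinj (funext fun i => ?_)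
    rw [map_zero, hfapp]
    change N.mkQ (y i • (G.ev (C (∏ i, p.comp (C (θ i)⁻¹ * X) ^ k)) : A) • m) = 0
    rw [← mul_smul, G.mul_ev_C (hθ i).2, mul_smul]
    change N.mkQ (G.ev (C _) • y i • m) = 0
    rw [map_smul]
    refine G.ev_smul_eq_zero_of_dvd (_root_.map_dvd C ?_) (hk (N.mkQ (y i • m)))
    rw [prod_comp]
    refine dvd_trans ?_ (Finset.dvd_prod_of_mem _ (Finset.mem_univ i))
    rw [pow_comp, comp_assoc, mul_comp, C_comp, X_comp, ← mul_assoc, ← C_mul,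
      inv_mul_cancel₀ (hθ i).1, C_1, one_mul, comp_X]

end GenWeylDatum

lemma polynomial_polynomial_algHom_ext {K B : Type} [Field K] [Ring B] [Algebra K B]
    {f g : K[X][X] →ₐ[K] B} (hC : f (C X) = g (C X)) (hX : f X = g X) : f = g := by
  refine AlgHom.ext fun p => ?_
  have h1 : f.comp (CAlgHom (R := K) (A := K[X])) = g.comp CAlgHom := Polynomial.algHom_ext hC
  induction p using Polynomial.induction_on' with
  | add p q hp hq => rw [map_add, map_add, hp, hq]
  | monomial n a =>
    rw [← C_mul_X_pow_eq_monomial, map_mul, map_mul, map_pow, map_pow, hX]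
    exact congrArg (· * _) (DFunLike.congr_fun h1 a)

/-- An algebra generated by two elements `d` and `u` whose products `u * d` and `d * u` lie in the
image of `K[z][x]`, on which `d` and `u` act through an endomorphism `σ`. -/
structure AmbiskewDatum (K A : Type) [Field K] [Ring A] [Algebra K A] where
  /-- evaluation of polynomials in `z` (inner variable) and `x` (outer variable) -/
  ev : K[X][X] →ₐ[K] A
  /-- the twist -/
  σ : K[X][X] →ₐ[K] K[X][X]
  /-- the lowering element -/
  d : A
  /-- the raising element -/
  u : A
  /-- the polynomial giving `u * d` -/
  t : K[X][X]
  d_mul_ev : ∀ f, d * ev f = ev (σ f) * d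
  ev_mul_u : ∀ f, ev f * u = u * ev (σ f)
  u_mul_d : u * d = ev t
  d_mul_u : d * u = ev (σ t)
  adjoin_eq_top : Algebra.adjoin K {d, u} = ⊤

namespace AmbiskewDatum

variable {K A : Type} [Field K] [Ring A] [Algebra K A] (G : AmbiskewDatum K A)

lemma d_pow_mul_ev (k : ℕ) (f : K[X][X]) : G.d ^ k * G.ev f = G.ev ((G.σ ^ k) f) * G.d ^ k := by
  induction k generalizing f with
  | zero => simp
  | succ k ih =>
    rw [pow_succ, mul_assoc, G.d_mul_ev, ← mul_assoc, ih, mul_assoc, ← pow_succ, pow_succ G.σ]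
    rfl

lemma ev_mul_u_pow (k : ℕ) (f : K[X][X]) : G.ev f * G.u ^ k = G.u ^ k * G.ev ((G.σ ^ k) f) := by
  induction k generalizing f with
  | zero => simp
  | succ k ih =>
    rw [pow_succ', ← mul_assoc, G.ev_mul_u, mul_assoc, ih, ← mul_assoc, ← pow_succ', pow_succ G.σ]
    rfl

/-- The polynomial giving `d ^ k * u ^ k`. -/
def lowerRaise (k : ℕ) : K[X][X] := ∏ i ∈ Finset.range k, (G.σ ^ (i + 1)) G.t

lemma d_pow_mul_u_pow (k : ℕ) : G.d ^ k * G.u ^ k = G.ev (G.lowerRaise k) := by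
  induction k with
  | zero => simp [lowerRaise]
  | succ k ih =>
    rw [pow_succ, pow_succ', mul_assoc, ← mul_assoc G.d, G.d_mul_u, ← mul_assoc, d_pow_mul_ev,
      mul_assoc, ih, ← map_mul, lowerRaise, lowerRaise, Finset.prod_range_succ, mul_comm,
      pow_succ G.σ]
    rfl

section

variable {n : ℕ} {c : K[X]}

lemma σ_pow_eq (hz : (G.σ ^ n) (C X) = C X) (hx : (G.σ ^ n) X = X + C c) (f : K[X][X]) :
    (G.σ ^ n) f = taylor c f := by
  have : G.σ ^ n = (taylorAlgHom c).restrictScalars K :=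
    polynomial_polynomial_algHom_ext (by rw [hz]; simp) (by rw [hx]; simp)
  rw [this]
  rfl

lemma exists_σ_mul_eq_one (hn : n ≠ 0) (hz : (G.σ ^ n) (C X) = C X)
    (hx : (G.σ ^ n) X = X + C c) : ∃ τ : K[X][X] →ₐ[K] K[X][X], G.σ * τ = 1 := by
  refine ⟨G.σ ^ (n - 1) * (taylorAlgHom (-c)).restrictScalars K, ?_⟩
  rw [← mul_assoc, ← pow_succ', Nat.sub_add_cancel (Nat.one_le_iff_ne_zero.2 hn)]
  refine AlgHom.ext fun f => ?_
  change (G.σ ^ n) (taylor (-c) f) = f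
  rw [G.σ_pow_eq hz hx, taylor_taylor, add_neg_cancel, taylor_zero]

variable {τ : K[X][X] →ₐ[K] K[X][X]}

lemma u_pow_mul_ev (hτ : G.σ * τ = 1) (k : ℕ) (f : K[X][X]) :
    G.u ^ k * G.ev f = G.ev ((τ ^ k) f) * G.u ^ k := by
  rw [ev_mul_u_pow]
  change _ = _ * G.ev ((G.σ ^ k * τ ^ k) f)
  rw [pow_mul_pow_eq_one k hτ]
  rfl

/-- The polynomial giving `u ^ k * d ^ k`, where `τ` is inverse to the twist. -/
def raiseLower (τ : K[X][X] →ₐ[K] K[X][X]) (k : ℕ) : K[X][X] :=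
  ∏ i ∈ Finset.range k, (τ ^ i) G.t

lemma u_pow_mul_d_pow (hτ : G.σ * τ = 1) (k : ℕ) :
    G.u ^ k * G.d ^ k = G.ev (G.raiseLower τ k) := by
  induction k with
  | zero => simp [raiseLower]
  | succ k ih =>
    rw [pow_succ, pow_succ', mul_assoc, ← mul_assoc G.u, G.u_mul_d, ← mul_assoc,
      G.u_pow_mul_ev hτ, mul_assoc, ih, ← map_mul, raiseLower, raiseLower,
      Finset.prod_range_succ, mul_comm]

lemma σ_pow_raiseLower (hτ : G.σ * τ = 1) (k : ℕ) :
    (G.σ ^ k) (G.raiseLower τ k) = G.lowerRaise k := by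
  rw [raiseLower, lowerRaise, map_prod, ← Finset.prod_range_reflect]
  refine Finset.prod_congr rfl fun i hi => ?_
  rw [Finset.mem_range] at hi
  have : G.σ ^ k * τ ^ (k - 1 - i) = G.σ ^ (i + 1) := by
    conv_lhs => rw [show k = (i + 1) + (k - 1 - i) by omega, pow_add]
    rw [show i + 1 + (k - 1 - i) - 1 - i = k - 1 - i by omega, mul_assoc,
      pow_mul_pow_eq_one _ hτ, mul_one]
  exact DFunLike.congr_fun this G.t

/-- The subalgebra generated by polynomials together with `u ^ n` and `d ^ n`. -/
def powSubalgebra (n : ℕ) : Subalgebra K A :=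
  Algebra.adjoin K (Set.range G.ev ∪ {G.u ^ n, G.d ^ n})

lemma ev_mem (n : ℕ) (f : K[X][X]) : G.ev f ∈ G.powSubalgebra n :=
  Algebra.subset_adjoin (Or.inl ⟨f, rfl⟩)

lemma u_pow_mem (n : ℕ) : G.u ^ n ∈ G.powSubalgebra n :=
  Algebra.subset_adjoin (Or.inr (Or.inl rfl))

lemma d_pow_mem (n : ℕ) : G.d ^ n ∈ G.powSubalgebra n :=
  Algebra.subset_adjoin (Or.inr (Or.inr rfl))

/-- If the `n`-th power of the twist is a shift, then polynomials together with `u ^ n` and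
`d ^ n` form a generalized Weyl algebra. -/
def genWeylDatum (hτ : G.σ * τ = 1) (hz : (G.σ ^ n) (C X) = C X) (hx : (G.σ ^ n) X = X + C c) :
    GenWeylDatum K (G.powSubalgebra n) where
  ev := G.ev.codRestrict _ (G.ev_mem n)
  U := ⟨G.u ^ n, G.u_pow_mem n⟩
  V := ⟨G.d ^ n, G.d_pow_mem n⟩
  c := c
  a := G.lowerRaise n
  b := G.raiseLower τ n
  central f w := by
    have hf : (G.σ ^ n) (C f) = C f := by rw [G.σ_pow_eq hz hx, taylor_C]
    have : G.powSubalgebra n ≤ Subalgebra.centralizer K {G.ev (C f)} := by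
      refine Algebra.adjoin_le ?_
      rintro _ (⟨g, rfl⟩ | rfl | rfl) <;>
        simp only [SetLike.mem_coe, Subalgebra.mem_centralizer_iff, Set.mem_singleton_iff,
          forall_eq]
      · rw [← map_mul, mul_comm, map_mul]
      · rw [G.ev_mul_u_pow, hf]
      · rw [G.d_pow_mul_ev, hf]
    exact Subtype.ext ((Subalgebra.mem_centralizer_iff K).1 (this w.2) _ rfl)
  X_mul_U := Subtype.ext ((G.ev_mul_u_pow n X).trans (by rw [hx]; rfl))
  V_mul_X := Subtype.ext ((G.d_pow_mul_ev n X).trans (by rw [hx]; rfl))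
  V_mul_U := Subtype.ext (G.d_pow_mul_u_pow n)
  U_mul_V := Subtype.ext (G.u_pow_mul_d_pow hτ n)
  taylor_b := by rw [← G.σ_pow_eq hz hx, G.σ_pow_raiseLower hτ]
  adjoin_eq_top := by
    refine top_le_iff.1 ((Algebra.adjoin_adjoin_coe_preimage (R := K)
      (s := Set.range G.ev ∪ {G.u ^ n, G.d ^ n})).ge.trans (Algebra.adjoin_mono ?_))
    rintro w (⟨f, hf⟩ | hw | hw)
    · exact Or.inl ⟨f, Subtype.ext hf⟩
    · exact Or.inr (Or.inl (Subtype.ext hw))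
    · exact Or.inr (Or.inr (Subtype.ext hw))

/-- The powers of `u` and `d` which generate the algebra over `powSubalgebra`. -/
def lowPow (n : ℕ) : Fin n ⊕ Fin n → A := Sum.elim (fun i => G.u ^ (i : ℕ)) fun i => G.d ^ (i : ℕ)

lemma exists_eq_sum_lowPow (hn : n ≠ 0) (hτ : G.σ * τ = 1) (w : A) :
    ∃ v : Fin n ⊕ Fin n → G.powSubalgebra n, w = ∑ i, (v i : A) * G.lowPow n i := by
  let W := Submodule.span (G.powSubalgebra n) (Set.range (G.lowPow n))
  have hu : ∀ i < n, G.u ^ i ∈ W := fun i hi => Submodule.subset_span ⟨Sum.inl ⟨i, hi⟩, rfl⟩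
  have hd : ∀ i < n, G.d ^ i ∈ W := fun i hi => Submodule.subset_span ⟨Sum.inr ⟨i, hi⟩, rfl⟩
  have hev : ∀ f, ∀ x ∈ W, G.ev f * x ∈ W := fun f x hx =>
    W.smul_mem (⟨G.ev f, G.ev_mem n f⟩ : G.powSubalgebra n) hx
  have h1 : (1 : A) ∈ W := by simpa using hu 0 (Nat.pos_of_ne_zero hn)
  have hu' : ∀ i ≤ n, G.u ^ i ∈ W := fun i hi => by
    rcases hi.lt_or_eq with hi | rfl
    · exact hu i hi
    · simpa [Subalgebra.smul_def] using
        W.smul_mem (⟨G.u ^ i, G.u_pow_mem i⟩ : G.powSubalgebra i) h1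
  have hd' : ∀ i ≤ n, G.d ^ i ∈ W := fun i hi => by
    rcases hi.lt_or_eq with hi | rfl
    · exact hd i hi
    · simpa [Subalgebra.smul_def] using
        W.smul_mem (⟨G.d ^ i, G.d_pow_mem i⟩ : G.powSubalgebra i) h1
  have hmul : ∀ y : A, (∀ i, G.lowPow n i * y ∈ W) → ∀ x ∈ W, x * y ∈ W := by
    intro y hy x hx
    induction hx using Submodule.span_induction with
    | mem x hx =>
      obtain ⟨i, rfl⟩ := hx
      exact hy i
    | zero => simp
    | add x x' _ _ h h' => rw [add_mul]; exact add_mem h h'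
    | smul v x _ h => rw [smul_mul_assoc]; exact W.smul_mem v h
  have hWu : ∀ x ∈ W, x * G.u ∈ W := hmul _ (by
    rintro (⟨i, hi⟩ | ⟨i, hi⟩)
    · change G.u ^ i * G.u ∈ W
      rw [← pow_succ]
      exact hu' _ hi
    · change G.d ^ i * G.u ∈ W
      rcases i with _ | i
      · simpa using hu' 1 hi
      · rw [pow_succ, mul_assoc, G.d_mul_u, d_pow_mul_ev]
        exact hev _ _ (hd i (by omega)))
  have hWd : ∀ x ∈ W, x * G.d ∈ W := hmul _ (by
    rintro (⟨i, hi⟩ | ⟨i, hi⟩)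
    · change G.u ^ i * G.d ∈ W
      rcases i with _ | i
      · simpa using hd' 1 hi
      · rw [pow_succ, mul_assoc, G.u_mul_d, G.u_pow_mul_ev hτ]
        exact hev _ _ (hu i (by omega))
    · change G.d ^ i * G.d ∈ W
      rw [← pow_succ]
      exact hd' _ hi)
  have key : ∀ y : A, ∀ x ∈ W, x * y ∈ W := by
    intro y
    have hy : y ∈ Algebra.adjoin K {G.d, G.u} := G.adjoin_eq_top ▸ Algebra.mem_top
    induction hy using Algebra.adjoin_induction with
    | mem y hy =>
      obtain rfl | rfl := hy
      exacts [hWd, hWu]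
    | algebraMap k =>
      intro x hx
      rw [← Algebra.commutes, ← Algebra.smul_def]
      exact (W.restrictScalars K).smul_mem k hx
    | add y y' _ _ h h' => intro x hx; rw [mul_add]; exact add_mem (h x hx) (h' x hx)
    | mul y y' _ _ h h' => intro x hx; rw [← mul_assoc]; exact h' _ (h x hx)
  have hw : w ∈ W := by simpa using key w 1 h1
  obtain ⟨v, hv⟩ := (Submodule.mem_span_range_iff_exists_fun _).1 hw
  exact ⟨v, hv.symm⟩

end

lemma finiteType (G : AmbiskewDatum K A) : Algebra.FiniteType K A := by
  classical exact ⟨⟨{G.d, G.u}, by simpa using G.adjoin_eq_top⟩⟩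

lemma isUnit_leadingCoeff_σ {η ρ : K} {l : K[X]} (hρ : ρ ≠ 0)
    (hz : G.σ (C X) = C (C η * X)) (hx : G.σ X = C (C ρ) * X + C l) {f : K[X][X]}
    (hf : IsUnit f.leadingCoeff) : IsUnit (G.σ f).leadingCoeff := by
  let φ : K[X] →ₐ[K] K[X] := aeval (C η * X)
  have hσ : G.σ f = (f.map φ.toRingHom).comp (C (C ρ) * X + C l) := by
    have : G.σ = ((aeval (C (C ρ) * X + C l) : K[X][X] →ₐ[K[X]] K[X][X]).restrictScalars K).comp
        (mapAlgHom φ) := by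
      refine polynomial_polynomial_algHom_ext ?_ ?_
      · rw [hz]; simp [φ]
      · rw [hx]; simp
    rw [this]
    simp [aeval_def, comp, eval₂_eq_eval_map]
  have hu : IsUnit (φ.toRingHom f.leadingCoeff) := hf.map φ.toRingHom
  rw [hσ, leadingCoeff_comp (by
    rw [natDegree_linear (by simpa using hρ)]
    exact one_ne_zero), leadingCoeff_linear (by simpa using hρ),
    leadingCoeff_map_of_leadingCoeff_ne_zero _ hu.ne_zero]
  exact hu.mul ((isUnit_C.2 hρ.isUnit).pow _)

lemma isUnit_leadingCoeff_lowerRaise {η ρ : K} {l : K[X]} (hρ : ρ ≠ 0)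
    (hz : G.σ (C X) = C (C η * X)) (hx : G.σ X = C (C ρ) * X + C l)
    (ht : IsUnit G.t.leadingCoeff) (n : ℕ) : IsUnit (G.lowerRaise n).leadingCoeff := by
  rw [lowerRaise, leadingCoeff_prod]
  have key : ∀ i, IsUnit ((G.σ ^ i) G.t).leadingCoeff := fun i => by
    induction i with
    | zero => exact ht
    | succ i ih =>
      rw [pow_succ']
      exact G.isUnit_leadingCoeff_σ hρ hz hx ih
  exact IsUnit.prod_iff.2 fun i _ => key _

theorem isArtinian_of_isMonolithElement {M : Type} [AddCommGroup M] [Module A M]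
    [Module.Finite A M] {s : M} (hs : IsMonolithElement A s) {n : ℕ} {c : K[X]} (hn : n ≠ 0)
    (hz : (G.σ ^ n) (C X) = C X) (hx : (G.σ ^ n) X = X + C c)
    (h : c = 0 ∨ CharZero K ∧ IsUnit G.t.leadingCoeff ∧ (∃ κ e, c = C κ * X ^ e) ∧
      ∃ (η ρ : K) (l : K[X]), η ≠ 0 ∧ ρ ≠ 0 ∧ G.σ (C X) = C (C η * X) ∧
        G.σ X = C (C ρ) * X + C l) : IsArtinian A M := by
  obtain ⟨τ, hτ⟩ := G.exists_σ_mul_eq_one hn hz hx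
  let _ : Module K M := Module.compHom M (algebraMap K A)
  have _ : IsScalarTower K A M := IsScalarTower.of_algebraMap_smul fun _ _ => rfl
  have _ := G.finiteType
  refine (G.genWeylDatum hτ hz hx).isArtinian_of_isMonolithElement
    (G.exists_eq_sum_lowPow hn hτ) ?_ hs
  refine h.imp id ?_
  rintro ⟨h0, ht, hc, η, ρ, l, hη, hρ, hz, hx⟩
  refine ⟨h0, G.isUnit_leadingCoeff_lowerRaise hρ hz hx ht n, hc, ?_⟩
  have hev : G.ev (C (C η * X)) = η • G.ev (C X) := by rw [C_mul', ← smul_C, map_smul]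
  have hd : ∀ i, G.d ^ i * G.ev (C X) = η ^ i • (G.ev (C X) * G.d ^ i) := fun i => by
    induction i with
    | zero => simp
    | succ i ih =>
      rw [pow_succ', mul_assoc, ih, mul_smul_comm, ← mul_assoc, G.d_mul_ev, hz, hev,
        smul_mul_assoc, smul_mul_assoc, smul_smul, mul_assoc, pow_succ]
  have hu : ∀ i, G.u ^ i * G.ev (C X) = η⁻¹ ^ i • (G.ev (C X) * G.u ^ i) := fun i => by
    induction i with
    | zero => simp
    | succ i ih =>
      have : G.u * G.ev (C X) = η⁻¹ • (G.ev (C X) * G.u) := by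
        rw [G.ev_mul_u, hz, hev, mul_smul_comm, smul_smul, inv_mul_cancel₀ hη, one_smul]
      rw [pow_succ', mul_assoc, ih, mul_smul_comm, ← mul_assoc, this,
        smul_mul_assoc, smul_smul, mul_assoc, pow_succ η⁻¹]
  refine ⟨Sum.elim (fun i => η⁻¹ ^ (i : ℕ)) fun i => η ^ (i : ℕ), ?_⟩
  rintro (i | i)
  · exact ⟨pow_ne_zero _ (inv_ne_zero hη), hu i⟩
  · exact ⟨pow_ne_zero _ hη, hd i⟩

end AmbiskewDatum

section PolynomialTwist

variable {K : Type} [Field K] {σ : K[X][X] →ₐ[K] K[X][X]} {η ρ : K}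

lemma AlgHom.apply_C_eq_comp {f : K[X]} (hz : σ (C X) = C f) (g : K[X]) :
    σ (C g) = C (g.comp f) := by
  have : σ.comp (CAlgHom (R := K) (A := K[X])) = (CAlgHom (R := K) (A := K[X])).comp (aeval f) :=
    Polynomial.algHom_ext (by simpa using hz)
  exact DFunLike.congr_fun this g

lemma pow_apply_eq_add_nsmul {S : Type*} [Semiring S] [Algebra K S] {φ : S →ₐ[K] S} {v w : S}
    (hv : φ v = v + w) (hw : φ w = w) (k : ℕ) : (φ ^ k) v = v + k • w := by
  induction k with
  | zero => simp
  | succ k ih =>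
    rw [pow_succ', AlgHom.mul_apply, ih, map_add, map_nsmul, hv, hw, succ_nsmul, add_assoc,
      add_comm w]

/-- In positive characteristic a triangular affine automorphism of the polynomial ring in two
variables whose multipliers are roots of unity has finite order. -/
lemma exists_pow_fixes_of_charP {η₀ : K} {l : K[X]} (p : ℕ) [CharP K p] {m : ℕ}
    (hη : η ^ m = 1) (hρ : ρ ^ m = 1) (hz : σ (C X) = C (C η * X + C η₀))
    (hx : σ X = C (C ρ) * X + C l) :
    (σ ^ (m * p * p)) (C X) = C X ∧ (σ ^ (m * p * p)) X = X := by
  have hCk : ∀ k, ∃ e : K, (σ ^ k) (C X) = C (C (η ^ k) * X + C e) := fun k => by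
    induction k with
    | zero => exact ⟨0, by simp⟩
    | succ k ih =>
      obtain ⟨e, he⟩ := ih
      refine ⟨η ^ k * η₀ + e, ?_⟩
      rw [pow_succ', AlgHom.mul_apply, he, AlgHom.apply_C_eq_comp hz]
      simp only [add_comp, mul_comp, C_comp, X_comp, pow_succ, C_mul, C_add]
      ring
  have hXk : ∀ k, ∃ f : K[X], (σ ^ k) X = C (C (ρ ^ k)) * X + C f := fun k => by
    induction k with
    | zero => exact ⟨0, by simp⟩
    | succ k ih =>
      obtain ⟨f, hf⟩ := ih
      refine ⟨C (ρ ^ k) * l + f.comp (C η * X + C η₀), ?_⟩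
      rw [pow_succ', AlgHom.mul_apply, hf, map_add, map_mul, AlgHom.apply_C_eq_comp hz,
        AlgHom.apply_C_eq_comp hz, hx]
      simp only [C_comp, pow_succ, C_mul, C_add]
      ring
  have hC : (σ ^ (m * p)) (C X) = C X := by
    obtain ⟨e, he⟩ := hCk m
    rw [hη, C_1, one_mul, C_add] at he
    have hK : (σ ^ m) (C (C e)) = C (C e) := (σ ^ m).commutes e
    rw [pow_mul, pow_apply_eq_add_nsmul he hK, nsmul_eq_mul, CharP.cast_eq_zero, zero_mul, add_zero]
  constructor
  · rw [pow_mul]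
    have := pow_apply_eq_add_nsmul (φ := σ ^ (m * p)) (v := C X) (w := 0)
      (by rw [hC, add_zero]) (map_zero _) p
    simpa using this
  · obtain ⟨f, hf⟩ := hXk (m * p)
    rw [pow_mul ρ, hρ, one_pow, C_1, C_1, one_mul] at hf
    have hfix : (σ ^ (m * p)) (C f) = C f := by
      rw [AlgHom.apply_C_eq_comp hC, comp_X]
    rw [pow_mul, pow_apply_eq_add_nsmul hf hfix, nsmul_eq_mul, CharP.cast_eq_zero, zero_mul,
      add_zero]

/-- The powers of a triangular automorphism which rescales `z` and sends `x` to `ρ x + z - c₀`. -/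
lemma exists_pow_apply_eq {c₀ : K} (hz : σ (C X) = C (C η * X))
    (hx : σ X = C (C ρ) * X + C (X - C c₀)) (k : ℕ) :
    (σ ^ k) (C X) = C (C (η ^ k) * X) ∧ ∃ a b : K, a * (ρ - η) = ρ ^ k - η ^ k ∧
      b * (ρ - 1) = ρ ^ k - 1 ∧
      (σ ^ k) X = C (C (ρ ^ k)) * X + C (C a * X - C (c₀ * b)) := by
  induction k with
  | zero => exact ⟨by simp, 0, 0, by simp, by simp, by simp⟩
  | succ k ih =>
    obtain ⟨h1, a, b, ha, hb, h2⟩ := ih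
    constructor
    · rw [pow_succ, AlgHom.mul_apply, hz, AlgHom.apply_C_eq_comp h1]
      simp only [mul_comp, C_comp, X_comp, pow_succ, C_mul]
      ring
    · refine ⟨ρ * a + η ^ k, ρ * b + 1, by linear_combination ρ * ha, by linear_combination ρ * hb, ?_⟩
      rw [pow_succ, AlgHom.mul_apply, hx, map_add, map_mul, AlgHom.apply_C_eq_comp h1,
        AlgHom.apply_C_eq_comp h1, h2]
      simp only [sub_comp, C_comp, X_comp, pow_succ, C_mul, C_add, C_sub, C_1]
      ring

end PolynomialTwist

section

variable {K A : Type} [Field K] [Ring A] [Algebra K A]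

/-- Evaluation of polynomials in two variables at two commuting elements. -/
def evalPair {z x : A} (hzx : Commute z x) : K[X][X] →ₐ[K] A :=
  eval₂AlgHom (aeval z) x fun f => by
    change aeval z f * x = x * aeval z f
    induction f using Polynomial.induction_on' with
    | add p q hp hq => rw [map_add, add_mul, mul_add, hp, hq]
    | monomial n k =>
      rw [aeval_monomial, mul_assoc, (hzx.pow_left n).eq, ← mul_assoc, Algebra.commutes, mul_assoc]

@[simp] lemma evalPair_C {z x : A} (hzx : Commute z x) (f : K[X]) :
    evalPair hzx (C f) = aeval z f := by
  simp [evalPair]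

@[simp] lemma evalPair_X {z x : A} (hzx : Commute z x) :
    evalPair hzx (X : K[X][X]) = x := by
  simp [evalPair]

/-- The triangular endomorphism `z ↦ η z + η₀`, `x ↦ ρ x + l(z)`. -/
def triangularTwist (η η₀ ρ : K) (l : K[X]) : K[X][X] →ₐ[K] K[X][X] :=
  evalPair (Commute.all (C (C η * X + C η₀)) (C (C ρ) * X + C l))

lemma triangularTwist_C_X (η η₀ ρ : K) (l : K[X]) :
    triangularTwist η η₀ ρ l (C X) = C (C η * X + C η₀) := by
  simp [triangularTwist]

lemma triangularTwist_X (η η₀ ρ : K) (l : K[X]) :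
    triangularTwist η η₀ ρ l X = C (C ρ) * X + C l := by
  simp [triangularTwist]

lemma mul_algHom_eq {B : Type} [Ring B] [Algebra K B] {f g : K[X][X] →ₐ[K] B} {d : B}
    (hz : d * f (C X) = g (C X) * d) (hx : d * f X = g X * d) (p : K[X][X]) :
    d * f p = g p * d := by
  have hpow : ∀ {v w : B}, d * v = w * d → ∀ n : ℕ, d * v ^ n = w ^ n * d := fun h n =>
    (show SemiconjBy d _ _ from h).pow_right n
  have hC : ∀ q : K[X], d * f (C q) = g (C q) * d := fun q => by
    induction q using Polynomial.induction_on' with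
    | add p q hp hq => simp only [map_add, mul_add, add_mul, hp, hq]
    | monomial n k =>
      rw [← smul_X_eq_monomial, ← smul_C, map_smul, map_smul, C_pow, map_pow, map_pow,
        mul_smul_comm, hpow hz, smul_mul_assoc]
  induction p using Polynomial.induction_on' with
  | add p q hp hq => simp only [map_add, mul_add, add_mul, hp, hq]
  | monomial n k =>
    rw [← C_mul_X_pow_eq_monomial, map_mul, map_mul, map_pow, map_pow, ← mul_assoc, hC, mul_assoc,
      hpow hx, mul_assoc]

lemma algHom_mul_eq {B : Type} [Ring B] [Algebra K B] {f g : K[X][X] →ₐ[K] B} {u : B}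
    (hz : f (C X) * u = u * g (C X)) (hx : f X * u = u * g X) (p : K[X][X]) :
    f p * u = u * g p :=
  (mul_algHom_eq (f := g) (g := f) hz.symm hx.symm p).symm

/-- The ambiskew datum determined by the action of `d` and `u` on two commuting elements. -/
def AmbiskewDatum.ofPair {z x d u : A} (hzx : Commute z x) {η η₀ ρ : K} {l : K[X]} {t : K[X][X]}
    (hdz : d * z = (η • z + algebraMap K A η₀) * d) (hzu : z * u = u * (η • z + algebraMap K A η₀))
    (hdx : d * x = (ρ • x + aeval z l) * d) (hxu : x * u = u * (ρ • x + aeval z l))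
    (hud : u * d = evalPair hzx t) (hdu : d * u = evalPair hzx (triangularTwist η η₀ ρ l t))
    (htop : Algebra.adjoin K {d, u} = ⊤) : AmbiskewDatum K A where
  ev := evalPair hzx
  σ := triangularTwist η η₀ ρ l
  d := d
  u := u
  t := t
  d_mul_ev := mul_algHom_eq (f := evalPair hzx) (g := (evalPair hzx).comp (triangularTwist η η₀ ρ l))
    (by simpa [triangularTwist_C_X, Algebra.smul_def] using hdz)
    (by simpa [triangularTwist_X, Algebra.smul_def] using hdx)
  ev_mul_u := algHom_mul_eq (f := evalPair hzx) (g := (evalPair hzx).comp (triangularTwist η η₀ ρ l))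
    (by simpa [triangularTwist_C_X, Algebra.smul_def] using hzu)
    (by simpa [triangularTwist_X, Algebra.smul_def] using hxu)
  u_mul_d := hud
  d_mul_u := hdu
  adjoin_eq_top := htop

variable {α β γ r s : K} {d u : A}

lemma commute_ud_du (h₁ : d * d * u = α • (d * u * d) + β • (u * d * d) + γ • d)
    (h₂ : d * u * u = α • (u * d * u) + β • (u * u * d) + γ • u) : Commute (u * d) (d * u) := by
  have e1 : u * d * (d * u) = u * (d * d * u) := by noncomm_ring
  have e2 : d * u * (u * d) = d * u * u * d := by noncomm_ring
  rw [commute_iff_eq, e1, e2, h₁, h₂]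
  simp only [mul_add, add_mul, mul_smul_comm, smul_mul_assoc, mul_assoc]

/-- The ambiskew datum with `x = u d` and `z = d u - r u d + c₀`. -/
lemma exists_ambiskewDatum (hsum : r + s = α) (hprod : r * s = -β) (c₀ : K)
    (h₁ : d * d * u = α • (d * u * d) + β • (u * d * d) + γ • d)
    (h₂ : d * u * u = α • (u * d * u) + β • (u * u * d) + γ • u)
    (htop : Algebra.adjoin K {d, u} = ⊤) :
    ∃ G : AmbiskewDatum K A, G.t = X ∧
      G.σ = triangularTwist s (γ + c₀ - s * c₀) r (X - C c₀) := by
  have hc := commute_ud_du h₁ h₂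
  have hzx : Commute (d * u - r • (u * d) + algebraMap K A c₀) (u * d) :=
    (hc.symm.sub_left ((Commute.refl _).smul_left r)).add_left (Algebra.commute_algebraMap_left _ _)
  have hβ : β = -(r * s) := by rw [hprod, neg_neg]
  subst hsum hβ
  refine ⟨AmbiskewDatum.ofPair hzx (d := d) (u := u) (η := s) (η₀ := γ + c₀ - s * c₀) (ρ := r)
    (l := X - C c₀) (t := X) ?_ ?_ ?_ ?_ ?_ ?_ htop, rfl, rfl⟩
  · have e : d * (d * u - r • (u * d) + algebraMap K A c₀) =
        d * d * u - r • (d * u * d) + c₀ • d := by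
      simp [mul_add, mul_sub, mul_assoc, Algebra.smul_def, Algebra.commutes]
    rw [e, h₁]
    simp only [Algebra.algebraMap_eq_smul_one, add_mul, sub_mul, smul_mul_assoc, one_mul, smul_add,
      smul_sub]
    module
  · have e : (d * u - r • (u * d) + algebraMap K A c₀) * u =
        d * u * u - r • (u * d * u) + c₀ • u := by
      simp [add_mul, sub_mul, Algebra.algebraMap_eq_smul_one]
    rw [e, h₂]
    simp only [Algebra.algebraMap_eq_smul_one, mul_add, mul_sub, mul_smul_comm, mul_one, smul_add,
      smul_sub, mul_assoc]
    module
  · simp [mul_assoc]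
  · simp [mul_assoc]
  · simp
  · simp [triangularTwist_X, Algebra.smul_def]

/-- The ambiskew datum with central `z` and `x = d u - u d` when both roots equal `1`. -/
lemma exists_ambiskewDatum_of_roots_eq_one [CharZero K] (hγ : γ ≠ 0)
    (h₁ : d * d * u = (2 : K) • (d * u * d) + (-1 : K) • (u * d * d) + γ • d)
    (h₂ : d * u * u = (2 : K) • (u * d * u) + (-1 : K) • (u * u * d) + γ • u)
    (htop : Algebra.adjoin K {d, u} = ⊤) :
    ∃ G : AmbiskewDatum K A, IsUnit G.t.leadingCoeff ∧ G.σ = triangularTwist 1 0 1 (C γ) := by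
  have hc := commute_ud_du h₁ h₂
  set t := u * d with ht
  set t' := d * u with ht'
  have hdt : d * t = t' * d := by simp [ht, ht', mul_assoc]
  have htu : t * u = u * t' := by simp [ht, ht', mul_assoc]
  have hdx : d * (t' - t) = (t' - t + γ • 1) * d := by
    have e : d * (t' - t) = d * d * u - t' * d := by
      rw [mul_sub, hdt, ht', mul_assoc d d u]
    rw [e, h₁, ht, ht', add_mul, sub_mul, smul_mul_assoc, one_mul]
    module
  have hxu : (t' - t) * u = u * (t' - t + γ • 1) := by
    have e : (t' - t) * u = t' * u - u * t' := by rw [sub_mul, htu]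
    rw [e, h₂, ht, ht', mul_add, mul_sub, mul_smul_comm, mul_one]
    simp only [mul_assoc]
    module
  have hxt : Commute (t' - t) t := hc.symm.sub_left (Commute.refl _)
  have hrel : t' = t' - t + t := by abel
  generalize hxdef : t' - t = x at hdx hxu hxt hrel
  obtain ⟨z, hz⟩ : ∃ z, z = x * x - γ • x - (2 * γ) • t := ⟨_, rfl⟩
  have hzx : Commute z x := by
    rw [hz]
    exact (((Commute.refl x).mul_left (Commute.refl x)).sub_left
      ((Commute.refl x).smul_left _)).sub_left (hxt.symm.smul_left _)
  have hdxx : d * (x * x) = (x + γ • 1) * (x + γ • 1) * d := by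
    rw [← mul_assoc, hdx, mul_assoc, hdx, mul_assoc]
  have hxxu : x * x * u = u * ((x + γ • 1) * (x + γ • 1)) := by
    rw [mul_assoc, hxu, ← mul_assoc, hxu, mul_assoc]
  have key : (x + γ • (1 : A)) * (x + γ • 1) - γ • (x + γ • 1) - (2 * γ) • t' = z := by
    rw [hrel, hz]
    simp only [mul_add, add_mul, smul_mul_assoc, mul_smul_comm, mul_one, one_mul]
    module
  have h2γ : 2 * γ ≠ 0 := mul_ne_zero two_ne_zero hγ
  have hT : (2 * γ)⁻¹ • (x * x - γ • x - z) = t := by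
    rw [hz, sub_sub_cancel, smul_smul, inv_mul_cancel₀ h2γ, one_smul]
  have hT' : (2 * γ)⁻¹ • ((x + γ • (1 : A)) * (x + γ • 1) - γ • (x + γ • 1) - z) = t' := by
    rw [← key, sub_sub_cancel, smul_smul, inv_mul_cancel₀ h2γ, one_smul]
  refine ⟨AmbiskewDatum.ofPair hzx (d := d) (u := u) (η := 1) (η₀ := 0) (ρ := 1)
    (l := C γ) (t := C (C (2 * γ)⁻¹) * (X ^ 2 - C (C γ) * X - C X)) ?_ ?_ ?_ ?_ ?_ ?_ htop, ?_, rfl⟩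
  · rw [one_smul, map_zero, add_zero]
    nth_rewrite 1 [hz]
    rw [← key, mul_sub, mul_sub, hdxx, mul_smul_comm, hdx, mul_smul_comm, hdt, sub_mul, sub_mul,
      smul_mul_assoc, smul_mul_assoc]
  · rw [one_smul, map_zero, add_zero]
    nth_rewrite 1 [hz]
    rw [sub_mul, sub_mul, hxxu, smul_mul_assoc, hxu, smul_mul_assoc, htu, ← key, mul_sub, mul_sub,
      mul_smul_comm, mul_smul_comm]
  · simpa [Algebra.algebraMap_eq_smul_one] using hdx
  · simpa [Algebra.algebraMap_eq_smul_one] using hxu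
  · rw [← ht, ← hT]
    simp [Algebra.algebraMap_eq_smul_one, pow_two]
    rw [smul_smul, mul_comm]
  · rw [← ht', ← hT']
    simp [Algebra.algebraMap_eq_smul_one, pow_two, triangularTwist]
    rw [mul_comm, mul_smul]
  · change IsUnit (C (C (2 * γ)⁻¹) * (X ^ 2 - C (C γ) * X - C X) : K[X][X]).leadingCoeff
    have : (X ^ 2 - C (C γ) * X - C X : K[X][X]).Monic := by monicity!
    rw [leadingCoeff_mul, this.leadingCoeff, mul_one, leadingCoeff_C]
    exact isUnit_C.2 (inv_ne_zero h2γ).isUnit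

variable {M : Type} [AddCommGroup M] [Module A M] [Module.Finite A M] {m : M}

lemma isArtinian_of_charZero_of_mul_eq [CharZero K] (hsum : r + s = α) (hprod : r * s = -β)
    (h₁ : d * d * u = α • (d * u * d) + β • (u * d * d) + γ • d)
    (h₂ : d * u * u = α • (u * d * u) + β • (u * u * d) + γ • u)
    (htop : Algebra.adjoin K {d, u} = ⊤) {n : ℕ} (hn : n ≠ 0) (hr : r ^ n = 1) (hs : s ^ n = 1)
    {c₀ : K} (hc : c₀ * (s - 1) = γ) (hc1 : s = 1 → c₀ = 0) (hm : IsMonolithElement A m) :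
    IsArtinian A M := by
  obtain ⟨G, ht, hσ⟩ := exists_ambiskewDatum hsum hprod c₀ h₁ h₂ htop
  have hz : G.σ (C X) = C (C s * X) := by
    rw [hσ, triangularTwist_C_X, show γ + c₀ - s * c₀ = 0 by linear_combination -hc, C_0, add_zero]
  have hx : G.σ X = C (C r) * X + C (X - C c₀) := by rw [hσ, triangularTwist_X]
  obtain ⟨hzn, a, b, ha, hb, hxn⟩ := exists_pow_apply_eq hz hx n
  rw [hs, C_1, one_mul] at hzn
  rw [hr, C_1, C_1, one_mul] at hxn
  rw [hr, hs, sub_self, mul_eq_zero, sub_eq_zero] at ha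
  rw [hr, sub_self, mul_eq_zero, sub_eq_zero] at hb
  refine G.isArtinian_of_isMonolithElement hm hn hzn hxn (Or.inr ⟨inferInstance, ?_, ?_,
    s, r, _, ?_, ?_, hz, hx⟩)
  · simp [ht]
  · have hab : a = 0 ∨ c₀ * b = 0 := by
      rcases ha with ha | rfl
      · exact Or.inl ha
      · rcases hb with rfl | hb
        · exact Or.inr (mul_zero _)
        · exact Or.inr (by rw [hc1 hb, zero_mul])
    rcases hab with h | h
    · exact ⟨-(c₀ * b), 0, by simp [h]⟩
    · exact ⟨a, 1, by simp [h]⟩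
  · rintro rfl
    exact zero_ne_one (by rwa [zero_pow hn] at hs)
  · rintro rfl
    exact zero_ne_one (by rwa [zero_pow hn] at hr)

/-- Finitely generated modules over a down-up algebra which have a simple essential submodule are
Artinian when both roots are roots of unity. -/
theorem isArtinian_of_pow_eq_one (hsum : r + s = α) (hprod : r * s = -β)
    (h₁ : d * d * u = α • (d * u * d) + β • (u * d * d) + γ • d)
    (h₂ : d * u * u = α • (u * d * u) + β • (u * u * d) + γ • u)
    (htop : Algebra.adjoin K {d, u} = ⊤) {n : ℕ} (hn : n ≠ 0) (hr : r ^ n = 1) (hs : s ^ n = 1)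
    (hm : IsMonolithElement A m) : IsArtinian A M := by
  obtain ⟨p, hp⟩ := CharP.exists K
  rcases eq_or_ne p 0 with rfl | hp0
  · have := CharP.charP_to_charZero K
    by_cases hs1 : s = 1
    · by_cases hr1 : r = 1
      · by_cases hγ : γ = 0
        · exact isArtinian_of_charZero_of_mul_eq hsum hprod h₁ h₂ htop hn hr hs (c₀ := 0)
            (by rw [zero_mul, hγ]) (fun _ => rfl) hm
        · obtain rfl : α = 2 := by rw [← hsum, hr1, hs1, one_add_one_eq_two]
          obtain rfl : β = -1 := by rw [hr1, hs1, one_mul] at hprod; rw [hprod, neg_neg]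
          obtain ⟨G, ht, hσ⟩ := exists_ambiskewDatum_of_roots_eq_one hγ h₁ h₂ htop
          have hz : G.σ (C X) = C (C 1 * X) := by rw [hσ, triangularTwist_C_X, C_0, add_zero]
          have hx : G.σ X = C (C 1) * X + C (C γ) := by rw [hσ, triangularTwist_X]
          refine G.isArtinian_of_isMonolithElement hm one_ne_zero (c := C γ) ?_ ?_
            (Or.inr ⟨inferInstance, ht, ⟨γ, 0, by simp⟩, 1, 1, _, one_ne_zero, one_ne_zero, hz, hx⟩)
          · rw [pow_one, hz, C_1, one_mul]
          · rw [pow_one, hx, C_1, C_1, one_mul]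
      · exact isArtinian_of_charZero_of_mul_eq ((add_comm _ _).trans hsum)
          ((mul_comm _ _).trans hprod) h₁ h₂ htop hn hs hr
          (div_mul_cancel₀ γ (sub_ne_zero.2 hr1)) (fun h => absurd h hr1) hm
    · exact isArtinian_of_charZero_of_mul_eq hsum hprod h₁ h₂ htop hn hr hs
        (div_mul_cancel₀ γ (sub_ne_zero.2 hs1)) (fun h => absurd h hs1) hm
  · obtain ⟨G, -, hσ⟩ := exists_ambiskewDatum hsum hprod 0 h₁ h₂ htop
    obtain ⟨hz, hx⟩ := exists_pow_fixes_of_charP (σ := G.σ) p hs hr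
      ((DFunLike.congr_fun hσ _).trans (triangularTwist_C_X _ _ _ _))
      ((DFunLike.congr_fun hσ _).trans (triangularTwist_X _ _ _ _))
    exact G.isArtinian_of_isMonolithElement hm (mul_ne_zero (mul_ne_zero hn hp0) hp0) hz
      (c := 0) (by rw [hx, C_0, add_zero]) (Or.inl rfl)

end

section

variable {K P : Type*} [Field K] [AddCommGroup P] [Module K P]

lemma Submodule.aeval_apply_mem {N : Submodule K P} {T : Module.End K P} (hT : ∀ x ∈ N, T x ∈ N)
    (p : K[X]) {x : P} (hx : x ∈ N) : aeval T p x ∈ N := by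
  induction p using Polynomial.induction_on' with
  | add p q hp hq => rw [map_add]; exact add_mem hp hq
  | monomial n k =>
    rw [aeval_monomial, ← Algebra.smul_def]
    refine N.smul_mem k ?_
    induction n with
    | zero => exact hx
    | succ n ih => rw [pow_succ']; exact hT _ ih

lemma map_aeval_apply_of_map_eq_mul {T : Module.End K P} {π : P →ₗ[K] K} {μ : K}
    (h : ∀ x, π (T x) = μ * π x) (p : K[X]) (x : P) : π (aeval T p x) = p.eval μ * π x := by
  induction p using Polynomial.induction_on' with
  | add p q hp hq => simp [add_mul, hp, hq]
  | monomial n k =>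
    have : ∀ n, π ((T ^ n) x) = μ ^ n * π x := fun n => by
      induction n with
      | zero => simp
      | succ n ih => rw [pow_succ', Module.End.mul_apply, h, ih, pow_succ', mul_assoc]
    rw [aeval_monomial, ← Algebra.smul_def, LinearMap.smul_apply, map_smul, this, smul_eq_mul,
      eval_monomial, mul_assoc]

/-- A polynomial in an operator acting diagonally on coordinates isolates any one of them. -/
lemma exists_aeval_apply_eq_single {ι : Type*} {T : Module.End K P} {π : P →ₗ[K] ι →₀ K}
    {μ : ι → K} (hμ : Function.Injective μ) (h : ∀ x i, π (T x) i = μ i * π x i) {x : P} {j : ι}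
    (hj : π x j ≠ 0) : ∃ (p : K[X]) (c : K), c ≠ 0 ∧ π (aeval T p x) = Finsupp.single j c := by
  classical
  let p : K[X] := ∏ i ∈ (π x).support.erase j, (X - C (μ i))
  have hp : ∀ i, π (aeval T p x) i = p.eval (μ i) * π x i := fun i =>
    map_aeval_apply_of_map_eq_mul (π := Finsupp.lapply i ∘ₗ π) (fun y => h y i) p x
  refine ⟨p, p.eval (μ j) * π x j, mul_ne_zero ?_ hj, Finsupp.ext fun i => ?_⟩
  · rw [eval_prod, Finset.prod_ne_zero_iff]
    intro i hi
    rw [eval_sub, eval_X, eval_C, sub_ne_zero]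
    exact fun e => (Finset.mem_erase.1 hi).1 (hμ e).symm
  · rw [hp]
    rcases eq_or_ne i j with rfl | hij
    · simp
    · rw [Finsupp.single_eq_of_ne hij]
      by_cases hi : π x i = 0
      · rw [hi, mul_zero]
      · rw [eval_prod, Finset.prod_eq_zero (i := i) (by simp [hij, hi]) (by simp), zero_mul]

end

namespace SkewExtension

variable {K : Type} [Field K]

/-- The underlying space of a non-Artinian essential extension of a simple module: the first
factor is the simple module, the second one the quotient. -/
abbrev Space (K : Type) [Field K] : Type := (ℤ →₀ K) × (ℕ →₀ K)

/-- Basis vector of the simple module. -/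
def sv (k : ℤ) : Space K := (Finsupp.single k 1, 0)

/-- Basis vector of the quotient. -/
def wv (k : ℕ) : Space K := (0, Finsupp.single k 1)

/-- The linear map with given values on the basis vectors. -/
def lin (f : ℤ → Space K) (g : ℕ → Space K) : Module.End K (Space K) :=
  (Finsupp.linearCombination K f).coprod (Finsupp.linearCombination K g)

@[simp] lemma lin_sv (f : ℤ → Space K) (g : ℕ → Space K) (k : ℤ) : lin f g (sv k) = f k := by
  simp [lin, sv]

@[simp] lemma lin_wv (f : ℤ → Space K) (g : ℕ → Space K) (k : ℕ) : lin f g (wv k) = g k := by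
  simp [lin, wv]

lemma hom_ext {Q : Type*} [AddCommGroup Q] [Module K Q] {f g : Space K →ₗ[K] Q}
    (hs : ∀ k, f (sv k) = g (sv k)) (hw : ∀ k, f (wv k) = g (wv k)) : f = g := by
  refine LinearMap.prod_ext (Finsupp.lhom_ext' fun k => LinearMap.ext_ring ?_)
    (Finsupp.lhom_ext' fun k => LinearMap.ext_ring ?_)
  · exact hs k
  · exact hw k

variable (q : K)

/-- The shift. -/
def θ (K : Type) [Field K] : Module.End K (Space K) := lin (fun k => sv (k + 1)) fun k => wv (k + 1)

/-- The action of the generator `u`. -/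
def up : Module.End K (Space K) :=
  lin (fun k => q ^ (-k) • sv (k - 1)) fun k => q ^ (-(k : ℤ)) • (wv k + sv (k : ℤ))

/-- The inverse of `up`. -/
def upInv : Module.End K (Space K) :=
  lin (fun k => q ^ (k + 1) • sv (k + 1)) fun k =>
    q ^ (k : ℤ) • wv k - q ^ ((k : ℤ) + 1) • sv ((k : ℤ) + 1)

variable {q}

@[simp] lemma sv_fst (k : ℤ) : (sv k : Space K).1 = Finsupp.single k 1 := rfl

@[simp] lemma sv_snd (k : ℤ) : (sv k : Space K).2 = 0 := rfl

@[simp] lemma wv_fst (k : ℕ) : (wv k : Space K).1 = 0 := rfl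

@[simp] lemma wv_snd (k : ℕ) : (wv k : Space K).2 = Finsupp.single k 1 := rfl

lemma θ_sv (k : ℤ) : θ K (sv k) = sv (k + 1) := lin_sv _ _ k

lemma θ_wv (k : ℕ) : θ K (wv k) = wv (k + 1) := lin_wv _ _ k

lemma up_sv (k : ℤ) : up q (sv k) = q ^ (-k) • sv (k - 1) := lin_sv _ _ k

lemma up_wv (k : ℕ) : up q (wv k) = q ^ (-(k : ℤ)) • (wv k + sv (k : ℤ)) := lin_wv _ _ k

lemma upInv_sv (k : ℤ) : upInv q (sv k) = q ^ (k + 1) • sv (k + 1) := lin_sv _ _ k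

lemma upInv_wv (k : ℕ) :
    upInv q (wv k) = q ^ (k : ℤ) • wv k - q ^ ((k : ℤ) + 1) • sv ((k : ℤ) + 1) := lin_wv _ _ k

lemma up_mul_upInv (hq : q ≠ 0) : up q * upInv q = 1 := by
  refine hom_ext (fun k => ?_) fun k => ?_
  · rw [Module.End.mul_apply, upInv_sv, map_smul, up_sv, smul_smul, ← zpow_add₀ hq]
    simp
  · rw [Module.End.mul_apply, upInv_wv, map_sub, map_smul, map_smul, up_wv, up_sv, smul_smul,
      smul_smul, ← zpow_add₀ hq, ← zpow_add₀ hq]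
    simp

lemma upInv_mul_up (hq : q ≠ 0) : upInv q * up q = 1 := by
  refine hom_ext (fun k => ?_) fun k => ?_
  · rw [Module.End.mul_apply, up_sv, map_smul, upInv_sv, smul_smul, ← zpow_add₀ hq]
    simp
  · rw [Module.End.mul_apply, up_wv, map_smul, map_add, upInv_wv, upInv_sv, sub_add_cancel,
      smul_smul, ← zpow_add₀ hq]
    simp

lemma θ_mul_up (hq : q ≠ 0) : θ K * up q = q • (up q * θ K) := by
  have e : ∀ k : ℤ, q * q ^ (-(k + 1)) = q ^ (-k) := fun k => by
    rw [← zpow_one_add₀ hq]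
    congr 1
    ring
  refine hom_ext (fun k => ?_) fun k => ?_
  · rw [LinearMap.smul_apply, Module.End.mul_apply, Module.End.mul_apply, up_sv, θ_sv, up_sv,
      map_smul, θ_sv, smul_smul, e, sub_add_cancel, add_sub_cancel_right]
  · rw [LinearMap.smul_apply, Module.End.mul_apply, Module.End.mul_apply, up_wv, θ_wv, up_wv,
      map_smul, map_add, θ_wv, θ_sv, smul_smul, Nat.cast_succ, e]

/-- The diagonal action of `up * θ` on the simple module. -/
lemma up_θ_inl (x : ℤ →₀ K) :
    up q (θ K (x, 0)) = (Finsupp.linearCombination K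
      (fun k : ℤ => q ^ (-(k + 1)) • Finsupp.single k (1 : K)) x, 0) := by
  have : (up q * θ K) ∘ₗ LinearMap.inl K _ _ = LinearMap.inl K (ℤ →₀ K) (ℕ →₀ K) ∘ₗ
      Finsupp.linearCombination K (fun k : ℤ => q ^ (-(k + 1)) • Finsupp.single k (1 : K)) := by
    refine Finsupp.lhom_ext' fun k => LinearMap.ext_ring ?_
    change up q (θ K (sv k)) = _
    rw [θ_sv, up_sv, add_sub_cancel_right]
    simp [sv]
  exact LinearMap.congr_fun this x

lemma snd_up (x : Space K) (k : ℕ) : (up q x).2 k = q ^ (-(k : ℤ)) * x.2 k := by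
  have : (Finsupp.lapply k ∘ₗ LinearMap.snd K _ _) ∘ₗ up q =
      q ^ (-(k : ℤ)) • (Finsupp.lapply k ∘ₗ LinearMap.snd K (ℤ →₀ K) (ℕ →₀ K)) := by
    refine hom_ext (fun i => ?_) fun i => ?_
    · simp [up_sv]
    · rcases eq_or_ne i k with rfl | h <;> simp [up_wv, *]
  exact LinearMap.congr_fun this x

lemma snd_upInv (x : Space K) (k : ℕ) : (upInv q x).2 k = q ^ (k : ℤ) * x.2 k := by
  have : (Finsupp.lapply k ∘ₗ LinearMap.snd K _ _) ∘ₗ upInv q =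
      q ^ (k : ℤ) • (Finsupp.lapply k ∘ₗ LinearMap.snd K (ℤ →₀ K) (ℕ →₀ K)) := by
    refine hom_ext (fun i => ?_) fun i => ?_
    · simp [upInv_sv]
    · rcases eq_or_ne i k with rfl | h <;> simp [upInv_wv, *]
  exact LinearMap.congr_fun this x

lemma snd_θ (x : Space K) : (θ K x).2 = Finsupp.lmapDomain K K Nat.succ x.2 := by
  have : LinearMap.snd K _ _ ∘ₗ θ K =
      Finsupp.lmapDomain K K Nat.succ ∘ₗ LinearMap.snd K (ℤ →₀ K) (ℕ →₀ K) := by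
    refine hom_ext (fun i => ?_) fun i => ?_
    · simp [θ_sv]
    · simp [θ_wv]
  exact LinearMap.congr_fun this x

lemma snd_θ_apply_eq_zero {n : ℕ} {x : Space K} (hx : ∀ k < n, x.2 k = 0) {k : ℕ} (hk : k < n) :
    (θ K x).2 k = 0 := by
  rw [snd_θ, Finsupp.lmapDomain_apply]
  rcases k with _ | k
  · exact Finsupp.mapDomain_of_notMem_range _ _ (by simp)
  · exact (Finsupp.mapDomain_apply Nat.succ_injective _ k).trans (hx k (by omega))

lemma zpow_injective (hq : q ≠ 0) (h : ∀ k : ℕ, 0 < k → q ^ k ≠ 1) :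
    Function.Injective fun k : ℤ => q ^ k := by
  have : ¬ IsOfFinOrder (Units.mk0 q hq) := fun hf => by
    obtain ⟨k, hk, e⟩ := isOfFinOrder_iff_pow_eq_one.1 hf
    exact h k hk (by simpa using congrArg Units.val e)
  intro a b hab
  refine injective_zpow_iff_not_isOfFinOrder.2 this (Units.ext ?_)
  simpa using hab

section Invariant

variable {N : Submodule K (Space K)}

lemma sv_mem_of_sv_mem (hq : q ≠ 0) (hu : ∀ x ∈ N, up q x ∈ N) (hθ : ∀ x ∈ N, θ K x ∈ N) {j : ℤ}
    (hj : sv j ∈ N) (k : ℤ) : sv k ∈ N := by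
  induction k using Int.inductionOn' (b := j) with
  | zero => exact hj
  | succ k _ ih => simpa [θ_sv, θ_wv] using hθ _ ih
  | pred k _ ih =>
    have := hu _ ih
    rw [up_sv] at this
    exact (N.smul_mem_iff (zpow_ne_zero _ hq)).1 this

lemma mem_of_forall_sv_mem (h : ∀ k, sv k ∈ N) {x : Space K} (hx : x.2 = 0) : x ∈ N := by
  obtain ⟨a, b⟩ := x
  obtain rfl : b = 0 := hx
  induction a using Finsupp.induction_linear with
  | zero => exact N.zero_mem
  | add f g hf hg => simpa using add_mem hf hg
  | single k c => simpa [sv] using N.smul_mem c (h k)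

lemma le_of_wv_zero_mem (hq : q ≠ 0) (hu : ∀ x ∈ N, up q x ∈ N) (hθ : ∀ x ∈ N, θ K x ∈ N)
    (h : wv 0 ∈ N) (x : Space K) : x ∈ N := by
  have hs : sv 0 ∈ N := by
    have := sub_mem (hu _ h) h
    simpa [up_wv] using this
  have hw : ∀ k, wv k ∈ N := fun k => by
    induction k with
    | zero => exact h
    | succ k ih => simpa [θ_sv, θ_wv] using hθ _ ih
  have h1 : (x.1, (0 : ℕ →₀ K)) ∈ N := mem_of_forall_sv_mem (sv_mem_of_sv_mem hq hu hθ hs) rfl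
  have h2 : ∀ b : ℕ →₀ K, ((0 : ℤ →₀ K), b) ∈ N := fun b => by
    induction b using Finsupp.induction_linear with
    | zero => exact N.zero_mem
    | add f g hf hg => simpa using add_mem hf hg
    | single k c => simpa [wv] using N.smul_mem c (hw k)
  simpa using add_mem h1 (h2 x.2)

/-- The first factor is simple. -/
lemma mem_of_snd_eq_zero (hq : q ≠ 0) (hroot : ∀ k : ℕ, 0 < k → q ^ k ≠ 1)
    (hu : ∀ x ∈ N, up q x ∈ N) (hθ : ∀ x ∈ N, θ K x ∈ N) {x : Space K} (hxN : x ∈ N) (hx0 : x ≠ 0)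
    (hx : x.2 = 0) {y : Space K} (hy : y.2 = 0) : y ∈ N := by
  obtain ⟨a, b⟩ := x
  obtain rfl : b = 0 := hx
  obtain ⟨j, hj⟩ : ∃ j, a j ≠ 0 := by
    by_contra! h
    exact hx0 (Prod.ext (Finsupp.ext h) rfl)
  let T : Module.End K (ℤ →₀ K) :=
    Finsupp.linearCombination K fun k : ℤ => q ^ (-(k + 1)) • Finsupp.single k (1 : K)
  have hT : ∀ x ∈ N.comap (LinearMap.inl K _ _), T x ∈ N.comap (LinearMap.inl K _ _) :=
    fun x hx => by
      have := hu _ (hθ _ hx)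
      rw [LinearMap.inl_apply, up_θ_inl] at this
      exact this
  have hdiag : ∀ x i, T x i = q ^ (-(i + 1)) * x i := fun x i => by
    have : Finsupp.lapply i ∘ₗ T = q ^ (-(i + 1)) • Finsupp.lapply i := by
      refine Finsupp.lhom_ext' fun k => LinearMap.ext_ring ?_
      rcases eq_or_ne k i with rfl | h <;> simp [T, *]
    exact LinearMap.congr_fun this x
  obtain ⟨p, c, hc, hp⟩ := exists_aeval_apply_eq_single (T := T) (π := LinearMap.id)
    (μ := fun k : ℤ => q ^ (-(k + 1))) (fun k l h => by simpa using zpow_injective hq hroot h)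
    hdiag hj
  have hmem := Submodule.aeval_apply_mem hT p (x := a) hxN
  rw [LinearMap.id_apply] at hp
  rw [hp] at hmem
  refine mem_of_forall_sv_mem (sv_mem_of_sv_mem hq hu hθ (j := j) ?_) hy
  refine (N.smul_mem_iff hc).1 ?_
  simpa [sv] using hmem

/-- The first factor is essential. -/
lemma exists_mem_snd_eq_zero (hq : q ≠ 0) (hroot : ∀ k : ℕ, 0 < k → q ^ k ≠ 1)
    (hu : ∀ x ∈ N, up q x ∈ N) {x : Space K} (hxN : x ∈ N) (hx0 : x ≠ 0) :
    ∃ y ∈ N, y ≠ 0 ∧ y.2 = 0 := by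
  by_cases hx : x.2 = 0
  · exact ⟨x, hxN, hx0, hx⟩
  obtain ⟨j, hj⟩ : ∃ j, x.2 j ≠ 0 := by
    by_contra! h
    exact hx (Finsupp.ext h)
  obtain ⟨p, c, hc, hp⟩ := exists_aeval_apply_eq_single (T := up q)
    (π := LinearMap.snd K (ℤ →₀ K) (ℕ →₀ K)) (μ := fun k : ℕ => q ^ (-(k : ℤ)))
    (fun k l h => by simpa using zpow_injective hq hroot h) (fun x i => snd_up x i) hj
  have hmem := Submodule.aeval_apply_mem hu p hxN
  generalize aeval (up q) p x = y at hp hmem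
  refine ⟨up q y - q ^ (-(j : ℤ)) • y, sub_mem (hu _ hmem) (N.smul_mem _ hmem), ?_, ?_⟩
  · let L : Space K →ₗ[K] K := Finsupp.linearCombination K
      (fun k : ℤ => q ^ ((j : ℤ) * k - k * (k + 1) / 2)) ∘ₗ LinearMap.fst K _ _
    have hy : y = (y.1, 0) + c • wv j := by
      refine Prod.ext (by simp [wv]) ?_
      simpa [wv] using hp
    have hL : ∀ a : ℤ →₀ K, L (up q (a, 0)) = q ^ (-(j : ℤ)) * L (a, 0) := fun a => by
      have : (L ∘ₗ up q) ∘ₗ LinearMap.inl K _ _ =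
          q ^ (-(j : ℤ)) • (L ∘ₗ LinearMap.inl K (ℤ →₀ K) (ℕ →₀ K)) := by
        refine Finsupp.lhom_ext' fun k => LinearMap.ext_ring ?_
        change L (up q (sv k)) = q ^ (-(j : ℤ)) * L (sv k)
        have e : (k - 1) * (k - 1 + 1) / 2 + k = k * (k + 1) / 2 := by
          rw [show k * (k + 1) = (k - 1) * (k - 1 + 1) + k * 2 by ring,
            Int.add_mul_ediv_right _ _ two_ne_zero]
        simp only [up_sv, map_smul, L, LinearMap.comp_apply, LinearMap.fst_apply, sv_fst,
          Finsupp.linearCombination_single, one_mul, smul_eq_mul, ← zpow_add₀ hq, ← e]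
        congr 1
        ring
      exact LinearMap.congr_fun this a
    intro h0
    have h1 := congrArg L h0
    rw [hy] at h1
    simp only [map_sub, map_add, map_smul, hL, smul_eq_mul, map_zero] at h1
    have h2 : L (wv j) = 0 := by simp [L, wv]
    have h3 : L (up q (wv j)) ≠ 0 := by
      simp [up_wv, L, hq, zpow_ne_zero]
    rw [h2] at h1
    refine mul_ne_zero hc h3 ?_
    linear_combination h1
  · refine Finsupp.ext fun k => ?_
    have := snd_up (q := q) y k
    rcases eq_or_ne k j with rfl | hk
    · simp [this]
    · have hyk : y.2 k = 0 := by
        rw [show y.2 = Finsupp.single j c from hp, Finsupp.single_eq_of_ne hk]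
      simp [this, hyk]

end Invariant

end SkewExtension

/-- The relations of a down-up algebra hold in the presence of an invertible `u` which commutes
with `θ` up to a root `q` of the defining polynomial. -/
lemma downUp_relations_of_mul_eq_smul_mul {K E : Type*} [Field K] [Ring E] [Algebra K E]
    {α β γ q κ : K} (hq : q * q = α * q + β) (hκ : κ * (1 - α - β) = γ) {θ u v : E}
    (huv : u * v = 1) (hvu : v * u = 1) (hθu : θ * u = q • (u * θ)) {d : E}
    (hd : d = v * (θ + κ • 1)) :
    d * d * u = α • (d * u * d) + β • (u * d * d) + γ • d ∧
    d * u * u = α • (u * d * u) + β • (u * u * d) + γ • u := by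
  have hud : u * d = θ + κ • 1 := by rw [hd, ← mul_assoc, huv, one_mul]
  have hdu : d * u = q • θ + κ • 1 := by
    rw [hd, mul_assoc, add_mul, hθu, mul_add, mul_smul_comm, ← mul_assoc, hvu, one_mul,
      smul_mul_assoc, one_mul, mul_smul_comm, hvu]
  have hdθ : d * θ = q • (θ * d) := by
    have : v * θ = q • (θ * v) := by
      calc v * θ = v * (θ * u) * v := by rw [mul_assoc, mul_assoc, huv, mul_one]
        _ = q • (θ * v) := by
          rw [hθu, mul_smul_comm, ← mul_assoc, hvu, one_mul, smul_mul_assoc]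
    have hc : (θ + κ • (1 : E)) * θ = θ * (θ + κ • 1) := by
      rw [add_mul, mul_add, smul_mul_assoc, mul_smul_comm, one_mul, mul_one]
    rw [hd, mul_assoc, hc, ← mul_assoc, this, smul_mul_assoc, mul_assoc]
  subst hκ
  obtain rfl : β = q * q - α * q := by rw [hq]; ring
  constructor
  · rw [mul_assoc d d u, hdu, hud, mul_add, mul_smul_comm, hdθ]
    simp only [add_mul, smul_mul_assoc, mul_smul_comm, one_mul, mul_one]
    module
  · rw [mul_assoc u d u, mul_assoc u u d, hdu, hud]
    simp only [add_mul, mul_add, smul_mul_assoc, mul_smul_comm, one_mul, mul_one, hθu]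
    module

namespace DownUpAlgebra

variable {K : Type} [Field K] {α β γ : K}

lemma relation_d : d K α β γ * d K α β γ * u K α β γ =
    α • (d K α β γ * u K α β γ * d K α β γ) + β • (u K α β γ * d K α β γ * d K α β γ) +
      γ • d K α β γ := by
  simpa [d, u] using RingQuot.mkAlgHom_rel K (DownUpRel.rel1 (K := K) (α := α) (β := β) (γ := γ))

lemma relation_u : d K α β γ * u K α β γ * u K α β γ =
    α • (u K α β γ * d K α β γ * u K α β γ) + β • (u K α β γ * u K α β γ * d K α β γ) +
      γ • u K α β γ := by
  simpa [d, u] using RingQuot.mkAlgHom_rel K (DownUpRel.rel2 (K := K) (α := α) (β := β) (γ := γ))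

lemma adjoin_d_u : Algebra.adjoin K {d K α β γ, u K α β γ} = ⊤ := by
  have h : (Algebra.adjoin K (Set.range (ι K : Fin 2 → _))).map
      (RingQuot.mkAlgHom K (DownUpRel K α β γ)) = ⊤ := by
    rw [FreeAlgebra.adjoin_range_ι, Algebra.map_top, AlgHom.range_eq_top]
    exact RingQuot.mkAlgHom_surjective K _
  rw [← top_le_iff, ← h, AlgHom.map_adjoin]
  refine Algebra.adjoin_mono ?_
  rintro _ ⟨_, ⟨i, rfl⟩, rfl⟩
  fin_cases i
  · exact Or.inl rfl
  · exact Or.inr rfl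

/-- The universal property of a down-up algebra. -/
lemma exists_algHom {E : Type*} [Ring E] [Algebra K E] {x y : E}
    (h₁ : x * x * y = α • (x * y * x) + β • (y * x * x) + γ • x)
    (h₂ : x * y * y = α • (y * x * y) + β • (y * y * x) + γ • y) :
    ∃ φ : DownUpAlgebra K α β γ →ₐ[K] E, φ (d K α β γ) = x ∧ φ (u K α β γ) = y := by
  refine ⟨RingQuot.liftAlgHom K ⟨FreeAlgebra.lift K ![x, y], ?_⟩, ?_, ?_⟩
  · rintro _ _ (_ | _)
    · simpa using h₁
    · simpa using h₂
  · simp [d]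
  · simp [u]

open SkewExtension in
/-- If a root of the defining polynomial is not a root of unity, then some finitely generated
essential extension of a simple module is not Artinian. -/
theorem exists_not_isArtinian {q κ : K} (hq : q * q = α * q + β) (hκ : κ * (1 - α - β) = γ)
    (hq0 : q ≠ 0) (hroot : ∀ k : ℕ, 0 < k → q ^ k ≠ 1) :
    ∃ (M : Type) (_ : AddCommGroup M) (_ : Module (DownUpAlgebra K α β γ) M),
      Module.Finite (DownUpAlgebra K α β γ) M ∧
      (∃ V : Submodule (DownUpAlgebra K α β γ) M, IsSimpleModule (DownUpAlgebra K α β γ) V ∧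
        ∀ N : Submodule (DownUpAlgebra K α β γ) M, N ≠ ⊥ → N ⊓ V ≠ ⊥) ∧
      ¬ IsArtinian (DownUpAlgebra K α β γ) M := by
  obtain ⟨h₁, h₂⟩ := downUp_relations_of_mul_eq_smul_mul (E := Module.End K (Space K)) hq hκ
    (up_mul_upInv hq0) (upInv_mul_up hq0) (θ_mul_up hq0) (d := upInv q * (θ K + κ • 1)) rfl
  obtain ⟨φ, hφd, hφu⟩ := exists_algHom h₁ h₂
  let _ : Module (DownUpAlgebra K α β γ) (Space K) := Module.compHom _ φ.toRingHom
  have hsmul : ∀ (a : DownUpAlgebra K α β γ) (x : Space K), a • x = φ a x := fun _ _ => rfl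
  have _ : IsScalarTower K (DownUpAlgebra K α β γ) (Space K) :=
    ⟨fun k a x => by rw [hsmul, hsmul, map_smul]; rfl⟩
  have hup : ∀ (N : Submodule (DownUpAlgebra K α β γ) (Space K)),
      ∀ x ∈ N.restrictScalars K, up q x ∈ N.restrictScalars K := fun N x hx => by
    have := N.smul_mem (u K α β γ) hx
    rwa [hsmul, hφu] at this
  have hθ : ∀ (N : Submodule (DownUpAlgebra K α β γ) (Space K)),
      ∀ x ∈ N.restrictScalars K, θ K x ∈ N.restrictScalars K := fun N x hx => by
    have := N.smul_mem (u K α β γ * d K α β γ) hx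
    rw [hsmul, map_mul, hφu, hφd, ← mul_assoc, up_mul_upInv hq0, one_mul] at this
    have h2 := sub_mem (show _ ∈ N.restrictScalars K from this) ((N.restrictScalars K).smul_mem κ hx)
    simpa using h2
  have hlift : ∀ N : Submodule K (Space K), (∀ x ∈ N, φ (d K α β γ) x ∈ N) →
      (∀ x ∈ N, φ (u K α β γ) x ∈ N) → ∀ (a : DownUpAlgebra K α β γ), ∀ x ∈ N, φ a x ∈ N := by
    intro N hd hu a
    have ha : a ∈ Algebra.adjoin K {d K α β γ, u K α β γ} := by
      rw [adjoin_d_u]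
      exact Algebra.mem_top
    induction ha using Algebra.adjoin_induction with
    | mem y hy =>
      obtain rfl | rfl := hy
      exacts [hd, hu]
    | algebraMap k => exact fun x hx => by simpa using N.smul_mem k hx
    | add y y' _ _ h h' => exact fun x hx => by simpa using add_mem (h x hx) (h' x hx)
    | mul y y' _ _ h h' => exact fun x hx => by simpa using h _ (h' x hx)
  let F : ℕ → Submodule (DownUpAlgebra K α β γ) (Space K) := fun n =>
    { carrier := {x : Space K | ∀ k < n, x.2 k = 0}
      zero_mem' := fun k _ => rfl
      add_mem' := fun hx hy k hk => by simp [hx k hk, hy k hk]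
      smul_mem' := fun a x hx => by
        refine hlift
          { carrier := {x : Space K | ∀ k < n, x.2 k = 0}
            zero_mem' := fun k _ => rfl
            add_mem' := fun hx hy k hk => by simp [hx k hk, hy k hk]
            smul_mem' := fun c x hx k hk => by simp [hx k hk] }
          (fun y hy k hk => ?_) (fun y hy k hk => ?_) a x hx
        · rw [hφd, Module.End.mul_apply, snd_upInv]
          simp [snd_θ_apply_eq_zero hy hk, hy k hk]
        · rw [hφu, snd_up, hy k hk, mul_zero] }
  let V : Submodule (DownUpAlgebra K α β γ) (Space K) := ⨅ n, F n
  have hV : ∀ x, x ∈ V ↔ x.2 = 0 := fun x => by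
    rw [Submodule.mem_iInf]
    exact ⟨fun h => Finsupp.ext fun k => h (k + 1) k (Nat.lt_succ_self k),
      fun h n k _ => by rw [h, Finsupp.zero_apply]⟩
  refine ⟨Space K, inferInstance, inferInstance, ⟨{(wv 0 : Space K)}, ?_⟩, ⟨V, ?_, fun N hN => ?_⟩, fun h => ?_⟩
  · refine eq_top_iff.2 fun x _ => ?_
    have h0 := Submodule.subset_span (R := DownUpAlgebra K α β γ)
      (Finset.mem_coe.2 (Finset.mem_singleton_self (wv 0 : Space K)))
    exact le_of_wv_zero_mem hq0 (hup (Submodule.span _ _)) (hθ _) h0 x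
  · rw [isSimpleModule_iff_isAtom]
    refine ⟨fun h => ?_, fun N hN => ?_⟩
    · have h0 : (sv 0 : Space K) ∈ V := (hV _).2 rfl
      rw [h, Submodule.mem_bot] at h0
      simpa using congrArg Prod.fst h0
    · by_contra h0
      obtain ⟨x, hx, hx0⟩ := N.ne_bot_iff.1 h0
      exact hN.not_ge fun y hy =>
        mem_of_snd_eq_zero hq0 hroot (hup N) (hθ N) hx hx0 ((hV x).1 (hN.le hx)) ((hV y).1 hy)
  · obtain ⟨x, hx, hx0⟩ := N.ne_bot_iff.1 hN
    obtain ⟨y, hy, hy0, hy2⟩ := exists_mem_snd_eq_zero hq0 hroot (hup N) hx hx0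
    exact (Submodule.ne_bot_iff _).2 ⟨y, ⟨hy, (hV y).2 hy2⟩, hy0⟩
  · obtain ⟨n, hn⟩ := IsArtinian.monotone_stabilizes
      ⟨fun n => OrderDual.toDual (F n), fun m n hmn x hx k hk => hx k (hk.trans_le hmn)⟩
    have hw : (wv n : Space K) ∈ F n := fun k hk => by simp [hk.ne']
    rw [show F n = F (n + 1) from hn (n + 1) (Nat.le_succ n)] at hw
    simpa using hw n (Nat.lt_succ_self n)

end DownUpAlgebra

/-- A nonzero element of an essential simple submodule lies in every nonzero submodule. -/
lemma exists_isMonolithElement {R M : Type*} [Ring R] [AddCommGroup M] [Module R M]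
    {V : Submodule R M} (hV : IsSimpleModule R V) (hess : ∀ N : Submodule R M, N ≠ ⊥ → N ⊓ V ≠ ⊥) :
    ∃ m : M, IsMonolithElement R m := by
  have hatom := isSimpleModule_iff_isAtom.1 hV
  obtain ⟨m, hm, hm0⟩ := V.ne_bot_iff.1 hatom.1
  refine ⟨m, hm0, fun x hx => Submodule.mem_span_singleton.1 ?_⟩
  have h := hess (Submodule.span R {x}) (by simpa using hx)
  have hle := (hatom.le_iff.1 (inf_le_right : Submodule.span R {x} ⊓ V ≤ V)).resolve_left h
  exact (hle.ge.trans inf_le_left) hm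

/-- If all finitely generated monolithic modules are Artinian, then the roots of the defining
polynomial are roots of unity. -/
lemma DownUpAlgebra.exists_pow_eq_one {K : Type} [Field K] {α β γ r s : K} (hβ : β ≠ 0)
    (hsum : r + s = α) (hprod : r * s = -β)
    (hassume : α + β = 1 → γ ≠ 0 → ∃ k : ℕ, 0 < k ∧ β ^ k = 1)
    (h : ∀ (M : Type) [AddCommGroup M] [Module (DownUpAlgebra K α β γ) M],
      Module.Finite (DownUpAlgebra K α β γ) M →
      (∃ V : Submodule (DownUpAlgebra K α β γ) M,
        IsSimpleModule (DownUpAlgebra K α β γ) V ∧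
        ∀ N : Submodule (DownUpAlgebra K α β γ) M, N ≠ ⊥ → N ⊓ V ≠ ⊥) →
      IsArtinian (DownUpAlgebra K α β γ) M) :
    ∃ k : ℕ, 0 < k ∧ r ^ k = 1 := by
  by_contra! hroot
  have hr0 : r ≠ 0 := by
    rintro rfl
    exact hβ (by simpa using hprod)
  have hr : r * r = α * r + β := by linear_combination r * hsum - hprod
  obtain ⟨κ, hκ⟩ : ∃ κ : K, κ * (1 - α - β) = γ := by
    by_cases hab : 1 - α - β = 0
    · have hγ : γ = 0 := by
        by_contra hγ
        obtain ⟨k, hk, e⟩ := hassume (by linear_combination -hab) hγ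
        have hrs : (1 - r) * (1 - s) = 0 := by linear_combination hab - hsum + hprod
        rcases mul_eq_zero.1 hrs with h1 | h1
        · exact hroot 1 one_pos (by linear_combination -h1)
        · have : r = -β := by linear_combination hprod + r * h1
          exact hroot (2 * k) (by omega) (by rw [this, pow_mul, neg_sq, ← pow_mul, mul_comm,
            pow_mul, e, one_pow])
      exact ⟨0, by rw [hγ, zero_mul]⟩
    · exact ⟨γ / (1 - α - β), div_mul_cancel₀ _ hab⟩
  obtain ⟨M, _, _, hfin, hmono, hart⟩ := exists_not_isArtinian hr hκ hr0 hroot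
  exact hart (h M hfin hmono)

end

/-- **Main theorem.**  Let `A = A(α, β, γ)` be a Noetherian down-up algebra (`β ≠ 0`),
where `X² - αX - β` has roots `r, s ∈ K`, and assume that if `α + β = 1` and `γ ≠ 0`
then `β` is a root of unity.  Then every finitely generated monolithic `A`-module
(a finitely generated module with a simple submodule meeting every nonzero submodule
nontrivially) is Artinian if and only if `r` and `s` are roots of unity. -/
theorem downUp_diamond_iff_roots_of_unity (K : Type) [Field K] (α β γ r s : K)
    (hβ : β ≠ 0) (hsum : r + s = α) (hprod : r * s = -β)
    (hassume : α + β = 1 → γ ≠ 0 → ∃ k : ℕ, 0 < k ∧ β ^ k = 1) :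
    (∀ (M : Type) [AddCommGroup M] [Module (DownUpAlgebra K α β γ) M],
      Module.Finite (DownUpAlgebra K α β γ) M →
      (∃ V : Submodule (DownUpAlgebra K α β γ) M,
        IsSimpleModule (DownUpAlgebra K α β γ) V ∧
        ∀ N : Submodule (DownUpAlgebra K α β γ) M, N ≠ ⊥ → N ⊓ V ≠ ⊥) →
      IsArtinian (DownUpAlgebra K α β γ) M) ↔
    ((∃ k : ℕ, 0 < k ∧ r ^ k = 1) ∧ (∃ k : ℕ, 0 < k ∧ s ^ k = 1)) := by
  refine ⟨fun h => ⟨DownUpAlgebra.exists_pow_eq_one hβ hsum hprod hassume h,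
    DownUpAlgebra.exists_pow_eq_one hβ ((add_comm s r).trans hsum) ((mul_comm s r).trans hprod)
      hassume h⟩, ?_⟩
  rintro ⟨⟨k, hk, hr⟩, l, hl, hs⟩ M _ _ _ ⟨V, hV, hess⟩
  obtain ⟨m, hm⟩ := exists_isMonolithElement hV hess
  exact isArtinian_of_pow_eq_one hsum hprod DownUpAlgebra.relation_d DownUpAlgebra.relation_u
    DownUpAlgebra.adjoin_d_u (mul_pos hk hl).ne' (by rw [pow_mul, hr, one_pow])
    (by rw [mul_comm, pow_mul, hs, one_pow]) hm

end
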